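/- Let K be a quadratic field and let c ∈ K. (i) If f_c admits both a fixed point in K and a point of exact period 3 in K, then c ∈ ℚ, every point of K of exact period 3 under f_c lies in ℚ, and no fixed point of f_c in K lies in ℚ. (ii) If f_c admits both a point of exact period 2 in K and a point of exact period 3 in K, then c ∈ ℚ, every point of K of exact period 3 under f_c lies in ℚ, and no point of K of exact period 2 under f_c lies in ℚ. -/

import Mathlib

/-- The quadratic map `z ↦ z ^ 2 + c`. -/
def fc {K : Type*} [Field K] (c : K) : K → K := fun z => z ^ 2 + c

/-- `α` has exact period `m` under `fc c`. -/
def HasExactPeriod {K : Type*} [Field K] (c : K) (m : ℕ) (α : K) : Prop :=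
  (fc c)^[m] α = α ∧ ∀ j : ℕ, 1 ≤ j → j < m → (fc c)^[j] α ≠ α

/-- `α` has preperiodic type `m_n` under `fc c`: preperiod exactly `n`, eventual period `m`. -/
def HasPreperiodicType {K : Type*} [Field K] (c : K) (m n : ℕ) (α : K) : Prop :=
  HasExactPeriod c m ((fc c)^[n] α) ∧ (fc c)^[n + m - 1] α ≠ (fc c)^[n - 1] α

/-- The binary quadratic form with coefficients `A`. -/
def quadForm {R : Type*} [CommRing R] (A : Fin 3 → R) (x z : R) : R :=
  A 0 * z ^ 2 + A 1 * (x * z) + A 2 * x ^ 2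

/-- The binary cubic form with coefficients `B`. -/
def cubForm {R : Type*} [CommRing R] (B : Fin 4 → R) (x z : R) : R :=
  B 0 * z ^ 3 + B 1 * (x * z ^ 2) + B 2 * (x ^ 2 * z) + B 3 * x ^ 3

/-- The binary quartic form with coefficients `C`. -/
def quarForm {R : Type*} [CommRing R] (C : Fin 5 → R) (x z : R) : R :=
  C 0 * z ^ 4 + C 1 * (x * z ^ 3) + C 2 * (x ^ 2 * z ^ 2) + C 3 * (x ^ 3 * z) + C 4 * x ^ 4

/-- The cubic form `x³ + x²z - 2xz² - z³`. -/
def hForm {R : Type*} [CommRing R] (x z : R) : R := x ^ 3 + x ^ 2 * z - 2 * (x * z ^ 2) - z ^ 3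

/-- The cubic form `xz(x + z)`. -/
def bForm {R : Type*} [CommRing R] (x z : R) : R := x ^ 2 * z + x * z ^ 2

/-- The sextic form `h² + 4mb²`. -/
def sexticForm {R : Type*} [CommRing R] (m : R) (x z : R) : R :=
  hForm x z ^ 2 + 4 * m * bForm x z ^ 2

theorem sextic_coeff_eq_zero {e₀ e₁ e₂ e₃ e₄ e₅ e₆ : ℤ}
    (h : ∀ x : ℤ, e₀ + e₁ * x + e₂ * x ^ 2 + e₃ * x ^ 3 + e₄ * x ^ 4 + e₅ * x ^ 5 + e₆ * x ^ 6 = 0) :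
    e₀ = 0 ∧ e₁ = 0 ∧ e₂ = 0 ∧ e₃ = 0 ∧ e₄ = 0 ∧ e₅ = 0 ∧ e₆ = 0 := by
  have h0 := h 0
  have h1 := h 1
  have h2 := h (-1)
  have h3 := h 2
  have h4 := h (-2)
  have h5 := h 3
  have h6 := h (-3)
  norm_num at h0 h1 h2 h3 h4 h5 h6
  omega

/-- The coefficients of the square of a quadratic form. -/
def sqCoeff {R : Type*} [CommRing R] (N : Fin 3 → R) : Fin 5 → R :=
  ![N 0 ^ 2, 2 * N 0 * N 1, 2 * N 0 * N 2 + N 1 ^ 2, 2 * N 1 * N 2, N 2 ^ 2]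

/-- The coefficients of `A * Q - (α * M² + κ * h * M - β * κ² * b²)`. -/
def descentDefect {R : Type*} [CommRing R] (α β κ : R) (A : Fin 3 → R) (Q : Fin 5 → R)
    (M : Fin 4 → R) : Fin 7 → R :=
  ![A 0 * Q 0 - (α * M 0 ^ 2 - κ * M 0),
    A 0 * Q 1 + A 1 * Q 0 - (2 * α * M 0 * M 1 - κ * M 1 - 2 * κ * M 0),
    A 0 * Q 2 + A 1 * Q 1 + A 2 * Q 0 -
      (α * (2 * M 0 * M 2 + M 1 ^ 2) + κ * (-M 2 - 2 * M 1 + M 0) - β * κ ^ 2),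
    A 0 * Q 3 + A 1 * Q 2 + A 2 * Q 1 -
      (2 * α * (M 0 * M 3 + M 1 * M 2) + κ * (-M 3 - 2 * M 2 + M 1 + M 0) - 2 * β * κ ^ 2),
    A 0 * Q 4 + A 1 * Q 3 + A 2 * Q 2 -
      (α * (2 * M 1 * M 3 + M 2 ^ 2) + κ * (-2 * M 3 + M 2 + M 1) - β * κ ^ 2),
    A 1 * Q 4 + A 2 * Q 3 - (2 * α * M 2 * M 3 + κ * (M 3 + M 2)),
    A 2 * Q 4 - (α * M 3 ^ 2 + κ * M 3)]

theorem descentDefect_eq_zero {α β κ : ℤ} {A : Fin 3 → ℤ} {Q : Fin 5 → ℤ} {M : Fin 4 → ℤ}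
    (h : ∀ x z : ℤ, quadForm A x z * quarForm Q x z =
      α * cubForm M x z ^ 2 + κ * (hForm x z * cubForm M x z) - β * κ ^ 2 * bForm x z ^ 2) :
    descentDefect α β κ A Q M = 0 := by
  have := sextic_coeff_eq_zero (e₀ := descentDefect α β κ A Q M 0)
    (e₁ := descentDefect α β κ A Q M 1) (e₂ := descentDefect α β κ A Q M 2)
    (e₃ := descentDefect α β κ A Q M 3) (e₄ := descentDefect α β κ A Q M 4)
    (e₅ := descentDefect α β κ A Q M 5) (e₆ := descentDefect α β κ A Q M 6) (fun x => by
      have := h x 1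
      simp only [quadForm, cubForm, hForm, bForm, quarForm] at this
      simp [descentDefect]
      linear_combination this)
  ext i
  fin_cases i <;> simp_all

theorem map_descentDefect {R S : Type*} [CommRing R] [CommRing S] (f : R →+* S) (α β κ : R)
    (A : Fin 3 → R) (Q : Fin 5 → R) (M : Fin 4 → R) (i : Fin 7) :
    f (descentDefect α β κ A Q M i) =
      descentDefect (f α) (f β) (f κ) (fun i => f (A i)) (fun i => f (Q i)) (fun i => f (M i)) i := by
  fin_cases i <;> simp [descentDefect, map_ofNat]

theorem map_sqCoeff {R S : Type*} [CommRing R] [CommRing S] (f : R →+* S) (N : Fin 3 → R)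
    (i : Fin 5) : f (sqCoeff N i) = sqCoeff (fun i => f (N i)) i := by
  fin_cases i <;> simp [sqCoeff, map_ofNat]

theorem quarForm_sqCoeff {R : Type*} [CommRing R] (N : Fin 3 → R) (x z : R) :
    quarForm (sqCoeff N) x z = quadForm N x z ^ 2 := by
  simp [quarForm, sqCoeff, quadForm]; ring

/-- The seven forms cut out by the rational torsion. -/
def torsionForms : List (Fin 3 → ℤ) :=
  [![0, 0, 1], ![1, 2, 1], ![1, 0, 0], ![0, 1, 1], ![0, 1, 0], ![1, 1, 0], ![1, 1, 1]]

/-- Exact solutions `(A, N, M, ρ, κ)` of the descent equation among the torsion forms. -/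
def torsionTable (α β : ℤ) : List ((Fin 3 → ℤ) × (Fin 3 → ℤ) × (Fin 4 → ℤ) × ℤ × ℤ) :=
  if α = 2 then
    [(![0, 0, 1], ![1, 1, 0], ![0, 0, 0, 0], -1, 1), (![1, 2, 1], ![0, 1, 0], ![0, 0, 0, 0], -1, 1),
     (![1, 0, 0], ![0, 1, 1], ![0, 0, 0, 0], -1, 1), (![0, 1, 1], ![1, 2, 1], ![0, -1, -2, -1], 1, 1),
     (![0, 1, 0], ![0, 0, 1], ![0, 0, -1, 0], -1, 1), (![1, 1, 0], ![1, 0, 0], ![1, 1, 0, 0], 1, 1),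
     (![1, 1, 1], ![1, 1, 1], ![1, 3, 0, -1], -1, 3)]
  else if β = 2 then
    [(![0, 1, 1], ![1, 1, 0], ![0, 1, 0, 0], -1, 1), (![0, 1, 1], ![1, 1, 0], ![1, 1, -1, -1], -1, 1),
     (![0, 1, 0], ![0, 1, 1], ![0, 0, -2, -1], 1, 1), (![0, 1, 0], ![0, 1, 1], ![1, 2, 1, 0], 1, 1),
     (![1, 1, 0], ![0, 1, 0], ![0, 0, -1, -1], -1, 1), (![1, 1, 0], ![0, 1, 0], ![1, 2, 0, 0], -1, 1)]
  else
    [(![0, 0, 1], ![1, 1, 0], ![0, 0, 0, 0], -1, 1), (![0, 0, 1], ![1, 1, 0], ![1, 2, -1, -1], -1, 1),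
     (![1, 2, 1], ![0, 1, 0], ![0, 0, 0, 0], -1, 1), (![1, 2, 1], ![0, 1, 0], ![1, 2, -1, -1], -1, 1),
     (![1, 0, 0], ![0, 1, 1], ![0, 0, 0, 0], -1, 1), (![1, 0, 0], ![0, 1, 1], ![1, 2, -1, -1], -1, 1),
     (![0, 1, 1], ![1, 0, 0], ![0, 1, -1, -1], -1, 1), (![0, 1, 1], ![1, 0, 0], ![1, 1, 0, 0], -1, 1),
     (![0, 1, 1], ![0, 1, 0], ![0, 0, -1, -1], 1, 1), (![0, 1, 1], ![0, 1, 0], ![1, 2, 0, 0], 1, 1),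
     (![0, 1, 0], ![1, 2, 1], ![0, -1, -2, -1], 1, 1), (![0, 1, 0], ![1, 2, 1], ![1, 3, 1, 0], 1, 1),
     (![0, 1, 0], ![1, 1, 0], ![0, 1, 0, 0], -1, 1), (![0, 1, 0], ![1, 1, 0], ![1, 1, -1, -1], -1, 1),
     (![1, 1, 0], ![0, 0, 1], ![0, 0, -1, 0], -1, 1), (![1, 1, 0], ![0, 0, 1], ![1, 2, 0, -1], -1, 1),
     (![1, 1, 0], ![0, 1, 1], ![0, 0, -2, -1], 1, 1), (![1, 1, 0], ![0, 1, 1], ![1, 2, 1, 0], 1, 1)]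

theorem torsionTable_spec {α β : ℤ} (h : (α, β) ∈ [((1 : ℤ), (1 : ℤ)), (1, 2), (2, 1)]) :
    ∀ t ∈ torsionTable α β, t.1 ∈ torsionForms ∧ t.2.1 ∈ torsionForms ∧ t.2.2.2.1 % 2 = 1 ∧
      t.2.2.2.2 % 2 = 1 ∧
      descentDefect α β t.2.2.2.2 (fun i => t.2.2.2.1 * t.1 i) (sqCoeff t.2.1) t.2.2.1 = 0 := by
  simp only [List.mem_cons, Prod.mk.injEq, List.not_mem_nil, or_false] at h
  rcases h with ⟨rfl, rfl⟩ | ⟨rfl, rfl⟩ | ⟨rfl, rfl⟩ <;> decide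

set_option synthInstance.maxSize 2000 in
set_option synthInstance.maxHeartbeats 400000 in
theorem mem_torsionTable_mod_two :
    ∀ p ∈ [((1 : ℤ), (1 : ℤ)), (1, 2), (2, 1)], ∀ a₀ a₁ a₂ n₀ n₁ n₂ m₀ m₁ m₂ m₃ : ZMod 2,
      descentDefect (p.1 : ZMod 2) p.2 1 ![a₀, a₁, a₂] (sqCoeff ![n₀, n₁, n₂]) ![m₀, m₁, m₂, m₃] = 0 →
      ¬(n₀ = 0 ∧ n₁ = 0 ∧ n₂ = 0) → ¬(a₀ = 0 ∧ a₁ = 0 ∧ a₂ = 0) →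
      ∃ t ∈ torsionTable p.1 p.2, (fun i => (t.1 i : ZMod 2)) = ![a₀, a₁, a₂] ∧
        (fun i => (t.2.1 i : ZMod 2)) = ![n₀, n₁, n₂] ∧
        (fun i => (t.2.2.1 i : ZMod 2)) = ![m₀, m₁, m₂, m₃] := by
  decide +kernel

/-- Modulo 2, the irreducible cubic `h` divides no product of a quadratic form with the square of
another one. -/
theorem mod_two_rigidity :
    ∀ a₀ a₁ a₂ n₀ n₁ n₂ d₀ d₁ d₂ d₃ : ZMod 2, ¬(n₀ = 0 ∧ n₁ = 0 ∧ n₂ = 0) →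
      descentDefect 0 0 1 ![a₀, a₁, a₂] (sqCoeff ![n₀, n₁, n₂]) ![d₀, d₁, d₂, d₃] = 0 →
      (a₀ = 0 ∧ a₁ = 0 ∧ a₂ = 0) ∧ (d₀ = 0 ∧ d₁ = 0 ∧ d₂ = 0 ∧ d₃ = 0) := by
  decide +kernel

theorem descentDefect_add {R : Type*} [CommRing R] (α β κ t : R) (A A' : Fin 3 → R)
    (Q : Fin 5 → R) (M M' : Fin 4 → R) (i : Fin 7) :
    descentDefect α β κ (fun i => A i + t * A' i) Q (fun i => M i + t * M' i) i =
      descentDefect α β κ A Q M i + t * (descentDefect 0 0 κ A' Q M' i) -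
      t * α * (2 * ![M 0 * M' 0, M 0 * M' 1 + M 1 * M' 0,
        M 0 * M' 2 + M 1 * M' 1 + M 2 * M' 0,
        M 0 * M' 3 + M 1 * M' 2 + M 2 * M' 1 + M 3 * M' 0,
        M 1 * M' 3 + M 2 * M' 2 + M 3 * M' 1, M 2 * M' 3 + M 3 * M' 2,
        M 3 * M' 3] i + t * (![M' 0 ^ 2, 2 * M' 0 * M' 1, 2 * M' 0 * M' 2 + M' 1 ^ 2,
          2 * (M' 0 * M' 3 + M' 1 * M' 2), 2 * M' 1 * M' 3 + M' 2 ^ 2, 2 * M' 2 * M' 3,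
          M' 3 ^ 2] i)) := by
  fin_cases i <;> simp [descentDefect] <;> ring

theorem descentDefect_smul {R : Type*} [CommRing R] (α β κ ρ u v : R) (A : Fin 3 → R)
    (Q : Fin 5 → R) (M : Fin 4 → R) (i : Fin 7) :
    descentDefect α β (v * κ) (fun i => v ^ 2 * ρ * u * A i) Q (fun i => v * M i) i =
      v ^ 2 * descentDefect α β κ (fun i => ρ * A i) (fun i => u * Q i) M i := by
  fin_cases i <;> simp [descentDefect] <;> ring

theorem intCast_sqCoeff {R : Type*} [CommRing R] (N : Fin 3 → ℤ) (i : Fin 5) :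
    ((sqCoeff N i : ℤ) : R) = sqCoeff (fun i => (N i : R)) i :=
  map_sqCoeff (Int.castRingHom R) N i

theorem intCast_zmod_two_eq_zero_iff (a : ℤ) : (a : ZMod 2) = 0 ↔ 2 ∣ a := by
  exact_mod_cast ZMod.intCast_zmod_eq_zero_iff_dvd a 2

theorem intCast_zmod_two_of_odd {a : ℤ} (h : Odd a) : (a : ZMod 2) = 1 := by
  obtain ⟨k, rfl⟩ := h
  push_cast
  rw [show (2 : ZMod 2) = 0 from rfl]; ring

theorem exists_odd_iff_zmod_two (A : Fin 3 → ℤ) : (∃ i, Odd (A i)) ↔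
    ¬((A 0 : ZMod 2) = 0 ∧ (A 1 : ZMod 2) = 0 ∧ (A 2 : ZMod 2) = 0) := by
  simp only [intCast_zmod_two_eq_zero_iff, ← even_iff_two_dvd, Fin.exists_fin_succ,
    ← Int.not_even_iff_odd]
  simp [-Int.not_even_iff_odd]
  tauto

theorem two_dvd_of_descentDefect {κ : ℤ} (hκ : Odd κ) {A N : Fin 3 → ℤ} {M : Fin 4 → ℤ}
    (hN : ∃ i, Odd (N i)) (h : ∀ i, 2 ∣ descentDefect 0 0 κ A (sqCoeff N) M i) :
    (∀ i, 2 ∣ A i) ∧ ∀ i, 2 ∣ M i := by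
  have key := mod_two_rigidity (A 0) (A 1) (A 2) (N 0) (N 1) (N 2) (M 0) (M 1) (M 2) (M 3)
    ((exists_odd_iff_zmod_two N).1 hN) (by
      ext i
      have := (intCast_zmod_two_eq_zero_iff _).2 (h i)
      rw [← eq_intCast (Int.castRingHom (ZMod 2)), map_descentDefect] at this
      simp only [intCast_sqCoeff, eq_intCast, intCast_zmod_two_of_odd hκ, Int.cast_zero] at this
      rw [Pi.zero_apply]
      convert this using 2
      · ext i; fin_cases i <;> rfl
      · congr 1; ext i; fin_cases i <;> rfl
      · ext i; fin_cases i <;> rfl)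
  simp only [intCast_zmod_two_eq_zero_iff] at key
  obtain ⟨⟨a, b, d⟩, e, f, g, k⟩ := key
  constructor <;> intro i <;> fin_cases i <;> simpa

/-- Two solutions modulo `2 ^ n` with the same reduction modulo 2 have the same `A`. -/
theorem descent_lift_unique {α β κ : ℤ} (hκ : Odd κ) {A A' N : Fin 3 → ℤ} {M M' : Fin 4 → ℤ}
    (hN : ∃ i, Odd (N i)) {n : ℕ} (h : descentDefect α β κ A (sqCoeff N) M = 0)
    (h' : ∀ i, 2 ^ n ∣ descentDefect α β κ A' (sqCoeff N) M' i)
    (hA : ∀ i, 2 ∣ A' i - A i) (hM : ∀ i, 2 ∣ M' i - M i) : ∀ i, 2 ^ n ∣ A' i - A i := by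
  have main : ∀ j, j + 1 ≤ n → (∀ i, 2 ^ (j + 1) ∣ A' i - A i) ∧ ∀ i, 2 ^ (j + 1) ∣ M' i - M i := by
    intro j
    induction j with
    | zero => intro _; simpa using ⟨hA, hM⟩
    | succ j ih =>
      intro hj
      obtain ⟨iA, iM⟩ := ih (by omega)
      choose a ha using iA
      choose d hd using iM
      have hA' : A' = fun i => A i + 2 ^ (j + 1) * a i := by ext i; linear_combination ha i
      have hM' : M' = fun i => M i + 2 ^ (j + 1) * d i := by ext i; linear_combination hd i
      have := two_dvd_of_descentDefect (A := a) (M := d) hκ hN (fun i => by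
        have h1 := (pow_dvd_pow 2 hj).trans (h' i)
        rw [hA', hM', descentDefect_add, h, Pi.zero_apply, zero_add, pow_succ 2 (j + 1), mul_assoc,
          ← mul_sub] at h1
        have h2 := (mul_dvd_mul_iff_left (by positivity)).1 h1
        refine (dvd_sub_left ?_).1 h2
        refine Dvd.dvd.mul_left (dvd_add (dvd_mul_right _ _) ?_) _
        exact Dvd.dvd.mul_right (dvd_pow_self 2 (by omega)) _)
      constructor
      · intro i
        rw [ha i, pow_succ]
        exact mul_dvd_mul_left _ (this.1 i)
      · intro i
        rw [hd i, pow_succ]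
        exact mul_dvd_mul_left _ (this.2 i)
  rcases n with _ | n
  · simp
  · exact (main n le_rfl).1

/-- `A` is proportional to a torsion form modulo `2 ^ n`. -/
def NearTorsion (n : ℕ) (A : Fin 3 → ℤ) : Prop :=
  ∃ T ∈ torsionForms, ∃ u : ℤ, Odd u ∧ ∀ i, 2 ^ n ∣ A i - u * T i

theorem torsionForms_mod_two : ∀ S ∈ torsionForms, ∀ T ∈ torsionForms,
    (∀ i, 2 ∣ S i - T i) → S = T := by decide

theorem exists_odd_of_mem_torsionForms : ∀ T ∈ torsionForms, ∃ i, T i % 2 = 1 := by decide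

theorem exists_odd_mul_modEq {κ κ' : ℤ} (hκ : Odd κ) (hκ' : Odd κ') (n : ℕ) :
    ∃ v : ℤ, Odd v ∧ 2 ^ (n + 1) ∣ v * κ - κ' := by
  have hc : IsCoprime κ (2 ^ (n + 1)) := by
    obtain ⟨j, rfl⟩ := hκ
    exact IsCoprime.pow_right ⟨1, -j, by ring⟩
  obtain ⟨a, b, hab⟩ := hc
  have h2 : a * κ * κ' - κ' = 2 ^ (n + 1) * (-b * κ') := by linear_combination κ' * hab
  refine ⟨a * κ', ?_, -b * κ', by linear_combination h2⟩
  have : Odd (a * κ) := by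
    rw [show a * κ = 1 - b * (2 ^ (n + 1)) by linear_combination hab, pow_succ]
    exact odd_one.sub_even ⟨b * 2 ^ n, by ring⟩
  exact (Int.odd_mul.1 this).1.mul hκ'

theorem two_dvd_mul_sub_mul {a b u v : ℤ} (hu : Odd u) (hv : Odd v) (h : 2 ∣ a - b) :
    2 ∣ u * b - v * a := by
  obtain ⟨s, rfl⟩ := hu
  obtain ⟨t, rfl⟩ := hv
  obtain ⟨w, hw⟩ := h
  exact ⟨s * b - t * a - w, by linear_combination -hw⟩

theorem sqCoeff_eq_of_near {R : Type*} [CommRing R] {u t : R} {N S ν : Fin 3 → R}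
    (ht : 2 * t = 0) (ht' : t * t = 0) (h : ∀ i, N i = u * S i + t * ν i) :
    sqCoeff N = fun i => u ^ 2 * sqCoeff S i := by
  ext i
  fin_cases i <;> simp [sqCoeff, h]
  · linear_combination u * S 0 * ν 0 * ht + ν 0 ^ 2 * ht'
  · linear_combination u * (S 0 * ν 1 + S 1 * ν 0) * ht + 2 * ν 0 * ν 1 * ht'
  · linear_combination u * (S 0 * ν 2 + S 2 * ν 0 + S 1 * ν 1) * ht +
      (2 * ν 0 * ν 2 + ν 1 ^ 2) * ht'
  · linear_combination u * (S 1 * ν 2 + S 2 * ν 1) * ht + 2 * ν 1 * ν 2 * ht'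
  · linear_combination u * S 2 * ν 2 * ht + ν 2 ^ 2 * ht'

theorem NearTorsion.of_descent {ρ α β κ : ℤ} {A N : Fin 3 → ℤ} {M : Fin 4 → ℤ}
    (hαβ : (α, β) ∈ [((1 : ℤ), (1 : ℤ)), (1, 2), (2, 1)]) (hρ : Odd ρ) (hκ : Odd κ)
    (hA : ∃ i, Odd (A i)) (hN : ∃ i, Odd (N i))
    (hD : descentDefect α β κ (fun i => ρ * A i) (sqCoeff N) M = 0) {n : ℕ}
    (hn : NearTorsion (n + 1) N) : NearTorsion (n + 2) A := by
  have cc : ∀ a b : ℤ, (a : ZMod 2) = b → 2 ∣ a - b := fun a b hab => by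
    rw [← intCast_zmod_two_eq_zero_iff]; push_cast; rw [hab, sub_self]
  have hD2 : descentDefect (α : ZMod 2) β 1 ![(A 0 : ZMod 2), A 1, A 2]
      (sqCoeff ![(N 0 : ZMod 2), N 1, N 2]) ![(M 0 : ZMod 2), M 1, M 2, M 3] = 0 := by
    ext i
    have := congrArg (Int.castRingHom (ZMod 2)) (congrFun hD i)
    rw [map_descentDefect] at this
    simp only [intCast_sqCoeff, map_mul, eq_intCast, intCast_zmod_two_of_odd hκ,
      intCast_zmod_two_of_odd hρ, one_mul, Pi.zero_apply, Int.cast_zero] at this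
    rw [Pi.zero_apply]
    convert this using 2
    · ext i; fin_cases i <;> rfl
    · congr 1; ext i; fin_cases i <;> rfl
    · ext i; fin_cases i <;> rfl
  obtain ⟨⟨T, S, L, r, k⟩, ht, e1, e2, e3⟩ := mem_torsionTable_mod_two (α, β) hαβ _ _ _ _ _ _ _ _ _ _
    hD2 ((exists_odd_iff_zmod_two N).1 hN) ((exists_odd_iff_zmod_two A).1 hA)
  obtain ⟨hT, hS, hr, hk, hX⟩ := torsionTable_spec hαβ _ ht
  simp only at e1 e2 e3 hT hS hr hk hX
  rw [← Int.odd_iff] at hr hk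
  have hTA : ∀ i, 2 ∣ T i - A i := fun i => cc _ _ (by
    have := congrFun e1 i; fin_cases i <;> simpa using this)
  have hSN : ∀ i, 2 ∣ S i - N i := fun i => cc _ _ (by
    have := congrFun e2 i; fin_cases i <;> simpa using this)
  have hLM : ∀ i, 2 ∣ L i - M i := fun i => cc _ _ (by
    have := congrFun e3 i; fin_cases i <;> simpa using this)
  obtain ⟨S', hS', u, hu, huN⟩ := hn
  obtain rfl : S' = S := by
    refine torsionForms_mod_two _ hS' _ hS fun i => ?_
    have h1 := hSN i
    have h2 : 2 ∣ N i - u * S' i := (dvd_pow_self 2 (by omega)).trans (huN i)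
    obtain ⟨w, rfl⟩ := hu
    have h3 : S' i - S i = -(S i - N i) - (N i - (2 * w + 1) * S' i) - 2 * (w * S' i) := by ring
    rw [h3]
    exact dvd_sub (dvd_sub (h1.neg_right) h2) (dvd_mul_right _ _)
  obtain ⟨v, hv, hvκ⟩ := exists_odd_mul_modEq hκ hk (n + 1)
  have hodd : Odd (v ^ 2 * ρ * u ^ 2) := ((hv.pow).mul hρ).mul hu.pow
  have key : ∀ i, 2 ^ (n + 2) ∣ (v ^ 2 * ρ * u ^ 2) * A i - r * T i := by
    refine descent_lift_unique (M' := fun i => v * M i) hk (N := S')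
      (A := fun i => r * T i) (A' := fun i => (v ^ 2 * ρ * u ^ 2) * A i) ?_ hX ?_ ?_ ?_
    · obtain ⟨i, hi⟩ := exists_odd_of_mem_torsionForms _ hS
      exact ⟨i, Int.odd_iff.2 hi⟩
    · have z : ∀ a : ℤ, (a : ZMod (2 ^ (n + 2))) = 0 ↔ 2 ^ (n + 2) ∣ a := fun a => by
        exact_mod_cast ZMod.intCast_zmod_eq_zero_iff_dvd a (2 ^ (n + 2))
      choose ν hν using huN
      have h4 : (2 : ZMod (2 ^ (n + 2))) ^ (n + 2) = 0 := by
        have := (z (2 ^ (n + 2))).2 dvd_rfl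
        simpa using this
      have h5 : (k : ZMod (2 ^ (n + 2))) = v * κ := by
        have := (z _).2 hvκ
        push_cast at this
        exact (sub_eq_zero.1 this).symm
      have hq := sqCoeff_eq_of_near (R := ZMod (2 ^ (n + 2))) (u := u) (t := 2 ^ (n + 1))
        (N := fun i => (N i : ZMod (2 ^ (n + 2)))) (S := fun i => (S' i : ZMod (2 ^ (n + 2))))
        (ν := fun i => (ν i : ZMod (2 ^ (n + 2)))) (by rw [← h4]; ring)
        (by linear_combination 2 ^ n * h4) (fun i => by
          have := congrArg (Int.cast : ℤ → ZMod (2 ^ (n + 2))) (hν i)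
          push_cast at this
          linear_combination this)
      intro i
      have h6 := congrArg (Int.castRingHom (ZMod (2 ^ (n + 2)))) (congrFun hD i)
      rw [← z, ← eq_intCast (Int.castRingHom (ZMod (2 ^ (n + 2)))), map_descentDefect]
      rw [map_descentDefect] at h6
      simp only [intCast_sqCoeff, map_mul, map_pow, eq_intCast, Pi.zero_apply, Int.cast_zero] at h6 ⊢
      rw [h5, descentDefect_smul, ← hq, h6, mul_zero]
    · exact fun i => two_dvd_mul_sub_mul hodd hr (hTA i)
    · intro i
      have := two_dvd_mul_sub_mul hv odd_one (hLM i)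
      rwa [one_mul] at this
  obtain ⟨w, hw, hw'⟩ := exists_odd_mul_modEq hodd odd_one (n + 1)
  refine ⟨T, hT, w * r, hw.mul hr, fun i => ?_⟩
  have : A i - w * r * T i = w * (v ^ 2 * ρ * u ^ 2 * A i - r * T i) -
    (w * (v ^ 2 * ρ * u ^ 2) - 1) * A i := by ring
  rw [this]
  exact dvd_sub ((key i).mul_left _) (hw'.mul_right _)

theorem nearTorsion_one {A : Fin 3 → ℤ} (hA : ∃ i, Odd (A i)) : NearTorsion 1 A := by
  have key : ∀ a₀ a₁ a₂ : ZMod 2, ¬(a₀ = 0 ∧ a₁ = 0 ∧ a₂ = 0) →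
    ∃ T ∈ torsionForms, (T 0 : ZMod 2) = a₀ ∧ (T 1 : ZMod 2) = a₁ ∧ (T 2 : ZMod 2) = a₂ := by decide
  obtain ⟨T, hT, h0, h1, h2⟩ := key _ _ _ ((exists_odd_iff_zmod_two A).1 hA)
  refine ⟨T, hT, 1, odd_one, fun i => ?_⟩
  rw [pow_one, ← intCast_zmod_two_eq_zero_iff]
  fin_cases i <;> simp [*]

/-- A form which is near torsion at every level is proportional to a torsion form. -/
theorem exists_torsionForm_of_forall_near {A : Fin 3 → ℤ} (h : ∀ n, NearTorsion n A) :
    ∃ T ∈ torsionForms, ∀ i j, A i * T j = A j * T i := by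
  obtain ⟨T, hT, u, hu, hu'⟩ := h 1
  refine ⟨T, hT, fun i j => ?_⟩
  have main : ∀ n : ℕ, (2 : ℤ) ^ n ∣ A i * T j - A j * T i := by
    intro n
    obtain ⟨S, hS, w, hw, hw'⟩ := h (n + 1)
    obtain rfl : S = T := by
      refine torsionForms_mod_two _ hS _ hT fun i => ?_
      have h1 : (2 : ℤ) ∣ A i - u * T i := by simpa using hu' i
      have h2 : (2 : ℤ) ∣ A i - w * S i := (dvd_pow_self 2 (by omega)).trans (hw' i)
      obtain ⟨s, rfl⟩ := hu
      obtain ⟨t, rfl⟩ := hw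
      have : S i - T i = (A i - (2 * s + 1) * T i) - (A i - (2 * t + 1) * S i) +
        2 * (s * T i - t * S i) := by ring
      rw [this]
      exact dvd_add (dvd_sub h1 h2) (dvd_mul_right _ _)
    have : A i * S j - A j * S i = (A i - w * S i) * S j - (A j - w * S j) * S i := by ring
    rw [this]
    exact (pow_dvd_pow 2 (Nat.le_succ n)).trans
      (dvd_sub ((hw' i).mul_right _) ((hw' j).mul_right _))
  by_contra hne
  have hne' : A i * T j - A j * T i ≠ 0 := sub_ne_zero.2 hne
  have h1 := Int.le_of_dvd (abs_pos.2 hne') ((dvd_abs _ _).2 (main (A i * T j - A j * T i).natAbs))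
  rw [Int.abs_eq_natAbs] at h1
  have h2 := Nat.lt_two_pow_self (n := (A i * T j - A j * T i).natAbs)
  have h3 : (((2 ^ (A i * T j - A j * T i).natAbs : ℕ)) : ℤ) ≤ ((A i * T j - A j * T i).natAbs : ℤ) := by
    push_cast at h1 ⊢; exact h1
  omega

/-- The binary linear form with coefficients `l`. -/
def linForm {R : Type*} [CommRing R] (l : Fin 2 → R) (x z : R) : R := l 0 * z + l 1 * x

theorem eval_of_descentDefect_eq_zero {R : Type*} [CommRing R] {α β κ : R} {A : Fin 3 → R}
    {Q : Fin 5 → R} {M : Fin 4 → R} (h : descentDefect α β κ A Q M = 0) (x z : R) :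
    quadForm A x z * quarForm Q x z =
      α * cubForm M x z ^ 2 + κ * (hForm x z * cubForm M x z) - β * κ ^ 2 * bForm x z ^ 2 := by
  have e := fun i => congrFun h i
  have e0 := e 0
  have e1 := e 1
  have e2 := e 2
  have e3 := e 3
  have e4 := e 4
  have e5 := e 5
  have e6 := e 6
  simp [descentDefect] at e0 e1 e2 e3 e4 e5 e6
  simp only [quadForm, quarForm, cubForm, hForm, bForm]
  linear_combination z ^ 6 * e0 + x * z ^ 5 * e1 + x ^ 2 * z ^ 4 * e2 + x ^ 3 * z ^ 3 * e3 +
    x ^ 4 * z ^ 2 * e4 + x ^ 5 * z * e5 + x ^ 6 * e6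

theorem exists_two_pow_mul_odd {ι : Type*} {f : ι → ℤ} (hf : ∃ i, f i ≠ 0) :
    ∃ (n : ℕ) (g : ι → ℤ), (∀ i, f i = 2 ^ n * g i) ∧ ∃ i, Odd (g i) := by
  obtain ⟨i, hi⟩ := hf
  induction hk : (f i).natAbs using Nat.strong_induction_on generalizing f with
  | _ k ih =>
    by_cases h : ∃ j, Odd (f j)
    · exact ⟨0, f, by simp, h⟩
    · simp only [not_exists, Int.not_odd_iff_even, even_iff_two_dvd] at h
      choose g hg using h
      have hgi := hg i
      obtain ⟨n, g', h1, h2⟩ := ih (g i).natAbs (by omega) (f := g) (by omega) rfl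
      exact ⟨n + 1, g', fun j => by rw [hg, h1]; ring, h2⟩

theorem exists_odd_quadForm {N : Fin 3 → ℤ} (hN : ∃ i, Odd (N i)) :
    ∃ x z, Odd (quadForm N x z) := by
  by_contra! h
  have h0 := h 0 1
  have h1 := h 1 0
  have h2 := h 1 1
  simp only [quadForm, Int.not_odd_iff_even] at h0 h1 h2
  obtain ⟨i, hi⟩ := hN
  ring_nf at h0 h1 h2
  have : ∀ i, Even (N i) := by
    intro i
    fin_cases i
    · exact h0
    · simp only [Int.even_iff] at *; simp; omega
    · exact h1
  exact Int.not_even_iff_odd.2 hi (this i)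

theorem odd_hForm {x z : ℤ} (h : Odd x ∨ Odd z) : Odd (hForm x z) := by
  simp only [hForm, Int.even_sub, Int.even_add, Int.even_mul, Int.even_pow,
    ← Int.not_even_iff_odd] at *
  have : Even (2 : ℤ) := even_two
  by_cases hx : Even x <;> by_cases hz : Even z <;> simp_all

theorem forms_modEq (N : Fin 3 → ℤ) (C : Fin 5 → ℤ) {x x' z z' t : ℤ} (hx : x' ≡ x [ZMOD t])
    (hz : z' ≡ z [ZMOD t]) : quadForm N x' z' ≡ quadForm N x z [ZMOD t] ∧
      quarForm C x' z' ≡ quarForm C x z [ZMOD t] ∧ hForm x' z' ≡ hForm x z [ZMOD t] := by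
  simp only [quadForm, quarForm, hForm]
  refine ⟨?_, ?_, ?_⟩ <;> gcongr

theorem odd_of_mul_sq_eq {A : Fin 3 → ℤ} {l : Fin 2 → ℤ} {N : Fin 3 → ℤ} {B : Fin 4 → ℤ}
    {C : Fin 5 → ℤ} {k R e : ℤ} (hA : ∃ i, Odd (A i)) (hl : ∃ i, Odd (l i)) (he : Even e)
    (h : ∀ x z, R * quadForm N x z ^ 2 = quadForm A x z * linForm l x z ^ 2 +
      e * linForm l x z * (2 * cubForm B x z + k * hForm x z) + e ^ 2 * quarForm C x z) :
    Odd R := by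
  by_contra hR
  rw [Int.not_odd_iff_even] at hR
  obtain ⟨r, rfl⟩ := hR
  obtain ⟨f, rfl⟩ := he
  have key : ∀ a₀ a₁ a₂ l₀ l₁ : ZMod 2, a₀ * l₀ ^ 2 = 0 → a₁ * l₀ ^ 2 = 0 →
      a₀ * l₁ ^ 2 + a₂ * l₀ ^ 2 = 0 → a₁ * l₁ ^ 2 = 0 → a₂ * l₁ ^ 2 = 0 →
      (a₀ = 0 ∧ a₁ = 0 ∧ a₂ = 0) ∨ (l₀ = 0 ∧ l₁ = 0) := by decide
  have := sextic_coeff_eq_zero (e₅ := 0) (e₆ := 0)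
    (e₀ := A 0 * l 0 ^ 2 + 2 * (f * l 0 * (2 * B 0 - k) + 2 * f ^ 2 * C 0 - r * N 0 ^ 2))
    (e₁ := A 1 * l 0 ^ 2 + 2 * (A 0 * l 0 * l 1 + f * (l 0 * (2 * B 1 - 2 * k) + l 1 * (2 * B 0 - k))
      + 2 * f ^ 2 * C 1 - 2 * r * N 0 * N 1))
    (e₂ := A 0 * l 1 ^ 2 + A 2 * l 0 ^ 2 + 2 * (A 1 * l 0 * l 1 + f * (l 0 * (2 * B 2 + k) +
      l 1 * (2 * B 1 - 2 * k)) + 2 * f ^ 2 * C 2 - r * (2 * N 0 * N 2 + N 1 ^ 2)))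
    (e₃ := A 1 * l 1 ^ 2 + 2 * (A 2 * l 0 * l 1 + f * (l 0 * (2 * B 3 + k) + l 1 * (2 * B 2 + k))
      + 2 * f ^ 2 * C 3 - 2 * r * N 1 * N 2))
    (e₄ := A 2 * l 1 ^ 2 + 2 * (f * l 1 * (2 * B 3 + k) + 2 * f ^ 2 * C 4 - r * N 2 ^ 2))
    (fun x => by
      have := h x 1
      simp only [quadForm, linForm, cubForm, hForm, quarForm] at this
      linear_combination -this)
  obtain ⟨h0, h1, h2, h3, h4, -⟩ := this
  have two : (2 : ZMod 2) = 0 := rfl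
  have c : ∀ a b : ℤ, a + 2 * b = 0 → (a : ZMod 2) = 0 := fun a b hab => by
    rw [intCast_zmod_two_eq_zero_iff]; exact ⟨-b, by linear_combination hab⟩
  have g0 := c _ _ h0
  have g1 := c _ _ h1
  have g2 := c _ _ h2
  have g3 := c _ _ h3
  have g4 := c _ _ h4
  push_cast at g0 g1 g2 g3 g4
  rcases key _ _ _ _ _ g0 g1 g2 g3 g4 with hh | ⟨hh, hh'⟩
  · exact (exists_odd_iff_zmod_two A).1 hA hh
  · obtain ⟨i, hi⟩ := hl
    have := intCast_zmod_two_of_odd hi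
    fin_cases i <;> simp_all

theorem not_even_of_mul_sq_eq {A : Fin 3 → ℤ} {l : Fin 2 → ℤ} {N : Fin 3 → ℤ} {B : Fin 4 → ℤ}
    {C : Fin 5 → ℤ} {k R e : ℤ} (hA : ∃ i, Odd (A i)) (hl : ∃ i, Odd (l i)) (hk : Odd k) (he0 : e ≠ 0)
    (h : ∀ x z, R * quadForm N x z ^ 2 = quadForm A x z * linForm l x z ^ 2 +
      e * linForm l x z * (2 * cubForm B x z + k * hForm x z) + e ^ 2 * quarForm C x z) :
    ¬Even e := by
  intro he
  have hR := odd_of_mul_sq_eq hA hl he h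
  obtain ⟨j, e₀, hj, e₀odd⟩ := exists_two_pow_mul_odd (f := fun _ : Unit => e) ⟨(), he0⟩
  replace hj := hj ()
  obtain ⟨u, e₀odd⟩ := e₀odd
  change Odd (e₀ ()) at e₀odd
  generalize e₀ () = e₁ at *
  have hj0 : j ≠ 0 := by
    rintro rfl
    rw [hj, pow_zero, one_mul] at he
    exact Int.not_even_iff_odd.2 e₀odd he
  obtain ⟨j, rfl⟩ := Nat.exists_eq_succ_of_ne_zero hj0
  set T : ℤ := 2 ^ (j + 1) with hT
  have hT2 : T = 2 * 2 ^ j := by rw [hT, pow_succ]; ring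
  have hT0 : T ≠ 0 := by positivity
  obtain ⟨p, q, w, hw, hpq⟩ : ∃ p q w : ℤ, Odd w ∧ linForm l p q = w := by
    obtain ⟨i, hi⟩ := hl
    fin_cases i
    · exact ⟨0, 1, _, hi, by simp [linForm]⟩
    · exact ⟨1, 0, _, hi, by simp [linForm]⟩
  have hl0 := h (-l 0) (l 1)
  have hl1 := h (-l 0 + 2 * T * p) (l 1 + 2 * T * q)
  have hodd : Odd (hForm (-l 0) (l 1)) := by
    apply odd_hForm
    obtain ⟨i, hi⟩ := hl
    fin_cases i
    · exact Or.inl hi.neg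
    · exact Or.inr hi
  obtain ⟨f1, f2, f3⟩ := forms_modEq N C (x := -l 0) (x' := -l 0 + 2 * T * p) (z := l 1)
    (z' := l 1 + 2 * T * q) (t := 2 * T)
    (Int.modEq_iff_dvd.2 ⟨-p, by ring⟩) (Int.modEq_iff_dvd.2 ⟨-q, by ring⟩)
  obtain ⟨N1, hN1⟩ := Int.modEq_iff_dvd.1 f1.symm
  obtain ⟨C1, hC1⟩ := Int.modEq_iff_dvd.1 f2.symm
  obtain ⟨H1, hH1⟩ := Int.modEq_iff_dvd.1 f3.symm
  have hlz : linForm l (-l 0) (l 1) = 0 := by simp [linForm]; ring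
  have hlz' : linForm l (-l 0 + 2 * T * p) (l 1 + 2 * T * q) = 2 * T * w := by
    rw [← hpq]; simp [linForm]; ring
  rw [hlz] at hl0
  rw [hlz'] at hl1
  rw [sub_eq_iff_eq_add] at hN1 hC1 hH1
  rw [hN1, hC1, hH1] at hl1
  generalize quadForm A (-l 0 + 2 * T * p) (l 1 + 2 * T * q) = a at *
  generalize cubForm B (-l 0 + 2 * T * p) (l 1 + 2 * T * q) = b at *
  generalize quarForm C (-l 0) (l 1) = γ at *
  generalize hForm (-l 0) (l 1) = η at *
  have hdvd : T ∣ quadForm N (-l 0) (l 1) := by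
    have hc : IsCoprime (T ^ 2) R := by
      rw [hT, ← pow_mul]
      refine IsCoprime.pow_left ?_
      obtain ⟨s, rfl⟩ := hR
      exact ⟨-s, 1, by ring⟩
    refine (Int.pow_dvd_pow_iff two_ne_zero).1 (hc.dvd_of_dvd_mul_left ?_)
    rw [hl0, hj]
    exact ⟨e₁ ^ 2 * γ, by ring⟩
  obtain ⟨ν, hν⟩ := hdvd
  rw [hν] at hl0 hl1
  subst hj
  have g0 : R * ν ^ 2 = e₁ ^ 2 * γ := by
    apply mul_left_cancel₀ (pow_ne_zero 2 hT0)
    linear_combination hl0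
  have g1 : R * (2 * N1 + ν) ^ 2 = 4 * a * w ^ 2 + 2 * e₁ * w * (2 * b + k * (2 * T * H1 + η)) +
      e₁ ^ 2 * (2 * T * C1 + γ) := by
    apply mul_left_cancel₀ (pow_ne_zero 2 hT0)
    linear_combination hl1
  have g2 : 2 * (e₁ * w * k * η) = 2 * (2 * (R * N1 ^ 2 + R * N1 * ν - a * w ^ 2 - e₁ * w * b -
      e₁ * w * k * T * H1 - e₁ ^ 2 * 2 ^ j * C1)) := by
    linear_combination g0 - g1 + 2 * e₁ ^ 2 * C1 * hT2
  have g3 := mul_left_cancel₀ two_ne_zero g2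
  have : Odd (e₁ * w * k * η) := ((e₀odd.mul hw).mul hk).mul hodd
  rw [g3] at this
  exact Int.not_even_iff_odd.2 this (even_two_mul _)

theorem exists_odd_of_mul_sq_eq {A : Fin 3 → ℤ} {N : Fin 3 → ℤ} {B : Fin 4 → ℤ}
    {C : Fin 5 → ℤ} {k : ℤ} (hA : ∃ i, Odd (A i)) (hk : Odd k) (hN : ∃ i, Odd (N i)) {R e : ℤ}
    {l : Fin 2 → ℤ} (he0 : e ≠ 0)
    (h : ∀ x z, R * quadForm N x z ^ 2 = quadForm A x z * linForm l x z ^ 2 +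
      e * linForm l x z * (2 * cubForm B x z + k * hForm x z) + e ^ 2 * quarForm C x z) :
    ∃ (R e : ℤ) (l : Fin 2 → ℤ), Odd e ∧
      ∀ x z, R * quadForm N x z ^ 2 = quadForm A x z * linForm l x z ^ 2 +
        e * linForm l x z * (2 * cubForm B x z + k * hForm x z) + e ^ 2 * quarForm C x z := by
  induction hn : e.natAbs using Nat.strong_induction_on generalizing R e l with
  | _ n ih =>
    by_cases he : Even e
    swap
    · exact ⟨R, e, l, Int.not_even_iff_odd.1 he, h⟩
    have hl : ¬∃ i, Odd (l i) := fun hl => not_even_of_mul_sq_eq hA hl hk he0 h he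
    simp only [not_exists, Int.not_odd_iff_even, even_iff_two_dvd] at hl
    choose l' hl' using hl
    obtain ⟨e', rfl⟩ := even_iff_two_dvd.1 he
    have hlin : ∀ x z, linForm l x z = 2 * linForm l' x z := fun x z => by
      simp only [linForm, hl']; ring
    obtain ⟨x, z, hxz⟩ := exists_odd_quadForm hN
    have h4 : (4 : ℤ) ∣ R := by
      have hc : IsCoprime (4 : ℤ) (quadForm N x z ^ 2) := by
        obtain ⟨s, hs⟩ := hxz.pow (n := 2)
        rw [hs, show (4 : ℤ) = 2 ^ 2 by norm_num]
        exact IsCoprime.pow_left ⟨-s, 1, by ring⟩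
      refine hc.dvd_of_dvd_mul_right ?_
      rw [h, hlin]
      exact ⟨quadForm A x z * linForm l' x z ^ 2 + e' * linForm l' x z * (2 * cubForm B x z +
        k * hForm x z) + e' ^ 2 * quarForm C x z, by ring⟩
    obtain ⟨R', rfl⟩ := h4
    refine ih e'.natAbs (by omega) (R := R') (e := e') (l := l') (by omega) (fun x z => ?_) rfl
    have := h x z
    rw [hlin] at this
    linarith

theorem hForm_mod_two_rigidity : ∀ μ q₀ q₁ q₂ q₃ q₄ m₀ m₁ m₂ m₃ : ZMod 2,
    descentDefect 1 μ 1 0 ![q₀, q₁, q₂, q₃, q₄] ![m₀, m₁, m₂, m₃] = 0 →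
      μ = 0 ∧ ((m₀ = 0 ∧ m₁ = 0 ∧ m₂ = 0 ∧ m₃ = 0) ∨ (m₀ = 1 ∧ m₁ = 0 ∧ m₂ = 1 ∧ m₃ = 1)) := by
  decide +kernel

theorem hForm_not_dvd_bForm_sq_mod_two : ∀ q₀ q₁ q₂ q₃ q₄ m₀ m₁ m₂ m₃ : ZMod 2,
    descentDefect 0 1 1 0 ![q₀, q₁, q₂, q₃, q₄] ![m₀, m₁, m₂, m₃] ≠ 0 := by
  decide +kernel

theorem intCast_descentDefect_of_even {α β κ R : ℤ} {A : Fin 3 → ℤ} {Q : Fin 5 → ℤ}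
    {M : Fin 4 → ℤ} (hR : Even R) (hκ : Odd κ)
    (h : descentDefect α β κ (fun i => R * A i) Q M = 0) :
    descentDefect (α : ZMod 2) β 1 0 ![(Q 0 : ZMod 2), Q 1, Q 2, Q 3, Q 4]
      ![(M 0 : ZMod 2), M 1, M 2, M 3] = 0 := by
  have hR0 : (R : ZMod 2) = 0 := (intCast_zmod_two_eq_zero_iff R).2 hR.two_dvd
  have hκ1 := intCast_zmod_two_of_odd hκ
  ext i
  have := map_descentDefect (Int.castRingHom (ZMod 2)) α β κ (fun i => R * A i) Q M i
  rw [h] at this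
  simp only [eq_intCast, hκ1, Int.cast_mul, hR0, zero_mul, Pi.zero_apply, Int.cast_zero] at this
  rw [Pi.zero_apply, this]
  congr 1 <;> ext i <;> fin_cases i <;> rfl

theorem exists_descent_of_double {κ R : ℤ} {A N : Fin 3 → ℤ} {M : Fin 4 → ℤ} (hκ : Odd κ)
    (hD : descentDefect 1 2 κ (fun i => 2 * R * A i) (sqCoeff N) (fun i => 2 * M i) = 0) :
    Odd R ∧ descentDefect 2 1 κ (fun i => R * A i) (sqCoeff N) M = 0 := by
  have key : descentDefect 2 1 κ (fun i => R * A i) (sqCoeff N) M = 0 := by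
    refine descentDefect_eq_zero fun x z => ?_
    have := eval_of_descentDefect_eq_zero hD x z
    simp only [quadForm, cubForm] at this ⊢
    apply mul_left_cancel₀ (two_ne_zero (α := ℤ))
    linear_combination this
  refine ⟨?_, key⟩
  by_contra hR
  have := intCast_descentDefect_of_even (Int.not_odd_iff_even.1 hR) hκ key
  rw [show ((2 : ℤ) : ZMod 2) = 0 from rfl, Int.cast_one] at this
  exact hForm_not_dvd_bForm_sq_mod_two _ _ _ _ _ _ _ _ _ this

theorem exists_descent_of_mul_sq_eq {m : ℤ} (hm : m = 1 ∨ m = 2) {A : Fin 3 → ℤ} {N : Fin 3 → ℤ}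
    {B : Fin 4 → ℤ} {C : Fin 5 → ℤ} {k : ℤ} (hA : ∃ i, Odd (A i)) (hk : Odd k)
    (hD : descentDefect 1 m k A C B = 0) (hN : ∃ i, Odd (N i)) {R e : ℤ}
    {l : Fin 2 → ℤ} (he0 : e ≠ 0)
    (h : ∀ x z, R * quadForm N x z ^ 2 = quadForm A x z * linForm l x z ^ 2 +
      e * linForm l x z * (2 * cubForm B x z + k * hForm x z) + e ^ 2 * quarForm C x z) :
    ∃ (ρ α β κ : ℤ) (M : Fin 4 → ℤ), (α, β) ∈ [((1 : ℤ), (1 : ℤ)), (1, 2), (2, 1)] ∧ α * β = m ∧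
      Odd ρ ∧ Odd κ ∧ descentDefect α β κ (fun i => ρ * A i) (sqCoeff N) M = 0 := by
  obtain ⟨R, e, l, he, h⟩ := exists_odd_of_mul_sq_eq hA hk hN he0 h
  set κ := e * k with hκdef
  have hκ : Odd κ := he.mul hk
  obtain ⟨M, hM⟩ : ∃ M : Fin 4 → ℤ,
      descentDefect 1 m κ (fun i => R * A i) (sqCoeff N) M = 0 := by
    refine ⟨![e * B 0 + A 0 * l 0, e * B 1 + (A 0 * l 1 + A 1 * l 0),
      e * B 2 + (A 1 * l 1 + A 2 * l 0), e * B 3 + A 2 * l 1], descentDefect_eq_zero fun x z => ?_⟩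
    have h1 := h x z
    have h2 := eval_of_descentDefect_eq_zero hD x z
    have h3 : cubForm ![e * B 0 + A 0 * l 0, e * B 1 + (A 0 * l 1 + A 1 * l 0),
        e * B 2 + (A 1 * l 1 + A 2 * l 0), e * B 3 + A 2 * l 1] x z =
        e * cubForm B x z + quadForm A x z * linForm l x z := by
      simp [cubForm, quadForm, linForm]; ring
    have h4 : quadForm (fun i => R * A i) x z = R * quadForm A x z := by
      simp only [quadForm]; ring
    rw [h3, h4, quarForm_sqCoeff, hκdef]
    linear_combination quadForm A x z * h1 + e ^ 2 * h2
  by_cases hR : Odd R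
  · refine ⟨R, 1, m, κ, M, ?_, one_mul m, hR, hκ, hM⟩
    rcases hm with rfl | rfl <;> simp
  rw [Int.not_odd_iff_even] at hR
  have hmod := hForm_mod_two_rigidity _ _ _ _ _ _ _ _ _ _
    (by simpa using intCast_descentDefect_of_even hR hκ hM)
  have hm2 : m = 2 := by
    rcases hm with rfl | rfl
    · simp at hmod
    · rfl
  subst hm2
  obtain ⟨M, hM, hM2⟩ : ∃ M : Fin 4 → ℤ,
      descentDefect 1 2 κ (fun i => R * A i) (sqCoeff N) M = 0 ∧ ∀ i, 2 ∣ M i := by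
    simp only [← intCast_zmod_two_eq_zero_iff]
    rcases hmod.2 with ⟨h0, h1, h2, h3⟩ | ⟨h0, h1, h2, h3⟩
    · exact ⟨M, hM, fun i => by fin_cases i <;> assumption⟩
    · refine ⟨![κ - M 0, 2 * κ - M 1, -κ - M 2, -κ - M 3], descentDefect_eq_zero fun x z => ?_,
        fun i => ?_⟩
      · have := eval_of_descentDefect_eq_zero hM x z
        have h3 : cubForm ![κ - M 0, 2 * κ - M 1, -κ - M 2, -κ - M 3] x z =
            -κ * hForm x z - cubForm M x z := by
          simp [cubForm, hForm]; ring
        rw [h3]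
        linear_combination this
      · have hκ1 := intCast_zmod_two_of_odd hκ
        have two : (2 : ZMod 2) = 0 := rfl
        fin_cases i <;> simp [hκ1, h0, h1, h2, h3, two]
  choose M' hM' using hM2
  obtain ⟨R', rfl⟩ := hR.two_dvd
  obtain rfl : M = fun i => 2 * M' i := funext hM'
  obtain ⟨hR', key⟩ := exists_descent_of_double hκ hM
  exact ⟨R', 2, 1, κ, M', by simp, by norm_num, hR', hκ, key⟩

/-- A quadratic form is primitive if its coefficients have no common divisor. -/
def IsPrimitiveForm (A : Fin 3 → ℤ) : Prop := ∀ d : ℤ, (∀ i, d ∣ A i) → IsUnit d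

theorem IsPrimitiveForm.exists_odd {A : Fin 3 → ℤ} (h : IsPrimitiveForm A) : ∃ i, Odd (A i) := by
  by_contra! H
  have := h 2 fun i => (Int.not_odd_iff_even.1 (H i)).two_dvd
  rw [Int.isUnit_iff] at this
  omega

theorem exists_isPrimitiveForm {N : Fin 3 → ℤ} (hN : N ≠ 0) :
    ∃ (g : ℤ) (N' : Fin 3 → ℤ), g ≠ 0 ∧ IsPrimitiveForm N' ∧ ∀ i, N i = g * N' i := by
  obtain ⟨N', hN', hg⟩ := Finset.extract_gcd N (s := Finset.univ) Finset.univ_nonempty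
  refine ⟨Finset.univ.gcd N, N', ?_, fun d hd => ?_, fun i => hN' i (Finset.mem_univ i)⟩
  · intro h0
    exact hN (funext fun i => Finset.gcd_eq_zero_iff.1 h0 i (Finset.mem_univ i))
  · exact isUnit_of_dvd_one (hg ▸ Finset.dvd_gcd fun i _ => hd i)

/-- The quadratic form `A` divides `B² + k * h * B - m * k² * b²` for some cubic form `B` and some
odd `k`. -/
def IsDescentForm (m : ℤ) (A : Fin 3 → ℤ) : Prop :=
  ∃ (B : Fin 4 → ℤ) (C : Fin 5 → ℤ) (k : ℤ), Odd k ∧ descentDefect 1 m k A C B = 0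

theorem IsDescentForm.of_descentDefect {α β κ ρ : ℤ} {A N : Fin 3 → ℤ} {M : Fin 4 → ℤ}
    (hκ : Odd κ) (h : descentDefect α β κ (fun i => ρ * A i) (sqCoeff N) M = 0) :
    IsDescentForm (α * β) N := by
  refine ⟨fun i => α * M i, ![α * ρ * (A 0 * N 0), α * ρ * (A 0 * N 1 + A 1 * N 0),
    α * ρ * (A 0 * N 2 + A 1 * N 1 + A 2 * N 0), α * ρ * (A 1 * N 2 + A 2 * N 1),
    α * ρ * (A 2 * N 2)], κ, hκ, descentDefect_eq_zero fun x z => ?_⟩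
  have := eval_of_descentDefect_eq_zero h x z
  rw [quarForm_sqCoeff] at this
  simp [quadForm, quarForm, cubForm] at this ⊢
  linear_combination α * this

theorem exists_torsionForm_of_isDescentForm {m : ℤ} (hm : m = 1 ∨ m = 2)
    (hstep : ∀ (A : Fin 3 → ℤ) (B : Fin 4 → ℤ) (C : Fin 5 → ℤ) (k : ℤ), IsPrimitiveForm A →
      Odd k → descentDefect 1 m k A C B = 0 →
      ∃ (R e : ℤ) (l : Fin 2 → ℤ) (N : Fin 3 → ℤ), e ≠ 0 ∧ N ≠ 0 ∧
        ∀ x z, R * quadForm N x z ^ 2 = quadForm A x z * linForm l x z ^ 2 +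
          e * linForm l x z * (2 * cubForm B x z + k * hForm x z) + e ^ 2 * quarForm C x z)
    {A : Fin 3 → ℤ} (hA : IsPrimitiveForm A) (hgood : IsDescentForm m A) :
    ∃ T ∈ torsionForms, ∀ i j, A i * T j = A j * T i := by
  have key : ∀ n : ℕ, ∀ A, IsPrimitiveForm A → IsDescentForm m A → NearTorsion (n + 1) A := by
    intro n
    induction n with
    | zero => exact fun A hA _ => nearTorsion_one hA.exists_odd
    | succ n ih =>
      intro A hA hgood
      obtain ⟨B, C, k, hk, hD⟩ := hgood
      obtain ⟨R, e, l, N, he, hN, h⟩ := hstep A B C k hA hk hD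
      obtain ⟨g, N', -, hN', hg⟩ := exists_isPrimitiveForm hN
      obtain ⟨ρ, α, β, κ, M, hαβ, hprod, hρ, hκ, hD'⟩ := exists_descent_of_mul_sq_eq hm
        hA.exists_odd hk hD hN'.exists_odd (R := R * g ^ 2) he (fun x z => by
          rw [← h x z]; simp only [quadForm, hg]; ring)
      exact NearTorsion.of_descent hαβ hρ hκ hA.exists_odd hN'.exists_odd hD'
        (ih N' hN' (hprod ▸ IsDescentForm.of_descentDefect hκ hD'))
  refine exists_torsionForm_of_forall_near fun n => ?_
  have := key n A hA hgood
  obtain ⟨T, hT, u, hu, h⟩ := this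
  exact ⟨T, hT, u, hu, fun i => (pow_dvd_pow 2 (Nat.le_succ n)).trans (h i)⟩

theorem exists_cubForm_eq_mul {𝕜 : Type*} [Field 𝕜] {P : Fin 4 → 𝕜} {p q : 𝕜}
    (hv : p ≠ 0 ∨ q ≠ 0) (h : cubForm P p q = 0) :
    ∃ Q : Fin 3 → 𝕜, ∀ x z, cubForm P x z = (q * x - p * z) * quadForm Q x z := by
  simp only [cubForm] at h
  rcases hv with hp | hq
  · refine ⟨![-P 0 / p, -(P 1 * p + P 0 * q) / p ^ 2,
      -(P 2 * p ^ 2 + P 1 * p * q + P 0 * q ^ 2) / p ^ 3], fun x z => ?_⟩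
    simp [cubForm, quadForm]
    field_simp
    linear_combination x ^ 3 * h
  · refine ⟨![(P 1 * q ^ 2 + P 2 * p * q + P 3 * p ^ 2) / q ^ 3, (P 2 * q + P 3 * p) / q ^ 2,
      P 3 / q], fun x z => ?_⟩
    simp [cubForm, quadForm]
    field_simp
    linear_combination z ^ 3 * h

theorem exists_quadForm_eq_mul {𝕜 : Type*} [Field 𝕜] {P : Fin 3 → 𝕜} {p q : 𝕜}
    (hv : p ≠ 0 ∨ q ≠ 0) (h : quadForm P p q = 0) :
    ∃ l : Fin 2 → 𝕜, ∀ x z, quadForm P x z = (q * x - p * z) * linForm l x z := by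
  simp only [quadForm] at h
  rcases hv with hp | hq
  · refine ⟨![-P 0 / p, -(P 1 * p + P 0 * q) / p ^ 2], fun x z => ?_⟩
    simp [linForm, quadForm]
    field_simp
    linear_combination x ^ 2 * h
  · refine ⟨![(P 1 * q + P 2 * p) / q ^ 2, P 2 / q], fun x z => ?_⟩
    simp [linForm, quadForm]
    field_simp
    linear_combination z ^ 2 * h

/-- A cubic form vanishing at both roots of a quadratic form, with multiplicity, is a multiple of
it. -/
theorem exists_cubForm_eq_quadForm_mul {𝕜 : Type*} [Field 𝕜] {A : Fin 3 → 𝕜} {P : Fin 4 → 𝕜}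
    {p₁ q₁ p₂ q₂ s : 𝕜} (hs : s ≠ 0) (hv₁ : p₁ ≠ 0 ∨ q₁ ≠ 0) (hv₂ : p₂ ≠ 0 ∨ q₂ ≠ 0)
    (hA : ∀ x z, quadForm A x z = s * (q₁ * x - p₁ * z) * (q₂ * x - p₂ * z))
    (h₁ : cubForm P p₁ q₁ = 0)
    (h₂ : ∀ Q : Fin 3 → 𝕜, (∀ x z, cubForm P x z = (q₁ * x - p₁ * z) * quadForm Q x z) →
      quadForm Q p₂ q₂ = 0) :
    ∃ l : Fin 2 → 𝕜, ∀ x z, cubForm P x z = quadForm A x z * linForm l x z := by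
  obtain ⟨Q, hQ⟩ := exists_cubForm_eq_mul hv₁ h₁
  obtain ⟨l, hl⟩ := exists_quadForm_eq_mul hv₂ (h₂ Q hQ)
  refine ⟨fun i => l i / s, fun x z => ?_⟩
  rw [hQ, hl, hA]
  simp only [linForm]
  field_simp

theorem exists_real_roots {A : Fin 3 → ℝ} (hA : A ≠ 0) (hD : 0 ≤ A 1 ^ 2 - 4 * A 0 * A 2) :
    ∃ p₁ q₁ p₂ q₂ s : ℝ, s ≠ 0 ∧ (p₁ ≠ 0 ∨ q₁ ≠ 0) ∧ (p₂ ≠ 0 ∨ q₂ ≠ 0) ∧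
      A 0 = s * p₁ * p₂ ∧ A 1 = -s * (q₁ * p₂ + p₁ * q₂) ∧ A 2 = s * q₁ * q₂ := by
  by_cases h2 : A 2 = 0
  · refine ⟨1, 0, -A 0, A 1, -1, by norm_num, by simp, ?_, by ring, by ring, by rw [h2]; ring⟩
    by_contra! h
    apply hA
    ext i
    fin_cases i
    · simpa using h.1
    · exact h.2
    · exact h2
  · have := Real.sq_sqrt hD
    generalize √(A 1 ^ 2 - 4 * A 0 * A 2) = d at *
    refine ⟨(-A 1 + d) / (2 * A 2), 1, (-A 1 - d) / (2 * A 2), 1, A 2, h2, by simp, by simp, ?_, ?_,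
      by ring⟩
    · field_simp
      linear_combination this
    · field_simp
      ring

theorem sexticForm_pos {m x z : ℝ} (hm : 0 < m) (h : x ≠ 0 ∨ z ≠ 0) : 0 < sexticForm m x z := by
  have h1 : 0 ≤ hForm x z ^ 2 := sq_nonneg _
  have h2 : 0 ≤ 4 * m * bForm x z ^ 2 := by positivity
  refine lt_of_le_of_ne (add_nonneg h1 h2) fun h0 => ?_
  have h3 : hForm x z ^ 2 = 0 ∧ 4 * m * bForm x z ^ 2 = 0 := by
    simp only [sexticForm] at h0; constructor <;> linarith
  have hb : bForm x z = 0 := by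
    have := h3.2
    simpa [hm.ne'] using this
  have hh : hForm x z = 0 := by simpa using h3.1
  clear h0 h1 h2 h3
  simp only [bForm, hForm] at hb hh
  have : x * z * (x + z) = 0 := by linear_combination hb
  rcases mul_eq_zero.1 this with h4 | h4
  · rcases mul_eq_zero.1 h4 with rfl | rfl <;> simp_all
  · obtain rfl : x = -z := by linarith
    have : z ^ 3 = 0 := by linear_combination hh
    simp_all

theorem quadForm_continuous_line (A : Fin 3 → ℝ) (x z u v : ℝ) :
    Continuous fun t : ℝ => quadForm A (x + t * u) (z + t * v) := by
  unfold quadForm; fun_prop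

/-- A nonzero quadratic form does not vanish identically on the open set where another one is
negative. -/
theorem exists_quadForm_neg_ne_zero {A N : Fin 3 → ℝ} (hN : N ≠ 0) {x z : ℝ}
    (h : quadForm A x z < 0) : ∃ x z, quadForm A x z < 0 ∧ quadForm N x z ≠ 0 := by
  by_contra! H
  have key : ∀ u v, quadForm N u v = 0 := by
    intro u v
    have h0 : ∀ᶠ t in nhds (0 : ℝ), quadForm A (x + t * u) (z + t * v) < 0 := by
      refine (quadForm_continuous_line A x z u v).continuousAt.eventually_lt continuousAt_const ?_
      simpa using h
    obtain ⟨ε, hε, hb⟩ := Metric.eventually_nhds_iff.1 h0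
    have e0 := H _ _ h
    have e1 := H _ _ (hb (y := ε / 2) (by simp [abs_of_pos hε, hε]))
    have e2 := H _ _ (hb (y := -(ε / 2)) (by simp [abs_of_pos hε, hε]))
    have : ε ^ 2 * quadForm N u v = 0 := by
      simp only [quadForm] at *
      linear_combination 2 * e1 + 2 * e2 - 4 * e0
    simpa [hε.ne'] using this
  apply hN
  have h0 := key 0 1
  have h1 := key 1 0
  have h2 := key 1 1
  simp [quadForm] at h0 h1 h2
  ext i
  fin_cases i <;> simp_all

theorem exists_quadForm_ne_zero {A : Fin 3 → ℝ} (hA : A ≠ 0) : ∃ x z, quadForm A x z ≠ 0 := by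
  by_contra! key
  apply hA
  have h0 := key 0 1
  have h1 := key 1 0
  have h2 := key 1 1
  simp [quadForm] at h0 h1 h2
  ext i
  fin_cases i <;> simp_all

theorem coeff_pos_of_quadForm_neg {A N : Fin 3 → ℝ} {M : Fin 4 → ℝ} {r δ m : ℝ} (hm : 0 < m)
    (hN : N ≠ 0) {x z : ℝ} (hneg : r * quadForm A x z < 0)
    (h : ∀ x z, r * quadForm A x z * quadForm N x z ^ 2 =
      cubForm M x z ^ 2 - δ * sexticForm m x z) : 0 < δ := by
  have e : ∀ x z, quadForm (fun i => r * A i) x z = r * quadForm A x z := fun x z => by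
    simp only [quadForm]; ring
  obtain ⟨x, z, h1, h2⟩ := exists_quadForm_neg_ne_zero (A := fun i => r * A i) hN
    (by rwa [e])
  rw [e] at h1
  have hF : 0 < sexticForm m x z := sexticForm_pos hm (by
    by_contra! h0
    obtain ⟨rfl, rfl⟩ := h0
    simp [quadForm] at h1)
  have h3 := h x z
  have h4 : 0 < quadForm N x z ^ 2 := by positivity
  have h5 := mul_pos_of_neg_of_neg h1 (neg_lt_zero.2 h4)
  have h6 : 0 < δ * sexticForm m x z := by nlinarith [sq_nonneg (cubForm M x z)]
  exact (pos_iff_pos_of_mul_pos h6).2 hF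

/-- A cubic form keeps its sign along a segment on which it does not vanish. -/
theorem cubForm_mul_pos {M : Fin 4 → ℝ} {p₁ q₁ p₂ q₂ : ℝ}
    (h : ∀ t ∈ Set.Icc (0 : ℝ) 1,
      cubForm M ((1 - t) * p₁ + t * p₂) ((1 - t) * q₁ + t * q₂) ≠ 0) :
    0 < cubForm M p₁ q₁ * cubForm M p₂ q₂ := by
  have hc : Continuous fun t : ℝ =>
      cubForm M ((1 - t) * p₁ + t * p₂) ((1 - t) * q₁ + t * q₂) := by
    unfold cubForm; fun_prop
  by_contra! hneg
  have h0 : (0 : ℝ) ∈ Set.uIcc (cubForm M p₁ q₁) (cubForm M p₂ q₂) := by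
    rw [Set.mem_uIcc]
    rcases mul_nonpos_iff.1 hneg with h | h
    · exact Or.inr ⟨h.2, h.1⟩
    · exact Or.inl h
  have := intermediate_value_uIcc (a := (0 : ℝ)) (b := 1) hc.continuousOn
  simp only [sub_zero, one_mul, zero_mul, add_zero, sub_self, zero_add] at this
  obtain ⟨t, ht, ht0⟩ := this h0
  rw [Set.uIcc_of_le zero_le_one] at ht
  exact h t ht ht0

theorem cubForm_mul_pos_of_segment {A N : Fin 3 → ℝ} {M : Fin 4 → ℝ} {r δ m s p₁ q₁ p₂ q₂ : ℝ}
    (hm : 0 < m) (hδ : 0 < δ) (hκ : q₁ * p₂ - p₁ * q₂ ≠ 0)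
    (hA : ∀ x z, quadForm A x z = s * (q₁ * x - p₁ * z) * (q₂ * x - p₂ * z))
    (h : ∀ x z, r * quadForm A x z * quadForm N x z ^ 2 =
      cubForm M x z ^ 2 - δ * sexticForm m x z) (hsign : r * s < 0) :
    0 < cubForm M p₁ q₁ * cubForm M p₂ q₂ := by
  refine cubForm_mul_pos fun t ht h0 => ?_
  set x := (1 - t) * p₁ + t * p₂ with hx
  set z := (1 - t) * q₁ + t * q₂ with hz
  have h1 := h x z
  have hF : 0 < sexticForm m x z := sexticForm_pos hm (by
    by_contra! hxz
    have e1 : (q₁ * p₂ - p₁ * q₂) * t = 0 := by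
      have : q₁ * x - p₁ * z = 0 := by rw [hxz.1, hxz.2]; ring
      rw [hx, hz] at this
      linear_combination this
    have e2 : (q₁ * p₂ - p₁ * q₂) * (1 - t) = 0 := by
      have : q₂ * x - p₂ * z = 0 := by rw [hxz.1, hxz.2]; ring
      rw [hx, hz] at this
      linear_combination -this
    simp only [mul_eq_zero, hκ, false_or] at e1 e2
    linarith)
  have h2 : r * quadForm A x z = -(r * s) * ((q₁ * p₂ - p₁ * q₂) ^ 2 * (t * (1 - t))) := by
    rw [hA, hx, hz]; ring
  have h3 : 0 ≤ r * quadForm A x z := by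
    rw [h2]
    have := ht.1
    have := sub_nonneg.2 ht.2
    have : 0 ≤ -(r * s) := by linarith
    positivity
  rw [h0] at h1
  have := mul_nonneg h3 (sq_nonneg (quadForm N x z))
  nlinarith [mul_pos hδ hF]

theorem sign_cubForm_mul {A N : Fin 3 → ℝ} {M : Fin 4 → ℝ} {r δ m s p₁ q₁ p₂ q₂ : ℝ}
    (hm : 0 < m) (hδ : 0 < δ) (hκ : q₁ * p₂ - p₁ * q₂ ≠ 0) (hr : r ≠ 0) (hs : s ≠ 0)
    (hA : ∀ x z, quadForm A x z = s * (q₁ * x - p₁ * z) * (q₂ * x - p₂ * z))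
    (h : ∀ x z, r * quadForm A x z * quadForm N x z ^ 2 =
      cubForm M x z ^ 2 - δ * sexticForm m x z) :
    r * s * (cubForm M p₁ q₁ * cubForm M p₂ q₂) < 0 := by
  rcases lt_or_gt_of_ne (mul_ne_zero hr hs) with hneg | hpos
  · exact mul_neg_of_neg_of_pos hneg (cubForm_mul_pos_of_segment hm hδ hκ hA h hneg)
  · have := cubForm_mul_pos_of_segment (s := -s) (p₁ := p₁) (q₁ := q₁) (p₂ := -p₂) (q₂ := -q₂) hm hδ
      (fun h0 => hκ (by linear_combination -h0)) (fun x z => by rw [hA]; ring) h (by linarith)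
    have e : cubForm M (-p₂) (-q₂) = -cubForm M p₂ q₂ := by simp only [cubForm]; ring
    rw [e] at this
    have := mul_pos hpos this
    linarith

theorem eq_zero_of_forall_mul_eq_zero {f : ℝ → ℂ} (hf : Continuous f) (h : ∀ t, t * f t = 0) :
    f 0 = 0 := by
  have : f = fun _ => 0 := by
    refine Continuous.ext_on (dense_compl_singleton (0 : ℝ)) hf continuous_const fun t ht => ?_
    exact (mul_eq_zero.1 (h t)).resolve_left (by exact_mod_cast ht)
  rw [this]

theorem quadForm_ofReal (A : Fin 3 → ℝ) (x z : ℝ) :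
    quadForm (fun i => (A i : ℂ)) x z = (quadForm A x z : ℝ) := by
  simp [quadForm]

theorem cubForm_ofReal (A : Fin 4 → ℝ) (x z : ℝ) :
    cubForm (fun i => (A i : ℂ)) x z = (cubForm A x z : ℝ) := by
  simp [cubForm]

theorem quarForm_ofReal (A : Fin 5 → ℝ) (x z : ℝ) :
    quarForm (fun i => (A i : ℂ)) x z = (quarForm A x z : ℝ) := by
  simp [quarForm]

theorem sexticForm_ofReal (m x z : ℝ) : sexticForm (m : ℂ) x z = (sexticForm m x z : ℝ) := by
  simp [sexticForm, hForm, bForm]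

theorem conj_cubForm (P : Fin 4 → ℝ) (x z : ℂ) :
    cubForm (fun i => (P i : ℂ)) (starRingEnd ℂ x) (starRingEnd ℂ z) =
      starRingEnd ℂ (cubForm (fun i => (P i : ℂ)) x z) := by
  simp [cubForm]

/-- A real cubic form vanishing at a complex root of a definite quadratic form is a multiple of
it. -/
theorem exists_cubForm_eq_quadForm_mul_of_disc_neg {A : Fin 3 → ℝ} {P : Fin 4 → ℝ} {p : ℂ}
    (hA : ∀ x z, quadForm (fun i => (A i : ℂ)) x z = A 2 * (x - p * z) * (x - starRingEnd ℂ p * z))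
    (h2 : A 2 ≠ 0) (hp : p ≠ starRingEnd ℂ p) (h : cubForm (fun i => (P i : ℂ)) p 1 = 0) :
    ∃ l : Fin 2 → ℂ, ∀ x z : ℂ, cubForm (fun i => (P i : ℂ)) x z =
      quadForm (fun i => (A i : ℂ)) x z * linForm l x z := by
  refine exists_cubForm_eq_quadForm_mul (p₁ := p) (q₁ := 1) (p₂ := starRingEnd ℂ p) (q₂ := 1)
    (s := A 2) (by exact_mod_cast h2) (by simp) (by simp) (fun x z => by rw [hA]; ring) h
    fun Q hQ => ?_
  have := conj_cubForm P p 1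
  rw [h, map_one, map_zero, hQ, one_mul, mul_one] at this
  exact (mul_eq_zero.1 this).resolve_left (sub_ne_zero.2 hp.symm)

theorem exists_complex_root {A : Fin 3 → ℝ} (hD : A 1 ^ 2 - 4 * A 0 * A 2 < 0) :
    A 2 ≠ 0 ∧ ∃ p : ℂ, p ≠ starRingEnd ℂ p ∧ ∀ x z, quadForm (fun i => (A i : ℂ)) x z =
      A 2 * (x - p * z) * (x - starRingEnd ℂ p * z) := by
  have h2 : A 2 ≠ 0 := by
    intro h; rw [h] at hD; nlinarith [sq_nonneg (A 1)]
  have hD' : 0 < 4 * A 0 * A 2 - A 1 ^ 2 := by linarith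
  have hsq := Real.sq_sqrt hD'.le
  have hpos := Real.sqrt_pos.2 hD'
  generalize √(4 * A 0 * A 2 - A 1 ^ 2) = d at *
  refine ⟨h2, ⟨-A 1 / (2 * A 2), d / (2 * A 2)⟩, fun h => ?_, fun x z => ?_⟩
  · have := congrArg Complex.im h
    simp only [Complex.conj_im] at this
    have h3 : d / (2 * A 2) ≠ 0 := by positivity
    apply h3; linarith
  · have e1 : (⟨-A 1 / (2 * A 2), d / (2 * A 2)⟩ : ℂ) = (-A 1 + d * Complex.I) / (2 * A 2) := by
      rw [Complex.mk_eq_add_mul_I]; push_cast; ring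
    rw [e1]
    have h2' : (A 2 : ℂ) ≠ 0 := by exact_mod_cast h2
    have hsq' : (d : ℂ) ^ 2 = 4 * A 0 * A 2 - A 1 ^ 2 := by exact_mod_cast hsq
    simp only [quadForm, map_div₀, map_add, map_neg, map_mul, Complex.conj_ofReal, Complex.conj_I,
      map_ofNat]
    field_simp
    linear_combination -z ^ 2 * hsq' + z ^ 2 * d ^ 2 * Complex.I_sq

/-- If `rAN² = M² - δF` and `G² = k²F + 4AC`, then `M` is congruent to a real multiple of `G`
modulo `A`, provided that the sign of `r` is chosen suitably. -/
theorem exists_sign_cubForm_congr {A : Fin 3 → ℝ} (hA : A ≠ 0) {G : Fin 4 → ℝ} {C : Fin 5 → ℝ}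
    {k m : ℝ} (hk : k ≠ 0) (hm : 0 < m)
    (hG : ∀ x z : ℂ, cubForm (fun i => (G i : ℂ)) x z ^ 2 =
      k ^ 2 * sexticForm (m : ℂ) x z + 4 * quadForm (fun i => (A i : ℂ)) x z *
        quarForm (fun i => (C i : ℂ)) x z) :
    ∃ ε : ℝ, (ε = 1 ∨ ε = -1) ∧ ∀ (r : ℝ) (N : Fin 3 → ℝ) (M : Fin 4 → ℝ) (δ : ℝ), 0 < ε * r →
      N ≠ 0 → (∀ x z : ℂ, r * quadForm (fun i => (A i : ℂ)) x z *
        quadForm (fun i => (N i : ℂ)) x z ^ 2 =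
          cubForm (fun i => (M i : ℂ)) x z ^ 2 - δ * sexticForm (m : ℂ) x z) →
      ∃ (e : ℝ) (l : Fin 2 → ℂ), e ≠ 0 ∧ e ^ 2 * k ^ 2 = δ ∧
        ∀ x z : ℂ, cubForm (fun i => ((M i - e * G i : ℝ) : ℂ)) x z =
          quadForm (fun i => (A i : ℂ)) x z * linForm l x z := by
  have sub_smul : ∀ (M : Fin 4 → ℝ) (e : ℝ) (x z : ℂ),
      cubForm (fun i => ((M i - e * G i : ℝ) : ℂ)) x z =
        cubForm (fun i => (M i : ℂ)) x z - e * cubForm (fun i => (G i : ℂ)) x z := by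
    intro M e x z
    simp only [cubForm]; push_cast; ring
  have hG' : ∀ x z : ℝ, cubForm G x z ^ 2 =
      k ^ 2 * sexticForm m x z + 4 * quadForm A x z * quarForm C x z := by
    intro x z
    have := hG x z
    rw [cubForm_ofReal, quadForm_ofReal, quarForm_ofReal, sexticForm_ofReal] at this
    exact_mod_cast this
  have toReal : ∀ (r : ℝ) (N : Fin 3 → ℝ) (M : Fin 4 → ℝ) (δ : ℝ),
      (∀ x z : ℂ, r * quadForm (fun i => (A i : ℂ)) x z *
        quadForm (fun i => (N i : ℂ)) x z ^ 2 =
          cubForm (fun i => (M i : ℂ)) x z ^ 2 - δ * sexticForm (m : ℂ) x z) →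
      ∀ x z : ℝ, r * quadForm A x z * quadForm N x z ^ 2 =
        cubForm M x z ^ 2 - δ * sexticForm m x z := by
    intro r N M δ h x z
    have := h x z
    rw [cubForm_ofReal, quadForm_ofReal, quadForm_ofReal, sexticForm_ofReal] at this
    exact_mod_cast this
  have exists_e : ∀ (r : ℝ) (N : Fin 3 → ℝ) (M : Fin 4 → ℝ) (δ : ℝ), 0 < δ →
      (∀ x z : ℂ, r * quadForm (fun i => (A i : ℂ)) x z *
        quadForm (fun i => (N i : ℂ)) x z ^ 2 =
          cubForm (fun i => (M i : ℂ)) x z ^ 2 - δ * sexticForm (m : ℂ) x z) →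
      ∀ p q : ℂ, quadForm (fun i => (A i : ℂ)) p q = 0 →
      ∃ e : ℝ, e ≠ 0 ∧ e ^ 2 * k ^ 2 = δ ∧
        cubForm (fun i => ((M i - e * G i : ℝ) : ℂ)) p q = 0 := by
    intro r N M δ hδ h p q hpq
    have hs := Real.sq_sqrt hδ.le
    have hsp := Real.sqrt_pos.2 hδ
    generalize √δ = d at *
    have h1 := h p q
    have h2 := hG p q
    rw [hpq] at h1 h2
    have hk' : (k : ℂ) ≠ 0 := by exact_mod_cast hk
    have h3 : cubForm (fun i => ((M i - d / k * G i : ℝ) : ℂ)) p q *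
        cubForm (fun i => ((M i - -(d / k) * G i : ℝ) : ℂ)) p q = 0 := by
      have hs' : (δ : ℂ) = d ^ 2 := by exact_mod_cast hs.symm
      rw [sub_smul, sub_smul]
      push_cast
      rw [hs'] at h1
      field_simp
      linear_combination -k ^ 2 * h1 - d ^ 2 * h2
    have h4 : d / k ≠ 0 := div_ne_zero hsp.ne' hk
    have h5 : (d / k) ^ 2 * k ^ 2 = δ := by rw [← hs]; field_simp
    rcases mul_eq_zero.1 h3 with h | h
    · exact ⟨d / k, h4, h5, h⟩
    · exact ⟨-(d / k), neg_ne_zero.2 h4, by rw [← h5]; ring, h⟩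
  rcases lt_or_ge (A 1 ^ 2 - 4 * A 0 * A 2) 0 with hD | hD
  · obtain ⟨h2, p, hp, hfac⟩ := exists_complex_root hD
    have hA10 : quadForm A 1 0 = A 2 := by simp [quadForm]
    obtain ⟨ε, hε, hεA⟩ : ∃ ε : ℝ, (ε = 1 ∨ ε = -1) ∧ ε * A 2 < 0 := by
      rcases lt_or_gt_of_ne h2 with h | h
      · exact ⟨1, by simp, by linarith⟩
      · exact ⟨-1, by simp, by linarith⟩
    refine ⟨ε, hε, fun r N M δ hr hN h => ?_⟩
    have hδ : 0 < δ := coeff_pos_of_quadForm_neg (r := r) (x := 1) (z := 0) (A := A) hm hN (by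
      rw [hA10]; rcases hε with rfl | rfl <;> nlinarith) (toReal r N M δ h)
    obtain ⟨e, he, hek, hP⟩ := exists_e r N M δ hδ h p 1 (by rw [hfac]; ring)
    obtain ⟨l, hl⟩ := exists_cubForm_eq_quadForm_mul_of_disc_neg hfac h2 hp hP
    exact ⟨e, l, he, hek, hl⟩
  obtain ⟨p₁, q₁, p₂, q₂, s, hs, hv₁, hv₂, c0, c1, c2⟩ := exists_real_roots hA hD
  have hfac : ∀ x z, quadForm A x z = s * (q₁ * x - p₁ * z) * (q₂ * x - p₂ * z) := fun x z => by
    simp only [quadForm, c0, c1, c2]; ring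
  have hfacC : ∀ x z : ℂ, quadForm (fun i => (A i : ℂ)) x z =
      s * (q₁ * x - p₁ * z) * (q₂ * x - p₂ * z) := fun x z => by
    simp only [quadForm, c0, c1, c2]; push_cast; ring
  have hA₁ : quadForm A p₁ q₁ = 0 := by rw [hfac]; ring
  have hA₂ : quadForm A p₂ q₂ = 0 := by rw [hfac]; ring
  have hA₁C : quadForm (fun i => (A i : ℂ)) p₁ q₁ = 0 := by rw [hfacC]; ring
  have hF₂ := sexticForm_pos hm hv₂
  have hG₁ : cubForm G p₁ q₁ ≠ 0 := by
    intro h0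
    have h1 := hG' p₁ q₁
    have hF₁ := sexticForm_pos hm hv₁
    rw [h0, hA₁] at h1
    have : 0 < k ^ 2 * sexticForm m p₁ q₁ := by positivity
    linarith
  have hG₂ : cubForm G p₂ q₂ ≠ 0 := by
    intro h0
    have h1 := hG' p₂ q₂
    rw [h0, hA₂] at h1
    have : 0 < k ^ 2 * sexticForm m p₂ q₂ := by positivity
    linarith
  have cast_ne : ∀ {p q : ℝ}, p ≠ 0 ∨ q ≠ 0 → (p : ℂ) ≠ 0 ∨ (q : ℂ) ≠ 0 := by
    intro p q h; exact_mod_cast h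
  by_cases hκ : q₁ * p₂ - p₁ * q₂ = 0
  · obtain ⟨x, z, hxz⟩ := exists_quadForm_ne_zero hA
    obtain ⟨ε, hε, hεA⟩ : ∃ ε : ℝ, (ε = 1 ∨ ε = -1) ∧ ε * quadForm A x z < 0 := by
      rcases lt_or_gt_of_ne hxz with h | h
      · exact ⟨1, by simp, by linarith⟩
      · exact ⟨-1, by simp, by linarith⟩
    refine ⟨ε, hε, fun r N M δ hr hN h => ?_⟩
    have hδ : 0 < δ := coeff_pos_of_quadForm_neg (r := r) (x := x) (z := z) (A := A) hm hN (by
      rcases hε with rfl | rfl <;> nlinarith) (toReal r N M δ h)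
    obtain ⟨e, he, hek, hP⟩ := exists_e r N M δ hδ h p₁ q₁ hA₁C
    obtain ⟨l, hl⟩ := exists_cubForm_eq_quadForm_mul (s := (s : ℂ)) (by exact_mod_cast hs)
      (cast_ne hv₁) (cast_ne hv₂) hfacC hP (fun Q hQ => by
        have hdot : q₁ * q₂ + p₁ * p₂ ≠ 0 := by
          intro h0
          have h1 : (q₁ ^ 2 + p₁ ^ 2) * (q₂ ^ 2 + p₂ ^ 2) = 0 := by
            linear_combination (q₁ * p₂ - p₁ * q₂) * hκ + (q₁ * q₂ + p₁ * p₂) * h0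
          have h2 : ∀ {p q : ℝ}, p ≠ 0 ∨ q ≠ 0 → q ^ 2 + p ^ 2 ≠ 0 := by
            intro p q h
            rcases h with h | h <;> positivity
          exact mul_ne_zero (h2 hv₁) (h2 hv₂) h1
        have hκC : (q₁ * p₂ - p₁ * q₂ : ℂ) = 0 := by exact_mod_cast hκ
        have hdotC : (q₁ * q₂ + p₁ * p₂ : ℂ) ≠ 0 := by exact_mod_cast hdot
        have hP2 := hQ p₂ q₂
        rw [hκC, zero_mul, sub_smul] at hP2
        have hfun := eq_zero_of_forall_mul_eq_zero (f := fun t : ℝ =>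
          (q₁ * q₂ + p₁ * p₂ : ℂ) * (quadForm Q (p₂ + t * q₂) (q₂ + t * -p₂) *
            (cubForm (fun i => (M i : ℂ)) (p₂ + t * q₂) (q₂ + t * -p₂) +
              e * cubForm (fun i => (G i : ℂ)) (p₂ + t * q₂) (q₂ + t * -p₂)) -
            s * (t * (q₂ * q₂ + p₂ * p₂)) * (r * quadForm (fun i => (N i : ℂ)) (p₂ + t * q₂)
              (q₂ + t * -p₂) ^ 2 - 4 * e ^ 2 *
                quarForm (fun i => (C i : ℂ)) (p₂ + t * q₂) (q₂ + t * -p₂))))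
          (by unfold quadForm cubForm quarForm; fun_prop) (fun t => by
            have h1 := h (p₂ + t * q₂) (q₂ + t * -p₂)
            have h2 := hG (p₂ + t * q₂) (q₂ + t * -p₂)
            have h3 := hQ (p₂ + t * q₂) (q₂ + t * -p₂)
            have h4 := hfacC (p₂ + t * q₂) (q₂ + t * -p₂)
            rw [sub_smul] at h3
            have hek' : (δ : ℂ) = e ^ 2 * k ^ 2 := by exact_mod_cast hek.symm
            rw [hek'] at h1
            generalize cubForm (fun i => (M i : ℂ)) (p₂ + t * q₂) (q₂ + t * -p₂) = M' at *
            generalize cubForm (fun i => (G i : ℂ)) (p₂ + t * q₂) (q₂ + t * -p₂) = G' at *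
            generalize quadForm Q (p₂ + t * q₂) (q₂ + t * -p₂) = Q' at *
            generalize quadForm (fun i => (N i : ℂ)) (p₂ + t * q₂) (q₂ + t * -p₂) = N' at *
            generalize quarForm (fun i => (C i : ℂ)) (p₂ + t * q₂) (q₂ + t * -p₂) = C' at *
            generalize sexticForm (m : ℂ) (p₂ + t * q₂) (q₂ + t * -p₂) = F' at *
            generalize quadForm (fun i => (A i : ℂ)) (p₂ + t * q₂) (q₂ + t * -p₂) = A' at *
            have e1 : (q₁ * (p₂ + t * q₂) - p₁ * (q₂ + t * -p₂) : ℂ) =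
              t * (q₁ * q₂ + p₁ * p₂) := by linear_combination hκC
            rw [e1] at h3 h4
            have e2 : (q₂ * (p₂ + t * q₂) - p₂ * (q₂ + t * -p₂) : ℂ) =
              t * (q₂ * q₂ + p₂ * p₂) := by ring
            rw [e2] at h4
            linear_combination -(M' + e * G') * h3 - h1 - e ^ 2 * h2 + (r * N' ^ 2 - 4 * e ^ 2 * C') * h4)
        simp only [Complex.ofReal_zero, zero_mul, add_zero, mul_zero, sub_zero, mul_eq_zero, hdotC,
          false_or] at hfun
        refine hfun.resolve_right fun h5 => ?_
        have h6 : cubForm (fun i => (G i : ℂ)) (p₂ : ℂ) (q₂ : ℂ) ≠ 0 := by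
          rw [cubForm_ofReal]; exact_mod_cast hG₂
        have h7 : (2 * e : ℂ) * cubForm (fun i => (G i : ℂ)) (p₂ : ℂ) (q₂ : ℂ) = 0 := by
          linear_combination h5 - hP2
        have h8 : (e : ℂ) ≠ 0 := by exact_mod_cast he
        simp [h6, h8] at h7)
    exact ⟨e, l, he, hek, hl⟩
  · obtain ⟨ε, hε, hεA⟩ : ∃ ε : ℝ, (ε = 1 ∨ ε = -1) ∧
        ε * (s * (cubForm G p₁ q₁ * cubForm G p₂ q₂)) < 0 := by
      rcases lt_or_gt_of_ne (mul_ne_zero hs (mul_ne_zero hG₁ hG₂)) with h | h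
      · exact ⟨1, by simp, by linarith⟩
      · exact ⟨-1, by simp, by linarith⟩
    refine ⟨ε, hε, fun r N M δ hr hN h => ?_⟩
    have hr0 : r ≠ 0 := by rintro rfl; simp at hr
    have hreal := toReal r N M δ h
    have hκ2 : 0 < (q₁ * p₂ - p₁ * q₂) ^ 2 := by positivity
    have hδ : 0 < δ := by
      rcases lt_or_gt_of_ne (mul_ne_zero hr0 hs) with hneg | hpos
      · refine coeff_pos_of_quadForm_neg (r := r) (x := p₁ - p₂) (z := q₁ - q₂) (A := A) hm hN ?_ hreal
        have : r * quadForm A (p₁ - p₂) (q₁ - q₂) = r * s * (q₁ * p₂ - p₁ * q₂) ^ 2 := by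
          rw [hfac]; ring
        rw [this]
        exact mul_neg_of_neg_of_pos hneg hκ2
      · refine coeff_pos_of_quadForm_neg (r := r) (x := p₁ + p₂) (z := q₁ + q₂) (A := A) hm hN ?_ hreal
        have : r * quadForm A (p₁ + p₂) (q₁ + q₂) = -(r * s * (q₁ * p₂ - p₁ * q₂) ^ 2) := by
          rw [hfac]; ring
        rw [this]
        exact neg_lt_zero.2 (mul_pos hpos hκ2)
    have hsign := sign_cubForm_mul hm hδ hκ hr0 hs hfac hreal
    obtain ⟨e, he, hek, hP⟩ := exists_e r N M δ hδ h p₁ q₁ hA₁C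
    have hP1 : cubForm M p₁ q₁ = e * cubForm G p₁ q₁ := by
      rw [sub_smul, cubForm_ofReal, cubForm_ofReal, sub_eq_zero] at hP
      exact_mod_cast hP
    have hP2 : cubForm M p₂ q₂ = e * cubForm G p₂ q₂ := by
      have h1 := hreal p₂ q₂
      have h2 := hG' p₂ q₂
      rw [hA₂] at h1 h2
      have h3 : (cubForm M p₂ q₂ - e * cubForm G p₂ q₂) *
          (cubForm M p₂ q₂ + e * cubForm G p₂ q₂) = 0 := by
        rw [← hek] at h1
        linear_combination -h1 - e ^ 2 * h2
      rcases mul_eq_zero.1 h3 with h4 | h4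
      · linarith
      · exfalso
        rw [hP1, show cubForm M p₂ q₂ = -(e * cubForm G p₂ q₂) by linarith] at hsign
        have he2 : 0 < e ^ 2 := by positivity
        have e1 : 0 < r * (s * (cubForm G p₁ q₁ * cubForm G p₂ q₂)) := by
          by_contra! hle
          nlinarith
        rcases hε with rfl | rfl <;> nlinarith
    obtain ⟨l, hl⟩ := exists_cubForm_eq_quadForm_mul (s := (s : ℂ)) (by exact_mod_cast hs)
      (cast_ne hv₁) (cast_ne hv₂) hfacC hP (fun Q hQ => by
        have h1 := hQ p₂ q₂
        rw [sub_smul, cubForm_ofReal, cubForm_ofReal, hP2, Complex.ofReal_mul, sub_self] at h1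
        refine (mul_eq_zero.1 h1.symm).resolve_left ?_
        exact_mod_cast hκ)
    exact ⟨e, l, he, hek, hl⟩

theorem descentDefect_eval {R : Type*} [CommRing R] (α β κ : R) (A : Fin 3 → R) (Q : Fin 5 → R)
    (M : Fin 4 → R) (x z : R) :
    quadForm A x z * quarForm Q x z -
      (α * cubForm M x z ^ 2 + κ * (hForm x z * cubForm M x z) - β * κ ^ 2 * bForm x z ^ 2) =
    descentDefect α β κ A Q M 0 * z ^ 6 + descentDefect α β κ A Q M 1 * (x * z ^ 5) +
      descentDefect α β κ A Q M 2 * (x ^ 2 * z ^ 4) + descentDefect α β κ A Q M 3 * (x ^ 3 * z ^ 3) +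
      descentDefect α β κ A Q M 4 * (x ^ 4 * z ^ 2) + descentDefect α β κ A Q M 5 * (x ^ 5 * z) +
      descentDefect α β κ A Q M 6 * x ^ 6 := by
  simp [descentDefect, quadForm, quarForm, cubForm, hForm, bForm]
  ring

/-- The coefficients of the sextic form `h² + 4mb²`. -/
def sexticCoeff {R : Type*} [CommRing R] (m : R) : Fin 7 → R :=
  ![1, 4, 2 + 4 * m, -6 + 8 * m, -3 + 4 * m, 2, 1]

set_option synthInstance.maxSize 2000 in
set_option synthInstance.maxHeartbeats 400000 in
theorem hForm_not_multiple_mod_two : ∀ d a₀ a₁ a₂ l₀ l₁ : ZMod 2, d = a₀ * l₀ →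
    0 = a₀ * l₁ + a₁ * l₀ → d = a₁ * l₁ + a₂ * l₀ → d = a₂ * l₁ →
    (a₀ = 0 ∧ a₁ = 0 ∧ a₂ = 0) ∨ (d = 0 ∧ l₀ = 0 ∧ l₁ = 0) := by decide

theorem cubForm_not_multiple {A : Fin 3 → ℤ} (hA : ∃ i, Odd (A i)) {B : Fin 4 → ℤ} {k : ℤ}
    (hk : Odd k) (l : Fin 2 → ℚ)
    (h0 : (2 * B 0 - k : ℚ) = A 0 * l 0) (h1 : (2 * B 1 - 2 * k : ℚ) = A 0 * l 1 + A 1 * l 0)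
    (h2 : (2 * B 2 + k : ℚ) = A 1 * l 1 + A 2 * l 0) (h3 : (2 * B 3 + k : ℚ) = A 2 * l 1) :
    False := by
  obtain ⟨⟨d, hd⟩, hintegral⟩ := IsLocalization.exist_integer_multiples_of_finite (nonZeroDivisors ℤ) l
  obtain ⟨l', hl'⟩ : ∃ l' : Fin 2 → ℤ, ∀ i, (l' i : ℚ) = d * l i := by
    choose f hf using hintegral
    exact ⟨f, fun i => by have := hf i; simpa [Submonoid.smul_def] using this⟩
  have hd0 : d ≠ 0 := nonZeroDivisors.ne_zero hd
  obtain ⟨n, g, hg, hodd⟩ := exists_two_pow_mul_odd (f := ![d, l' 0, l' 1]) ⟨0, by simpa using hd0⟩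
  have g0 : d = 2 ^ n * g 0 := by simpa using hg 0
  have g1 : l' 0 = 2 ^ n * g 1 := by simpa using hg 1
  have g2 : l' 1 = 2 ^ n * g 2 := by simpa using hg 2
  have hl0 := hl' 0
  have hl1 := hl' 1
  rw [g1, g0] at hl0
  rw [g2, g0] at hl1
  push_cast at hl0 hl1
  have hn : (2 ^ n : ℚ) ≠ 0 := by positivity
  replace hl0 : (g 1 : ℚ) = g 0 * l 0 := mul_left_cancel₀ hn (by linear_combination hl0)
  replace hl1 : (g 2 : ℚ) = g 0 * l 1 := mul_left_cancel₀ hn (by linear_combination hl1)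
  have e0 : g 0 * (2 * B 0 - k) = A 0 * g 1 := by
    have : (g 0 * (2 * B 0 - k) : ℚ) = A 0 * g 1 := by rw [h0, hl0]; ring
    exact_mod_cast this
  have e1 : g 0 * (2 * B 1 - 2 * k) = A 0 * g 2 + A 1 * g 1 := by
    have : (g 0 * (2 * B 1 - 2 * k) : ℚ) = A 0 * g 2 + A 1 * g 1 := by rw [h1, hl0, hl1]; ring
    exact_mod_cast this
  have e2 : g 0 * (2 * B 2 + k) = A 1 * g 2 + A 2 * g 1 := by
    have : (g 0 * (2 * B 2 + k) : ℚ) = A 1 * g 2 + A 2 * g 1 := by rw [h2, hl0, hl1]; ring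
    exact_mod_cast this
  have e3 : g 0 * (2 * B 3 + k) = A 2 * g 2 := by
    have : (g 0 * (2 * B 3 + k) : ℚ) = A 2 * g 2 := by rw [h3, hl1]; ring
    exact_mod_cast this
  have two : (2 : ZMod 2) = 0 := rfl
  have hk1 := intCast_zmod_two_of_odd hk
  have c0 := congrArg (Int.cast : ℤ → ZMod 2) e0
  have c1 := congrArg (Int.cast : ℤ → ZMod 2) e1
  have c2 := congrArg (Int.cast : ℤ → ZMod 2) e2
  have c3 := congrArg (Int.cast : ℤ → ZMod 2) e3
  push_cast at c0 c1 c2 c3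
  rw [two, hk1, zero_mul] at c0 c2 c3
  rw [two, zero_mul, zero_mul, sub_zero, mul_zero] at c1
  rw [show (0 - 1 : ZMod 2) = 1 from rfl, mul_one] at c0
  rw [zero_add, mul_one] at c2 c3
  rcases hForm_not_multiple_mod_two _ _ _ _ _ _ c0 c1 c2 c3 with hh | ⟨t0, t1, t2⟩
  · exact (exists_odd_iff_zmod_two A).1 hA hh
  · obtain ⟨i, hi⟩ := hodd
    have := intCast_zmod_two_of_odd hi
    fin_cases i
    · exact zero_ne_one (t0.symm.trans this)
    · exact zero_ne_one (t1.symm.trans this)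
    · exact zero_ne_one (t2.symm.trans this)

theorem sum_fin_seven_mul_pow {R : Type*} [CommRing R] (f : Fin 7 → R) (x : R) :
    ∑ i, f i * x ^ (i : ℕ) = f 0 + f 1 * x + f 2 * x ^ 2 + f 3 * x ^ 3 + f 4 * x ^ 4 + f 5 * x ^ 5 +
      f 6 * x ^ 6 := by
  simp [Fin.sum_univ_succ, Fin.succ_zero_eq_one]
  ring_nf

theorem quarForm_eq_zero_of_mul {A : Fin 3 → ℤ} (hA : A ≠ 0) {X : Fin 5 → ℤ}
    (h : ∀ x z, quadForm A x z * quarForm X x z = 0) : X = 0 := by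
  have h0 := descentDefect_eq_zero (α := 0) (β := 0) (κ := 0) (M := 0) (A := A) (Q := X)
    (fun x z => by rw [h]; ring)
  have e0 := congrFun h0 0
  have e1 := congrFun h0 1
  have e2 := congrFun h0 2
  have e3 := congrFun h0 3
  have e4 := congrFun h0 4
  have e5 := congrFun h0 5
  have e6 := congrFun h0 6
  simp [descentDefect] at e0 e1 e2 e3 e4 e5 e6
  by_cases a0 : A 0 = 0
  · by_cases a1 : A 1 = 0
    · have a2 : A 2 ≠ 0 := fun a2 => hA (by ext i; fin_cases i <;> assumption)
      simp [a0, a1, a2] at e0 e1 e2 e3 e4 e5 e6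
      ext i; fin_cases i <;> assumption
    · simp [a0, a1] at e0 e1
      simp [a0, a1, e1] at e2
      simp [a0, a1, e2] at e3
      simp [a0, a1, e3] at e4
      simp [a1, e4] at e5
      ext i; fin_cases i <;> assumption
  · simp [a0] at e0
    simp [a0, e0] at e1
    simp [a0, e0, e1] at e2
    simp [a0, e1, e2] at e3
    simp [a0, e2, e3] at e4
    ext i; fin_cases i <;> assumption

theorem exists_sq_relation {L : Type*} [Field L] [Algebra ℚ L] (hL : Module.finrank ℚ L = 6) {θ : L}
    {m : ℚ}
    (hθ : ∀ e : Fin 7 → ℚ, ∑ i, algebraMap ℚ L (e i) * θ ^ (i : ℕ) = 0 →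
      ∃ δ : ℚ, ∀ i, e i = δ * sexticCoeff m i)
    {A : Fin 3 → ℚ} {r : ℚ} {ζ : L}
    (h : algebraMap ℚ L r * quadForm (fun i => algebraMap ℚ L (A i)) θ 1 = ζ ^ 2) :
    ∃ (N : Fin 3 → ℚ) (M : Fin 4 → ℚ) (δ : ℚ), N ≠ 0 ∧
      ∀ i, descentDefect 1 0 0 (fun i => r * A i) (sqCoeff N) M i = -δ * sexticCoeff m i := by
  have hdep : ¬LinearIndependent ℚ ![ζ, ζ * θ, ζ * θ ^ 2, -1, -θ, -θ ^ 2, -θ ^ 3] := by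
    intro hli
    have : FiniteDimensional ℚ L := FiniteDimensional.of_finrank_pos (by omega)
    have := hli.fintype_card_le_finrank
    simp [hL] at this
  obtain ⟨g, hg, i, hi⟩ := Fintype.not_linearIndependent_iff.1 hdep
  simp [Fin.sum_univ_succ, Algebra.smul_def] at hg
  refine ⟨![g 0, g 1, g 2], ![g 3, g 4, g 5, g 6], ?_⟩
  have hE' := descentDefect_eval (1 : L) 0 0 (fun i => algebraMap ℚ L (r * A i))
    (fun i => algebraMap ℚ L (sqCoeff ![g 0, g 1, g 2] i))
    (fun i => algebraMap ℚ L (![g 3, g 4, g 5, g 6] i)) θ 1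
  have hmap : ∀ i, descentDefect (1 : L) 0 0 (fun i => algebraMap ℚ L (r * A i))
    (fun i => algebraMap ℚ L (sqCoeff ![g 0, g 1, g 2] i))
    (fun i => algebraMap ℚ L (![g 3, g 4, g 5, g 6] i)) i =
      algebraMap ℚ L (descentDefect 1 0 0 (fun i => r * A i) (sqCoeff ![g 0, g 1, g 2])
        ![g 3, g 4, g 5, g 6] i) := fun i => by
    rw [map_descentDefect, map_one, map_zero]
  simp only [hmap] at hE'
  obtain ⟨δ, hδ⟩ := hθ (descentDefect 1 0 0 (fun i => r * A i) (sqCoeff ![g 0, g 1, g 2])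
        ![g 3, g 4, g 5, g 6]) (by
    rw [sum_fin_seven_mul_pow]
    have : quadForm (fun i => algebraMap ℚ L (r * A i)) θ 1 *
        quarForm (fun i => algebraMap ℚ L (sqCoeff ![g 0, g 1, g 2] i)) θ 1 -
        cubForm (fun i => algebraMap ℚ L (![g 3, g 4, g 5, g 6] i)) θ 1 ^ 2 = 0 := by
      have e1 : quadForm (fun i => algebraMap ℚ L (r * A i)) θ 1 = ζ ^ 2 := by
        rw [← h]; simp only [quadForm, map_mul]; ring
      simp only [map_sqCoeff (algebraMap ℚ L)]
      rw [e1, quarForm_sqCoeff]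
      have e2 : ζ * quadForm (fun i => algebraMap ℚ L (![g 0, g 1, g 2] i)) θ 1 =
          cubForm (fun i => algebraMap ℚ L (![g 3, g 4, g 5, g 6] i)) θ 1 := by
        simp [quadForm, cubForm]
        linear_combination hg
      rw [← e2]; ring
    linear_combination -hE' + this)
  refine ⟨-δ, fun hN => ?_, by simpa using hδ⟩
  have n0 : g 0 = 0 := congrFun hN 0
  have n1 : g 1 = 0 := congrFun hN 1
  have n2 : g 2 = 0 := congrFun hN 2
  simp [n0, n1, n2] at hg
  obtain ⟨δ', hδ'⟩ := hθ ![g 3, g 4, g 5, g 6, 0, 0, 0] (by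
    simp [Fin.sum_univ_succ]
    linear_combination -hg)
  have d6 : δ' = 0 := by
    have := hδ' 6
    simp [sexticCoeff] at this
    exact this.symm
  have d0 := hδ' 0
  have d1 := hδ' 1
  have d2 := hδ' 2
  have d3 := hδ' 3
  simp [d6] at d0 d1 d2 d3
  fin_cases i <;> simp_all

theorem exists_rat_linear_retraction : ∃ φ : ℂ →ₗ[ℚ] ℚ, ∀ q : ℚ, φ q = q := by
  obtain ⟨φ, hφ⟩ := (Algebra.linearMap ℚ ℂ).exists_leftInverse_of_injective
    (LinearMap.ker_eq_bot.2 (algebraMap ℚ ℂ).injective)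
  exact ⟨φ, fun q => by simpa using LinearMap.congr_fun hφ q⟩

theorem cubForm_coeff_of_eq_mul {P : Fin 4 → ℂ} {A : Fin 3 → ℂ} {l : Fin 2 → ℂ}
    (h : ∀ x z, cubForm P x z = quadForm A x z * linForm l x z) :
    P 0 = A 0 * l 0 ∧ P 1 = A 0 * l 1 + A 1 * l 0 ∧ P 2 = A 1 * l 1 + A 2 * l 0 ∧
      P 3 = A 2 * l 1 := by
  have h0 := h 0 1
  have h1 := h 1 0
  have h2 := h 1 1
  have h3 := h (-1) 1
  simp only [cubForm, quadForm, linForm] at h0 h1 h2 h3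
  refine ⟨by linear_combination h0, ?_, ?_, by linear_combination h1⟩
  · linear_combination h2 / 2 - h3 / 2 - h1
  · linear_combination h2 / 2 + h3 / 2 - h0

theorem rat_of_cubForm_congr {A : Fin 3 → ℤ} (hA : ∃ i, Odd (A i)) {B : Fin 4 → ℤ} {k : ℤ}
    (hk : Odd k) {M : Fin 4 → ℚ} {e : ℂ} {l : Fin 2 → ℂ}
    (h0 : M 0 - e * (2 * B 0 - k) = A 0 * l 0)
    (h1 : M 1 - e * (2 * B 1 - 2 * k) = A 0 * l 1 + A 1 * l 0)
    (h2 : M 2 - e * (2 * B 2 + k) = A 1 * l 1 + A 2 * l 0)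
    (h3 : M 3 - e * (2 * B 3 + k) = A 2 * l 1) :
    ∃ (e' : ℚ) (l' : Fin 2 → ℚ), e = e' ∧ M 0 - e' * (2 * B 0 - k) = A 0 * l' 0 ∧
      M 1 - e' * (2 * B 1 - 2 * k) = A 0 * l' 1 + A 1 * l' 0 ∧
      M 2 - e' * (2 * B 2 + k) = A 1 * l' 1 + A 2 * l' 0 ∧
      M 3 - e' * (2 * B 3 + k) = A 2 * l' 1 := by
  obtain ⟨φ, hφ⟩ := exists_rat_linear_retraction
  have hmul : ∀ (q : ℤ) (w : ℂ), φ (q * w) = q * φ w := fun q w => by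
    have := φ.map_smul (q : ℚ) w
    simpa [Algebra.smul_def] using this
  have proj : ∀ (M : ℚ) (w : ℂ) (n : ℤ) (a b : ℤ) (u v : ℂ), M - w * n = a * u + b * v →
      M - φ w * n = a * φ u + b * φ v := by
    intro M w n a b u v h
    have := congrArg φ h
    rw [map_sub, map_add, hφ, mul_comm w, hmul, hmul, hmul] at this
    linear_combination this
  have p0 := proj (M 0) e (2 * B 0 - k) (A 0) 0 (l 0) 0 (by push_cast; linear_combination h0)
  have p1 := proj (M 1) e (2 * B 1 - 2 * k) (A 0) (A 1) (l 1) (l 0)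
    (by push_cast; linear_combination h1)
  have p2 := proj (M 2) e (2 * B 2 + k) (A 1) (A 2) (l 1) (l 0) (by push_cast; linear_combination h2)
  have p3 := proj (M 3) e (2 * B 3 + k) (A 2) 0 (l 1) 0 (by push_cast; linear_combination h3)
  push_cast at p0 p1 p2 p3
  refine ⟨φ e, ![φ (l 0), φ (l 1)], ?_, by simpa using p0, by simpa using p1, by simpa using p2,
    by simpa using p3⟩
  by_contra hne
  have hne' : (φ e : ℂ) - e ≠ 0 := sub_ne_zero.2 (Ne.symm hne)
  have castC : ∀ (M E u v : ℚ) (n a b : ℤ), M - E * n = a * u + b * v →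
      (M : ℂ) - E * n = a * u + b * v := by
    intro M E u v n a b h
    exact_mod_cast congrArg (Rat.cast : ℚ → ℂ) h
  have c0 := castC (M 0) (φ e) (φ (l 0)) 0 (2 * B 0 - k) (A 0) 0
    (by push_cast; linear_combination p0)
  have c1 := castC (M 1) (φ e) (φ (l 1)) (φ (l 0)) (2 * B 1 - 2 * k) (A 0) (A 1)
    (by push_cast; linear_combination p1)
  have c2 := castC (M 2) (φ e) (φ (l 1)) (φ (l 0)) (2 * B 2 + k) (A 1) (A 2)
    (by push_cast; linear_combination p2)
  have c3 := castC (M 3) (φ e) (φ (l 1)) 0 (2 * B 3 + k) (A 2) 0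
    (by push_cast; linear_combination p3)
  push_cast at c0 c1 c2 c3
  set u := (l 0 - φ (l 0)) / (φ e - e) with hu
  set v := (l 1 - φ (l 1)) / (φ e - e) with hv
  have hu' : (φ e - e) * u = l 0 - φ (l 0) := mul_div_cancel₀ _ hne'
  have hv' : (φ e - e) * v = l 1 - φ (l 1) := mul_div_cancel₀ _ hne'
  have q0 := proj (2 * B 0 - k) 0 0 (A 0) 0 u 0 (by
    apply mul_left_cancel₀ hne'
    push_cast
    linear_combination h0 - c0 - A 0 * hu')
  have q1 := proj (2 * B 1 - 2 * k) 0 0 (A 0) (A 1) v u (by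
    apply mul_left_cancel₀ hne'
    push_cast
    linear_combination h1 - c1 - A 0 * hv' - A 1 * hu')
  have q2 := proj (2 * B 2 + k) 0 0 (A 1) (A 2) v u (by
    apply mul_left_cancel₀ hne'
    push_cast
    linear_combination h2 - c2 - A 1 * hv' - A 2 * hu')
  have q3 := proj (2 * B 3 + k) 0 0 (A 2) 0 v 0 (by
    apply mul_left_cancel₀ hne'
    push_cast
    linear_combination h3 - c3 - A 2 * hv')
  push_cast at q0 q1 q2 q3
  refine cubForm_not_multiple (B := B) hA hk ![φ u, φ v] ?_ ?_ ?_ ?_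
  · simp; linear_combination q0
  · simp; linear_combination q1
  · simp; linear_combination q2
  · simp; linear_combination q3

theorem exists_int_mul_sq_eq {m : ℤ} {A : Fin 3 → ℤ} (hA : ∃ i, Odd (A i)) {B : Fin 4 → ℤ}
    {C : Fin 5 → ℤ} {k r : ℤ} (hD : descentDefect 1 m k A C B = 0) {N : Fin 3 → ℚ} {M : Fin 4 → ℚ}
    {e δ : ℚ} {l : Fin 2 → ℚ} (hN : N ≠ 0) (he : e ≠ 0) (hδ : e ^ 2 * k ^ 2 = δ)
    (hrel : ∀ x z : ℚ, r * quadForm (fun i => (A i : ℚ)) x z * quadForm N x z ^ 2 =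
      cubForm M x z ^ 2 - δ * sexticForm (m : ℚ) x z)
    (h0 : M 0 - e * (2 * B 0 - k) = A 0 * l 0)
    (h1 : M 1 - e * (2 * B 1 - 2 * k) = A 0 * l 1 + A 1 * l 0)
    (h2 : M 2 - e * (2 * B 2 + k) = A 1 * l 1 + A 2 * l 0)
    (h3 : M 3 - e * (2 * B 3 + k) = A 2 * l 1) :
    ∃ (R e : ℤ) (l : Fin 2 → ℤ) (N : Fin 3 → ℤ), e ≠ 0 ∧ N ≠ 0 ∧
      ∀ x z, R * quadForm N x z ^ 2 = quadForm A x z * linForm l x z ^ 2 +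
        e * linForm l x z * (2 * cubForm B x z + k * hForm x z) + e ^ 2 * quarForm C x z := by
  obtain ⟨⟨d, hd⟩, hintegral⟩ := IsLocalization.exist_integer_multiples_of_finite (nonZeroDivisors ℤ)
    ![N 0 / 2, N 1 / 2, N 2 / 2, l 0 / 2, l 1 / 2, e]
  obtain ⟨f, hf⟩ : ∃ f : Fin 6 → ℤ, ∀ i,
      (f i : ℚ) = d * (![N 0 / 2, N 1 / 2, N 2 / 2, l 0 / 2, l 1 / 2, e] : Fin 6 → ℚ) i := by
    choose f hf using hintegral
    exact ⟨f, fun i => by have := hf i; simpa [Submonoid.smul_def] using this⟩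
  have hd0 : (d : ℚ) ≠ 0 := by exact_mod_cast nonZeroDivisors.ne_zero hd
  have f0 : (f 0 : ℚ) = d * (N 0 / 2) := hf 0
  have f1 : (f 1 : ℚ) = d * (N 1 / 2) := hf 1
  have f2 : (f 2 : ℚ) = d * (N 2 / 2) := hf 2
  have f3 : (f 3 : ℚ) = d * (l 0 / 2) := hf 3
  have f4 : (f 4 : ℚ) = d * (l 1 / 2) := hf 4
  have f5 : (f 5 : ℚ) = d * e := hf 5
  refine ⟨r, f 5, ![f 3, f 4], ![f 0, f 1, f 2], ?_, ?_, ?_⟩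
  · intro hz
    rw [hz, Int.cast_zero, eq_comm] at f5
    exact mul_ne_zero hd0 he f5
  · intro hz
    have z0 : f 0 = 0 := congrFun hz 0
    have z1 : f 1 = 0 := congrFun hz 1
    have z2 : f 2 = 0 := congrFun hz 2
    rw [z0] at f0
    rw [z1] at f1
    rw [z2] at f2
    apply hN
    ext i
    simp [hd0] at f0 f1 f2
    fin_cases i <;> assumption
  have hA0 : A ≠ 0 := by
    rintro rfl
    simp at hA
  have key : (fun i => (![r * f 0 ^ 2 - A 0 * f 3 ^ 2 - f 5 * f 3 * (2 * B 0 - k) - f 5 ^ 2 * C 0,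
      2 * r * f 0 * f 1 - (A 1 * f 3 ^ 2 + 2 * A 0 * f 3 * f 4) -
        f 5 * (f 3 * (2 * B 1 - 2 * k) + f 4 * (2 * B 0 - k)) - f 5 ^ 2 * C 1,
      r * (2 * f 0 * f 2 + f 1 ^ 2) - (A 0 * f 4 ^ 2 + 2 * A 1 * f 3 * f 4 + A 2 * f 3 ^ 2) -
        f 5 * (f 3 * (2 * B 2 + k) + f 4 * (2 * B 1 - 2 * k)) - f 5 ^ 2 * C 2,
      2 * r * f 1 * f 2 - (A 1 * f 4 ^ 2 + 2 * A 2 * f 3 * f 4) -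
        f 5 * (f 3 * (2 * B 3 + k) + f 4 * (2 * B 2 + k)) - f 5 ^ 2 * C 3,
      r * f 2 ^ 2 - A 2 * f 4 ^ 2 - f 5 * f 4 * (2 * B 3 + k) - f 5 ^ 2 * C 4] : Fin 5 → ℤ) i) =
      0 := by
    refine quarForm_eq_zero_of_mul hA0 fun x z => ?_
    have hr := hrel x z
    have hd1 := eval_of_descentDefect_eq_zero hD x z
    have hM : cubForm M x z = e * (2 * cubForm (fun i => (B i : ℚ)) x z + k * hForm (x : ℚ) z) +
        quadForm (fun i => (A i : ℚ)) x z * linForm l x z := by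
      simp only [cubForm, quadForm, linForm, hForm]
      linear_combination (z : ℚ) ^ 3 * h0 + (x : ℚ) * z ^ 2 * h1 + (x : ℚ) ^ 2 * z * h2 +
        (x : ℚ) ^ 3 * h3
    have hN' : quadForm N x z * d = 2 * quadForm (fun i => ((![f 0, f 1, f 2] i : ℤ) : ℚ)) x z := by
      simp [quadForm, f0, f1, f2]; ring
    have hl' : linForm l x z * d = 2 * linForm (fun i => ((![f 3, f 4] i : ℤ) : ℚ)) x z := by
      simp [linForm, f3, f4]; ring
    have hd2 : quadForm (fun i => (A i : ℚ)) x z * quarForm (fun i => (C i : ℚ)) x z =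
        1 * cubForm (fun i => (B i : ℚ)) x z ^ 2 +
          k * (hForm (x : ℚ) z * cubForm (fun i => (B i : ℚ)) x z) -
          m * k ^ 2 * bForm (x : ℚ) z ^ 2 := by
      simp only [quadForm, quarForm, cubForm, hForm, bForm] at hd1 ⊢
      exact_mod_cast hd1
    have main : quadForm (fun i => (A i : ℚ)) x z *
        (r * quadForm (fun i => ((![f 0, f 1, f 2] i : ℤ) : ℚ)) x z ^ 2 -
          (quadForm (fun i => (A i : ℚ)) x z * linForm (fun i => ((![f 3, f 4] i : ℤ) : ℚ)) x z ^ 2 +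
          f 5 * linForm (fun i => ((![f 3, f 4] i : ℤ) : ℚ)) x z *
            (2 * cubForm (fun i => (B i : ℚ)) x z + k * hForm (x : ℚ) z) +
          f 5 ^ 2 * quarForm (fun i => (C i : ℚ)) x z)) = 0 := by
      rw [hM, ← hδ] at hr
      rw [f5]
      simp only [sexticForm] at hr
      generalize quadForm (fun i => ((![f 0, f 1, f 2] i : ℤ) : ℚ)) x z = N' at *
      generalize linForm (fun i => ((![f 3, f 4] i : ℤ) : ℚ)) x z = l' at *
      obtain rfl : N' = quadForm N x z * d / 2 := by linarith
      obtain rfl : l' = linForm l x z * d / 2 := by linarith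
      linear_combination d ^ 2 / 4 * hr - e ^ 2 * d ^ 2 * hd2
    have : ((quadForm A x z * quarForm (![r * f 0 ^ 2 - A 0 * f 3 ^ 2 -
        f 5 * f 3 * (2 * B 0 - k) - f 5 ^ 2 * C 0,
      2 * r * f 0 * f 1 - (A 1 * f 3 ^ 2 + 2 * A 0 * f 3 * f 4) -
        f 5 * (f 3 * (2 * B 1 - 2 * k) + f 4 * (2 * B 0 - k)) - f 5 ^ 2 * C 1,
      r * (2 * f 0 * f 2 + f 1 ^ 2) - (A 0 * f 4 ^ 2 + 2 * A 1 * f 3 * f 4 + A 2 * f 3 ^ 2) -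
        f 5 * (f 3 * (2 * B 2 + k) + f 4 * (2 * B 1 - 2 * k)) - f 5 ^ 2 * C 2,
      2 * r * f 1 * f 2 - (A 1 * f 4 ^ 2 + 2 * A 2 * f 3 * f 4) -
        f 5 * (f 3 * (2 * B 3 + k) + f 4 * (2 * B 2 + k)) - f 5 ^ 2 * C 3,
      r * f 2 ^ 2 - A 2 * f 4 ^ 2 - f 5 * f 4 * (2 * B 3 + k) - f 5 ^ 2 * C 4] : Fin 5 → ℤ) x z
        : ℤ) : ℚ) = 0 := by
      rw [← main]
      simp only [quadForm, quarForm, cubForm, linForm, hForm, Matrix.cons_val]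
      push_cast
      ring
    exact_mod_cast this
  intro x z
  have k0 := congrFun key 0
  have k1 := congrFun key 1
  have k2 := congrFun key 2
  have k3 := congrFun key 3
  have k4 := congrFun key 4
  simp at k0 k1 k2 k3 k4
  simp [quadForm, quarForm, cubForm, linForm, hForm]
  linear_combination z ^ 4 * k0 + x * z ^ 3 * k1 + x ^ 2 * z ^ 2 * k2 + x ^ 3 * z * k3 + x ^ 4 * k4

theorem eval_of_sq_relation {S : Type*} [CommRing S] (f : ℚ →+* S) {m r δ : ℚ} {A N : Fin 3 → ℚ}
    {M : Fin 4 → ℚ} (h : ∀ i, descentDefect 1 0 0 (fun i => r * A i) (sqCoeff N) M i =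
      -δ * sexticCoeff m i) (x z : S) :
    f r * quadForm (fun i => f (A i)) x z * quadForm (fun i => f (N i)) x z ^ 2 =
      cubForm (fun i => f (M i)) x z ^ 2 - f δ * sexticForm (f m) x z := by
  have key := descentDefect_eval 1 0 0 (fun i => f (r * A i)) (fun i => f (sqCoeff N i))
    (fun i => f (M i)) x z
  have hf : ∀ i, descentDefect 1 0 0 (fun i => f (r * A i)) (fun i => f (sqCoeff N i))
      (fun i => f (M i)) i = f (-δ * sexticCoeff m i) := fun i => by
    rw [← h i, map_descentDefect]; simp
  rw [hf, hf, hf, hf, hf, hf, hf] at key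
  simp only [map_sqCoeff, quarForm_sqCoeff] at key
  simp only [sexticCoeff, Matrix.cons_val, map_add, map_mul, map_neg, map_ofNat, map_one] at key
  simp only [quadForm, cubForm, sexticForm, hForm, bForm] at key ⊢
  linear_combination key

/-- If `A(θ)` is a square up to sign, then a suitable quadric cut out by a translate is a multiple
of a square. -/
theorem exists_mul_sq_eq {L : Type*} [Field L] [Algebra ℚ L] (hL : Module.finrank ℚ L = 6) {θ s : L}
    {m : ℤ} (hm : 0 < m) (hs : s ^ 2 = -(m : L))
    (hθ : ∀ e : Fin 7 → ℚ, ∑ i, algebraMap ℚ L (e i) * θ ^ (i : ℕ) = 0 →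
      ∃ δ : ℚ, ∀ i, e i = δ * sexticCoeff (m : ℚ) i)
    {A : Fin 3 → ℤ} (hA : ∃ i, Odd (A i)) {B : Fin 4 → ℤ} {C : Fin 5 → ℤ} {k : ℤ} (hk : Odd k)
    (hD : descentDefect 1 m k A C B = 0) {ξ : L}
    (hξ : quadForm (fun i => (A i : L)) θ 1 = ξ ^ 2 ∨ quadForm (fun i => (A i : L)) θ 1 = -ξ ^ 2) :
    ∃ (R e : ℤ) (l : Fin 2 → ℤ) (N : Fin 3 → ℤ), e ≠ 0 ∧ N ≠ 0 ∧
      ∀ x z, R * quadForm N x z ^ 2 = quadForm A x z * linForm l x z ^ 2 +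
        e * linForm l x z * (2 * cubForm B x z + k * hForm x z) + e ^ 2 * quarForm C x z := by
  have hA0 : (fun i => (A i : ℝ)) ≠ 0 := by
    obtain ⟨i, hi⟩ := hA
    intro h
    have : A i = 0 := by simpa using congrFun h i
    simp [this] at hi
  have hk0 : (k : ℝ) ≠ 0 := by
    have : k ≠ 0 := by rintro rfl; simp at hk
    exact_mod_cast this
  obtain ⟨ε, hε, hS⟩ := exists_sign_cubForm_congr hA0
    (G := fun i => ((2 * B i + k * (![-1, -2, 1, 1] : Fin 4 → ℤ) i : ℤ) : ℝ))
    (C := fun i => (C i : ℝ)) (m := m) hk0 (by exact_mod_cast hm) (by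
      intro x z
      have hd : descentDefect (1 : ℂ) m k (fun i => (A i : ℂ)) (fun i => (C i : ℂ))
          (fun i => (B i : ℂ)) = 0 := by
        ext i
        have := map_descentDefect (Int.castRingHom ℂ) 1 m k A C B i
        simpa [hD] using this.symm
      have := eval_of_descentDefect_eq_zero hd x z
      simp only [quadForm, quarForm, cubForm, hForm, bForm, sexticForm, Matrix.cons_val] at this ⊢
      push_cast
      linear_combination (-4 : ℂ) * this)
  obtain ⟨r, ζ, hr, hζ⟩ : ∃ (r : ℤ) (ζ : L), 0 < ε * r ∧
      (r : L) * quadForm (fun i => (A i : L)) θ 1 = ζ ^ 2 := by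
    have hm' : (0 : ℝ) < m := by exact_mod_cast hm
    rcases hξ with h | h <;> rcases hε with rfl | rfl
    · exact ⟨1, ξ, by simp, by simp [h]⟩
    · exact ⟨-m, s * ξ, by push_cast; linarith, by rw [h, mul_pow, hs]; push_cast; ring⟩
    · exact ⟨m, s * ξ, by linarith, by rw [h, mul_pow, hs]; ring⟩
    · exact ⟨-1, ξ, by push_cast; linarith, by rw [h]; push_cast; ring⟩
  obtain ⟨N, M, δ, hN, hrel⟩ := exists_sq_relation hL (m := m) hθ (A := fun i => (A i : ℚ))
    (r := r) (ζ := ζ) (by simpa using hζ)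
  obtain ⟨e, l, he, heδ, hl⟩ := hS r (fun i => (N i : ℝ)) (fun i => (M i : ℝ)) δ hr (by
      intro h
      apply hN
      ext i
      simpa using congrFun h i) (by
      intro x z
      have := eval_of_sq_relation (algebraMap ℚ ℂ) hrel x z
      simpa using this)
  obtain ⟨h0, h1, h2, h3⟩ := cubForm_coeff_of_eq_mul hl
  obtain ⟨e', l', hee, g0, g1, g2, g3⟩ := rat_of_cubForm_congr hA hk (B := B) (M := M) (e := e)
    (l := l) (by simp at h0; linear_combination h0) (by simp at h1; linear_combination h1)
    (by simp at h2; linear_combination h2) (by simp at h3; linear_combination h3)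
  replace hee : e = e' := by exact_mod_cast hee
  subst hee
  refine exists_int_mul_sq_eq hA hD hN (e := e') (δ := δ) (r := r) (l := l') (by exact_mod_cast he)
    (by exact_mod_cast heδ) (fun x z => ?_) g0 g1 g2 g3
  have := eval_of_sq_relation (RingHom.id ℚ) hrel x z
  simpa using this

section

open NumberField
open scoped Matrix

/-- A commutative group generated by three elements modulo squares is covered by the products of
any three elements which are independent modulo squares. -/
theorem exists_eq_prod_mul_sq_of_independent {U : Type*} [CommGroup U] (f g : Fin 3 → U)
    (hf : ∀ u : U, ∃ (a : Fin 3 → ℤ), u = ∏ i, f i ^ a i)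
    (hg : ∀ n : Fin 3 → Fin 2, n ≠ 0 → ¬IsSquare (∏ i, g i ^ (n i : ℕ))) (u : U) :
    ∃ (n : Fin 3 → Fin 2) (v : U), u = (∏ i, g i ^ (n i : ℕ)) * v ^ 2 := by
  let S : Subgroup U := (powMonoidHom 2).range
  have hS : ∀ x : U, x ∈ S ↔ IsSquare x := fun x => by
    rw [isSquare_iff_exists_sq]
    exact ⟨fun ⟨y, hy⟩ => ⟨y, hy.symm⟩, fun ⟨y, hy⟩ => ⟨y, hy.symm⟩⟩
  let Φ : (Fin 3 → U) → (Fin 3 → Fin 2) → U ⧸ S := fun g n =>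
    ((∏ i, g i ^ (n i : ℕ) : U) : U ⧸ S)
  have hsurj : Function.Surjective (Φ f) := by
    intro q
    obtain ⟨u, rfl⟩ := QuotientGroup.mk_surjective q
    obtain ⟨a, rfl⟩ := hf u
    refine ⟨fun i => ⟨(a i % 2).toNat, by omega⟩, ?_⟩
    rw [QuotientGroup.eq, ← Finset.prod_inv_distrib, ← Finset.prod_mul_distrib]
    refine Subgroup.prod_mem _ fun i _ => (hS _).2 ⟨f i ^ (a i / 2), ?_⟩
    rw [← zpow_natCast, ← zpow_neg, ← zpow_add, ← zpow_add]
    congr 1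
    simp only
    omega
  have hinj : Function.Injective (Φ g) := by
    intro n n' h
    by_contra hne
    rw [QuotientGroup.eq, ← Finset.prod_inv_distrib, ← Finset.prod_mul_distrib, hS] at h
    refine hg (fun i => n i + n' i) ?_ ?_
    · intro h0
      apply hne
      ext i
      have := congrFun h0 i
      revert this
      simp only [Pi.zero_apply]
      generalize n i = a
      generalize n' i = b
      revert a b
      decide
    · have : ∀ i, ∃ y, g i ^ ((n i + n' i : Fin 2) : ℕ) = ((g i ^ (n i : ℕ))⁻¹ * g i ^ (n' i : ℕ)) * y ^ 2 := by
        intro i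
        generalize n i = a
        generalize n' i = b
        fin_cases a <;> fin_cases b
        · exact ⟨1, by simp⟩
        · exact ⟨1, by simp⟩
        · exact ⟨g i, by simp [pow_two]⟩
        · exact ⟨1, by simp⟩
      choose y hy using this
      simp only [hy, Finset.prod_mul_distrib] at h ⊢
      refine h.mul ?_
      rw [Finset.prod_pow]
      exact ⟨_, pow_two _⟩
  have hfin : Finite (U ⧸ S) := Finite.of_surjective _ hsurj
  have hbij : Function.Bijective (Φ g) := by
    have h1 := Nat.card_le_card_of_surjective _ hsurj
    have h2 := Nat.card_le_card_of_injective _ hinj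
    exact (Nat.bijective_iff_injective_and_card _).2 ⟨hinj, le_antisymm h2 h1⟩
  obtain ⟨n, hn⟩ := hbij.2 (u : U ⧸ S)
  rw [QuotientGroup.eq, hS, isSquare_iff_exists_sq] at hn
  obtain ⟨v, hv⟩ := hn
  exact ⟨n, v, by rw [← hv]; group⟩

theorem exists_units_generators {L : Type*} [Field L] [NumberField L] (hr : Units.rank L = 2) :
    ∃ f : Fin 3 → (𝓞 L)ˣ, ∀ u, ∃ a : Fin 3 → ℤ, u = ∏ i, f i ^ a i := by
  obtain ⟨ζ, hζ⟩ := IsCyclic.exists_generator (α := Units.torsion L)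
  refine ⟨Fin.cons (ζ : (𝓞 L)ˣ) fun i => Units.fundSystem L (Fin.cast hr.symm i), fun u => ?_⟩
  obtain ⟨⟨z, e⟩, h, -⟩ := Units.exist_unique_eq_mul_prod L u
  obtain ⟨n, rfl⟩ := Subgroup.mem_zpowers_iff.1 (hζ z)
  refine ⟨Fin.cons n fun i => e (Fin.cast hr.symm i), ?_⟩
  rw [Fin.prod_univ_succ]
  simp only [Fin.cons_zero, Fin.cons_succ]
  rw [h]
  congr 1
  exact (Fintype.prod_equiv (finCongr hr.symm) _ _ fun i => rfl).symm

theorem nrRealPlaces_eq_zero_of_sq {L : Type*} [Field L] [NumberField L] {s : L} {m : ℕ} (hm : 0 < m)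
    (hs : s ^ 2 = -(m : L)) : InfinitePlace.nrRealPlaces L = 0 := by
  classical
  rw [InfinitePlace.nrRealPlaces, Fintype.card_eq_zero_iff]
  refine ⟨fun ⟨w, hw⟩ => ?_⟩
  have h := congrArg (InfinitePlace.embedding_of_isReal hw) hs
  simp only [map_pow, map_neg, map_natCast] at h
  have : (0 : ℝ) < m := by exact_mod_cast hm
  nlinarith [sq_nonneg (InfinitePlace.embedding_of_isReal hw s)]

theorem nrComplexPlaces_eq_three {L : Type*} [Field L] [NumberField L] (h : Module.finrank ℚ L = 6)
    (hr : InfinitePlace.nrRealPlaces L = 0) : InfinitePlace.nrComplexPlaces L = 3 := by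
  have := InfinitePlace.card_add_two_mul_card_eq_rank L
  omega

theorem units_rank_eq_two {L : Type*} [Field L] [NumberField L] (h : Module.finrank ℚ L = 6)
    (hr : InfinitePlace.nrRealPlaces L = 0) : Units.rank L = 2 := by
  rw [Units.rank, InfinitePlace.card_eq_nrRealPlaces_add_nrComplexPlaces, hr,
    nrComplexPlaces_eq_three h hr]

/-- The discriminant of a number field is bounded by that of any basis of integers. -/
theorem abs_discr_le {L : Type*} [Field L] [NumberField L] {ι : Type*} [Fintype ι] [DecidableEq ι]
    (b : Module.Basis ι ℚ L) (hb : ∀ i, IsIntegral ℤ (b i)) :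
    |(discr L : ℚ)| ≤ |Algebra.discr ℚ b| := by
  let e : ι ≃ Module.Free.ChooseBasisIndex ℤ (𝓞 L) := b.indexEquiv (integralBasis L)
  let ω : Module.Basis ι ℤ (𝓞 L) := (RingOfIntegers.basis L).reindex e.symm
  let c : ι → 𝓞 L := fun i => ⟨b i, hb i⟩
  have hdisc : Algebra.discr ℤ c = (ω.toMatrix c).det ^ 2 * discr L := by
    rw [discr, ← Algebra.discr_reindex ℤ (RingOfIntegers.basis L) e.symm]
    have : c = (fun i => ω i) ᵥ* (ω.toMatrix c).map (algebraMap ℤ (𝓞 L)) := by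
      ext i
      have := ω.sum_toMatrix_smul_self c i
      rw [← this]
      simp [Matrix.vecMul, dotProduct, mul_comm]
    conv_lhs => rw [this]
    rw [Algebra.discr_of_matrix_vecMul]
    congr 2
    ext i
    simp [ω]
  have hcast : Algebra.discr ℚ b = (Algebra.discr ℤ c : ℚ) := by
    rw [Algebra.discr_def, Algebra.discr_def]
    change _ = Int.castRingHom ℚ _
    rw [RingHom.map_det]
    congr 1
    ext i j
    simp only [Algebra.traceMatrix_apply, Algebra.traceForm_apply, RingHom.mapMatrix_apply,
      Matrix.map_apply]
    have := Algebra.trace_localization ℤ (nonZeroDivisors ℤ) (Rₘ := ℚ) (Sₘ := L) (c i * c j)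
    rw [map_mul] at this
    exact this
  have hne : Algebra.discr ℚ b ≠ 0 := Algebra.discr_not_zero_of_basis ℚ b
  have hd : (ω.toMatrix c).det ≠ 0 := by
    intro h
    rw [hcast, hdisc, h] at hne
    simp at hne
  rw [hcast, hdisc, Int.cast_mul, Int.cast_pow, abs_mul, abs_pow]
  have h1 : (1 : ℚ) ≤ |((ω.toMatrix c).det : ℚ)| ^ 2 :=
    one_le_pow₀ (by exact_mod_cast Int.one_le_abs hd)
  nlinarith [abs_nonneg (discr L : ℚ)]

end

open Polynomial in
/-- Over a field, if `A * C = B²` with `A` quadratic and `A`, `C` have a common root in some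
extension, then `A` divides `B`. -/
theorem exists_linForm_of_common_root {F E : Type*} [Field F] [Field E] [Algebra F E]
    {A : Fin 3 → F} {B : Fin 4 → F} {C : Fin 5 → F} {μ : F} (hA : A ≠ 0)
    (h : descentDefect 1 μ 0 A C B = 0) {τ : E} (hτ : IsIntegral F τ)
    (hAτ : quadForm (fun i => algebraMap F E (A i)) τ 1 = 0)
    (hCτ : quarForm (fun i => algebraMap F E (C i)) τ 1 = 0) :
    ∃ l : Fin 2 → F, B 0 = A 0 * l 0 ∧ B 1 = A 0 * l 1 + A 1 * l 0 ∧
      B 2 = A 1 * l 1 + A 2 * l 0 ∧ B 3 = A 2 * l 1 := by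
  set a : F[X] := Polynomial.C (A 0) + Polynomial.C (A 1) * X + Polynomial.C (A 2) * X ^ 2 with ha
  set b : F[X] := Polynomial.C (B 0) + Polynomial.C (B 1) * X + Polynomial.C (B 2) * X ^ 2 +
    Polynomial.C (B 3) * X ^ 3 with hb
  set c : F[X] := Polynomial.C (C 0) + Polynomial.C (C 1) * X + Polynomial.C (C 2) * X ^ 2 +
    Polynomial.C (C 3) * X ^ 3 + Polynomial.C (C 4) * X ^ 4 with hc
  have e := fun i => congrFun h i
  have e6 : A 2 * C 4 = B 3 ^ 2 := by
    have := e 6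
    simp [descentDefect] at this
    linear_combination this
  have hac : a * c = b ^ 2 := by
    have e0 := congrArg Polynomial.C (e 0)
    have e1 := congrArg Polynomial.C (e 1)
    have e2 := congrArg Polynomial.C (e 2)
    have e3 := congrArg Polynomial.C (e 3)
    have e4 := congrArg Polynomial.C (e 4)
    have e5 := congrArg Polynomial.C (e 5)
    have e6 := congrArg Polynomial.C (e 6)
    simp [descentDefect, -map_eq_zero, -Polynomial.C_eq_zero] at e0 e1 e2 e3 e4 e5 e6
    have two : Polynomial.C (2 : F) = 2 := rfl
    simp only [two] at e0 e1 e2 e3 e4 e5 e6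
    rw [ha, hb, hc]
    linear_combination e0 + X * e1 + X ^ 2 * e2 + X ^ 3 * e3 + X ^ 4 * e4 + X ^ 5 * e5 + X ^ 6 * e6
  have haτ : aeval τ a = 0 := by
    simp only [quadForm] at hAτ
    simp [ha]
    linear_combination hAτ
  have hcτ : aeval τ c = 0 := by
    simp only [quarForm] at hCτ
    simp [hc]
    linear_combination hCτ
  have hprime := minpoly.prime hτ
  have hμ1 := minpoly.natDegree_pos hτ
  obtain ⟨ν, hν⟩ := minpoly.dvd F τ haτ
  obtain ⟨c', hc'⟩ := minpoly.dvd F τ hcτ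
  have hbτ : minpoly F τ ∣ b := hprime.dvd_of_dvd_pow (n := 2) (by
    rw [← hac]; exact (minpoly.dvd F τ haτ).mul_right _)
  obtain ⟨b', hb'⟩ := hbτ
  have hνc : ν * c' = b' ^ 2 := by
    have : minpoly F τ ^ 2 * (ν * c') = minpoly F τ ^ 2 * b' ^ 2 := by
      rw [← mul_pow, ← hb', ← hac, hν, hc']; ring
    exact mul_left_cancel₀ (pow_ne_zero 2 hprime.ne_zero) this
  have ha0 : a ≠ 0 := by
    intro h0
    apply hA
    have c0 := congrArg (fun p => coeff p 0) h0
    have c1 := congrArg (fun p => coeff p 1) h0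
    have c2 := congrArg (fun p => coeff p 2) h0
    simp [ha, coeff_X, coeff_C] at c0 c1 c2
    ext i
    fin_cases i <;> assumption
  have hadeg : a.natDegree ≤ 2 := by rw [ha]; compute_degree
  have hν0 : ν ≠ 0 := by rintro rfl; simp [hν] at ha0
  have hνdeg : ν.natDegree ≤ 1 := by
    have := natDegree_mul hprime.ne_zero hν0
    rw [← hν] at this
    omega
  have hνsq : Squarefree ν := by
    rcases Nat.le_one_iff_eq_zero_or_eq_one.1 hνdeg with h0 | h1
    · rw [natDegree_eq_zero] at h0
      obtain ⟨x, rfl⟩ := h0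
      exact (isUnit_C.2 (isUnit_iff_ne_zero.2 (by rintro rfl; simp at hν0))).squarefree
    · exact (irreducible_of_degree_eq_one ((degree_eq_iff_natDegree_eq hν0).2 h1)).squarefree
  have hνb : ν ∣ b' := (hνsq.dvd_pow_iff_dvd
    two_ne_zero).1 (hνc ▸ dvd_mul_right _ _)
  obtain ⟨q, hq⟩ : a ∣ b := by rw [hν, hb']; exact mul_dvd_mul_left _ hνb
  have hqdeg : q.natDegree ≤ 1 := by
    by_cases hq0 : q = 0
    · simp [hq0]
    have hmul := natDegree_mul ha0 hq0
    rw [← hq] at hmul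
    by_cases h2 : A 2 = 0
    · have hB3 : B 3 = 0 := by rw [h2, zero_mul] at e6; exact pow_eq_zero_iff two_ne_zero |>.1 e6.symm
      have hbdeg : b.natDegree ≤ 2 := by rw [hb, hB3]; simp; compute_degree
      have : 1 ≤ a.natDegree := by
        have := natDegree_mul hprime.ne_zero hν0
        rw [← hν] at this
        omega
      omega
    · have hbdeg : b.natDegree ≤ 3 := by rw [hb]; compute_degree
      have : 2 ≤ a.natDegree := le_natDegree_of_ne_zero (by simpa [ha, coeff_X, coeff_C] using h2)
      omega
  refine ⟨![q.coeff 0, q.coeff 1], ?_⟩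
  rw [eq_X_add_C_of_natDegree_le_one hqdeg] at hq
  have hexp : b = Polynomial.C (A 0 * q.coeff 0) +
      Polynomial.C (A 0 * q.coeff 1 + A 1 * q.coeff 0) * X +
      Polynomial.C (A 1 * q.coeff 1 + A 2 * q.coeff 0) * X ^ 2 +
      Polynomial.C (A 2 * q.coeff 1) * X ^ 3 := by
    rw [hq, ha]
    simp only [map_add, map_mul]
    ring
  rw [hb] at hexp
  have c0 := congrArg (fun p => coeff p 0) hexp
  have c1 := congrArg (fun p => coeff p 1) hexp
  have c2 := congrArg (fun p => coeff p 2) hexp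
  have c3 := congrArg (fun p => coeff p 3) hexp
  simp [coeff_X, coeff_C, -map_add, -map_mul] at c0 c1 c2 c3
  exact ⟨c0, c1, c2, c3⟩

theorem quar_eq_zero_of_mul_eq_zero {F : Type*} [CommRing F] [IsDomain F] {A : Fin 3 → F} {C : Fin 5 → F}
    {μ : F} (hA : A ≠ 0) (h : descentDefect 1 μ 0 A C 0 = 0) : C = 0 := by
  have e := fun i => congrFun h i
  have e0 := e 0
  have e1 := e 1
  have e2 := e 2
  have e3 := e 3
  have e4 := e 4
  have e5 := e 5
  have e6 := e 6
  simp [descentDefect, -mul_eq_zero] at e0 e1 e2 e3 e4 e5 e6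
  suffices C 0 = 0 ∧ C 1 = 0 ∧ C 2 = 0 ∧ C 3 = 0 ∧ C 4 = 0 by
    obtain ⟨h0, h1, h2, h3, h4⟩ := this
    ext i
    fin_cases i <;> assumption
  by_cases h2 : A 2 = 0
  · by_cases h1 : A 1 = 0
    · have h0 : A 0 ≠ 0 := by
        intro h0
        apply hA
        ext i
        fin_cases i <;> assumption
      simp_all
    · simp_all
  · simp_all

theorem zmod_form_ne_zero {A : Fin 3 → ℤ} (hA : IsPrimitiveForm A) {p : ℕ} (hp : p.Prime) :
    (fun i => (A i : ZMod p)) ≠ 0 := by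
  intro h
  have := hA p fun i => (ZMod.intCast_zmod_eq_zero_iff_dvd _ p).1 (congrFun h i)
  exact hp.one_lt.ne' (by simpa [Int.isUnit_iff_natAbs_eq] using this)

theorem exists_quar_eq_mul_of_dvd {A : Fin 3 → ℤ} (hA : IsPrimitiveForm A) {p : ℕ} (hp : p.Prime)
    {C : Fin 5 → ℤ} (h : ∀ i, (p : ℤ) ∣ descentDefect 1 0 0 A C 0 i) :
    ∃ C' : Fin 5 → ℤ, ∀ i, C i = p * C' i := by
  have := Fact.mk hp
  have hz : (fun i => (C i : ZMod p)) = 0 := by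
    refine quar_eq_zero_of_mul_eq_zero (μ := 0) (zmod_form_ne_zero hA hp) ?_
    ext i
    have h2 := map_descentDefect (Int.castRingHom (ZMod p)) 1 0 0 A C 0 i
    have h1 := (ZMod.intCast_zmod_eq_zero_iff_dvd _ p).2 (h i)
    simp only [Int.coe_castRingHom, h1, Int.cast_zero, Int.cast_one, Pi.zero_apply] at h2
    exact h2.symm
  choose C' hC' using fun i => (ZMod.intCast_zmod_eq_zero_iff_dvd _ p).1 (congrFun hz i)
  exact ⟨C', hC'⟩

/-- Division of the descent parameter by a prime `p` modulo which `A` divides `B`. -/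
theorem exists_descent_of_prime_dvd {m : ℤ} {A : Fin 3 → ℤ} (hA : IsPrimitiveForm A) {p : ℕ}
    (hp : p.Prime) {B B' : Fin 4 → ℤ} {C : Fin 5 → ℤ} {k : ℤ} {l : Fin 2 → ℤ}
    (hD : descentDefect 1 m (p * k) A C B = 0) (h0 : B 0 = A 0 * l 0 + p * B' 0)
    (h1 : B 1 = A 0 * l 1 + A 1 * l 0 + p * B' 1) (h2 : B 2 = A 1 * l 1 + A 2 * l 0 + p * B' 2)
    (h3 : B 3 = A 2 * l 1 + p * B' 3) :
    ∃ C' : Fin 5 → ℤ, descentDefect 1 m k A C' B' = 0 := by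
  set C₁ : Fin 5 → ℤ := ![
    C 0 - A 0 * l 0 ^ 2 - 2 * p * (l 0 * B' 0) + p * k * l 0,
    C 1 - (A 1 * l 0 ^ 2 + 2 * A 0 * l 0 * l 1) - 2 * p * (l 0 * B' 1 + l 1 * B' 0) +
      p * k * (2 * l 0 + l 1),
    C 2 - (A 0 * l 1 ^ 2 + 2 * A 1 * l 0 * l 1 + A 2 * l 0 ^ 2) -
      2 * p * (l 0 * B' 2 + l 1 * B' 1) + p * k * (2 * l 1 - l 0),
    C 3 - (A 1 * l 1 ^ 2 + 2 * A 2 * l 0 * l 1) - 2 * p * (l 0 * B' 3 + l 1 * B' 2) -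
      p * k * (l 0 + l 1),
    C 4 - A 2 * l 1 ^ 2 - 2 * p * (l 1 * B' 3) - p * k * l 1] with hC₁
  have hp0 : (p : ℤ) ≠ 0 := by exact_mod_cast hp.ne_zero
  have heval : ∀ x z, quadForm A x z * quarForm C₁ x z = p ^ 2 * (cubForm B' x z ^ 2 +
      k * (hForm x z * cubForm B' x z) - m * k ^ 2 * bForm x z ^ 2) := by
    intro x z
    have e := eval_of_descentDefect_eq_zero hD x z
    have hB : cubForm B x z = quadForm A x z * linForm l x z + p * cubForm B' x z := by
      simp only [cubForm, quadForm, linForm, h0, h1, h2, h3]; ring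
    have hC : quarForm C₁ x z = quarForm C x z - quadForm A x z * linForm l x z ^ 2 -
        2 * p * (linForm l x z * cubForm B' x z) - p * k * (hForm x z * linForm l x z) := by
      simp only [hC₁, quarForm, quadForm, linForm, cubForm, hForm, Matrix.cons_val]; ring
    rw [hB] at e
    rw [hC]
    linear_combination e
  have hdvd : ∀ i, (p : ℤ) ^ 2 ∣ descentDefect 1 0 0 A C₁ 0 i := by
    intro i
    have hz := sextic_coeff_eq_zero
      (e₀ := descentDefect 1 0 0 A C₁ 0 0 + p ^ 2 * descentDefect 1 m k 0 0 B' 0)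
      (e₁ := descentDefect 1 0 0 A C₁ 0 1 + p ^ 2 * descentDefect 1 m k 0 0 B' 1)
      (e₂ := descentDefect 1 0 0 A C₁ 0 2 + p ^ 2 * descentDefect 1 m k 0 0 B' 2)
      (e₃ := descentDefect 1 0 0 A C₁ 0 3 + p ^ 2 * descentDefect 1 m k 0 0 B' 3)
      (e₄ := descentDefect 1 0 0 A C₁ 0 4 + p ^ 2 * descentDefect 1 m k 0 0 B' 4)
      (e₅ := descentDefect 1 0 0 A C₁ 0 5 + p ^ 2 * descentDefect 1 m k 0 0 B' 5)
      (e₆ := descentDefect 1 0 0 A C₁ 0 6 + p ^ 2 * descentDefect 1 m k 0 0 B' 6) (by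
        intro x
        have := heval x 1
        simp only [quadForm, quarForm, cubForm, hForm, bForm] at this
        simp [descentDefect]
        linear_combination this)
    obtain ⟨z0, z1, z2, z3, z4, z5, z6⟩ := hz
    fin_cases i
    · exact ⟨_, (eq_neg_of_add_eq_zero_left z0).trans (mul_neg _ _).symm⟩
    · exact ⟨_, (eq_neg_of_add_eq_zero_left z1).trans (mul_neg _ _).symm⟩
    · exact ⟨_, (eq_neg_of_add_eq_zero_left z2).trans (mul_neg _ _).symm⟩
    · exact ⟨_, (eq_neg_of_add_eq_zero_left z3).trans (mul_neg _ _).symm⟩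
    · exact ⟨_, (eq_neg_of_add_eq_zero_left z4).trans (mul_neg _ _).symm⟩
    · exact ⟨_, (eq_neg_of_add_eq_zero_left z5).trans (mul_neg _ _).symm⟩
    · exact ⟨_, (eq_neg_of_add_eq_zero_left z6).trans (mul_neg _ _).symm⟩
  obtain ⟨C₂, hC₂⟩ := exists_quar_eq_mul_of_dvd hA hp fun i => (Dvd.intro_left _ (pow_two _).symm
    : (p : ℤ) ∣ p ^ 2).trans (hdvd i)
  obtain ⟨C₃, hC₃⟩ := exists_quar_eq_mul_of_dvd hA hp (C := C₂) fun i => by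
    have : descentDefect 1 0 0 A C₁ 0 i = p * descentDefect 1 0 0 A C₂ 0 i := by
      fin_cases i <;> simp [descentDefect, hC₂] <;> ring
    have h := hdvd i
    rw [this, pow_two] at h
    exact Int.dvd_of_mul_dvd_mul_left hp0 h
  refine ⟨C₃, descentDefect_eq_zero fun x z => ?_⟩
  have h := heval x z
  have hq : quarForm C₁ x z = p ^ 2 * quarForm C₃ x z := by
    simp only [quarForm, hC₂, hC₃]; ring
  rw [hq] at h
  exact mul_left_cancel₀ (pow_ne_zero 2 hp0) (by linear_combination h)

/-- A primitive descent form has a descent whose parameter is coprime to the residue characteristic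
at every common root of `A` and `C`. -/
theorem IsDescentForm.exists_reduced {m : ℤ} {A : Fin 3 → ℤ} (h : IsDescentForm m A)
    (hA : IsPrimitiveForm A) :
    ∃ (B : Fin 4 → ℤ) (C : Fin 5 → ℤ) (k : ℤ), Odd k ∧ descentDefect 1 m k A C B = 0 ∧
      ∀ (E : Type*) [Field E] [Finite E] (τ : E), quadForm (fun i => (A i : E)) τ 1 = 0 →
        quarForm (fun i => (C i : E)) τ 1 = 0 → (k : E) ≠ 0 := by
  obtain ⟨B, C, k, hk, hD⟩ := h
  induction hn : k.natAbs using Nat.strong_induction_on generalizing B C k with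
  | _ n ih =>
    by_cases hgood : ∀ (E : Type _) [Field E] [Finite E] (τ : E),
        quadForm (fun i => (A i : E)) τ 1 = 0 →
          quarForm (fun i => (C i : E)) τ 1 = 0 → (k : E) ≠ 0
    · exact ⟨B, C, k, hk, hD, hgood⟩
    push Not at hgood
    obtain ⟨E, _, _, τ, hAτ, hCτ, hkE⟩ := hgood
    obtain ⟨p, hpE⟩ := CharP.exists E
    have hp : p.Prime := by
      rcases CharP.char_is_prime_or_zero E p with h | h
      · exact h
      · subst h
        have := CharP.charP_to_charZero E
        exact absurd (Finite.of_injective (Nat.cast : ℕ → E) Nat.cast_injective)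
          (not_finite_iff_infinite.2 inferInstance)
    have := Fact.mk hp
    obtain ⟨k', rfl⟩ := (CharP.intCast_eq_zero_iff E p k).1 hkE
    let _ : Algebra (ZMod p) E := ZMod.algebra E p
    have hmap : ∀ a : ℤ, algebraMap (ZMod p) E (a : ZMod p) = a := fun a => map_intCast _ a
    obtain ⟨l, g0, g1, g2, g3⟩ := exists_linForm_of_common_root (E := E) (μ := (m : ZMod p))
      (A := fun i => (A i : ZMod p)) (B := fun i => (B i : ZMod p)) (C := fun i => (C i : ZMod p))
      (zmod_form_ne_zero hA hp) (by
        ext i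
        have := map_descentDefect (Int.castRingHom (ZMod p)) 1 m (p * k') A C B i
        simp [hD] at this
        exact this.symm) (Algebra.IsIntegral.isIntegral τ) (by simpa [hmap] using hAτ)
      (by simpa [hmap] using hCτ)
    obtain ⟨l₀, hl₀⟩ := ZMod.intCast_surjective (l 0)
    obtain ⟨l₁, hl₁⟩ := ZMod.intCast_surjective (l 1)
    have lift : ∀ a b : ℤ, (a : ZMod p) = b → ∃ c, a = b + p * c := fun a b hab => by
      obtain ⟨c, hc⟩ := (ZMod.intCast_eq_intCast_iff_dvd_sub b a p).1 hab.symm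
      exact ⟨c, by linear_combination hc⟩
    obtain ⟨b₀, hb₀⟩ := lift (B 0) (A 0 * l₀) (by push_cast; rw [hl₀]; exact g0)
    obtain ⟨b₁, hb₁⟩ := lift (B 1) (A 0 * l₁ + A 1 * l₀) (by push_cast; simp only [hl₀, hl₁]; exact g1)
    obtain ⟨b₂, hb₂⟩ := lift (B 2) (A 1 * l₁ + A 2 * l₀) (by push_cast; simp only [hl₀, hl₁]; exact g2)
    obtain ⟨b₃, hb₃⟩ := lift (B 3) (A 2 * l₁) (by push_cast; rw [hl₁]; exact g3)
    obtain ⟨C', hC'⟩ := exists_descent_of_prime_dvd hA hp (l := ![l₀, l₁]) (B' := ![b₀, b₁, b₂, b₃])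
      hD hb₀ hb₁ hb₂ hb₃
    have hk' : Odd k' := (Int.odd_mul.1 hk).2
    refine ih k'.natAbs ?_ _ C' k' hk' hC' rfl
    rw [← hn, Int.natAbs_mul, Int.natAbs_natCast]
    have : 0 < k'.natAbs := Int.natAbs_pos.2 (by rintro rfl; simp at hk')
    have := hp.two_le
    nlinarith

section

open NumberField

/-- In a principal ideal domain, if all common prime factors of `a` and `c` are associated to `ρ`
and `a * c` is a square, then `a` is a square up to a unit and a power of `ρ`. -/
theorem exists_eq_unit_mul_pow_mul_sq {R : Type*} [CommRing R] [IsDomain R] [IsPrincipalIdealRing R]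
    {a c γ ρ : R} (hρ : Prime ρ) (h : a * c = γ ^ 2) (hγ : γ ≠ 0)
    (hcommon : ∀ q, Prime q → q ∣ a → q ∣ c → ρ ∣ q) :
    ∃ (u : Rˣ) (e : ℕ) (β : R), a = u * ρ ^ e * β ^ 2 := by
  have hac : a * c ≠ 0 := by rw [h]; exact pow_ne_zero 2 hγ
  obtain ⟨i, a', ha', rfl⟩ := WfDvdMonoid.max_power_factor (left_ne_zero_of_mul hac) hρ.irreducible
  obtain ⟨j, c', hc', rfl⟩ := WfDvdMonoid.max_power_factor (right_ne_zero_of_mul hac) hρ.irreducible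
  obtain ⟨n, γ', hγ', rfl⟩ := WfDvdMonoid.max_power_factor hγ hρ.irreducible
  have h' : ρ ^ (i + j) * (a' * c') = ρ ^ (2 * n) * γ' ^ 2 := by
    rw [pow_add, pow_mul', ← mul_pow, ← h]; ring
  have hij : i + j = 2 * n := by
    have e1 : emultiplicity ρ (ρ ^ (i + j) * (a' * c')) = (i + j : ℕ) := by
      rw [emultiplicity_mul hρ, emultiplicity_pow_self_of_prime hρ,
        emultiplicity_eq_zero.2 (hρ.not_dvd_mul ha' hc'), add_zero]
    have e2 : emultiplicity ρ (ρ ^ (2 * n) * γ' ^ 2) = (2 * n : ℕ) := by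
      rw [emultiplicity_mul hρ, emultiplicity_pow_self_of_prime hρ,
        emultiplicity_eq_zero.2 fun hd => hγ' (hρ.dvd_of_dvd_pow hd), add_zero]
    rw [h', e2] at e1
    exact_mod_cast e1.symm
  rw [hij] at h'
  have hsq := mul_left_cancel₀ (pow_ne_zero _ hρ.ne_zero) h'
  have hcop : IsCoprime a' c' := by
    refine isCoprime_of_prime_dvd (fun h0 => ha' (h0.1 ▸ dvd_zero _)) fun q hq hqa hqc => ?_
    exact ha' ((hcommon q hq (hqa.mul_left _) (hqc.mul_left _)).trans hqa)
  obtain ⟨β, u, hu⟩ := exists_associated_pow_of_mul_eq_pow' hcop hsq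
  exact ⟨u, i, β, by rw [← hu]; ring⟩

theorem even_of_mul_pow_eq_sq {k N Z n : ℤ} {q e : ℕ} (hq : q.Prime) (hk : k ≠ 0) (hn : n ≠ 0)
    (h : k ^ 4 * N = Z ^ 2) (hN : N.natAbs = q ^ e * n.natAbs ^ 2) : Even e := by
  have h1 := congrArg Int.natAbs h
  rw [Int.natAbs_mul, Int.natAbs_pow, Int.natAbs_pow, hN] at h1
  have h2 := congrArg (fun x => x.factorization q) h1
  have hk' : k.natAbs ≠ 0 := Int.natAbs_ne_zero.2 hk
  have hn' : n.natAbs ≠ 0 := Int.natAbs_ne_zero.2 hn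
  rw [Nat.factorization_mul (pow_ne_zero _ hk')
    (mul_ne_zero (pow_ne_zero _ hq.ne_zero) (pow_ne_zero _ hn')),
    Nat.factorization_mul (pow_ne_zero _ hq.ne_zero) (pow_ne_zero _ hn')] at h2
  simp [Nat.factorization_pow, hq.factorization_self] at h2
  exact ⟨Z.natAbs.factorization q - 2 * k.natAbs.factorization q - n.natAbs.factorization q,
    by omega⟩

theorem exists_quadForm_factors (A : Fin 3 → ℂ) : ∃ p₁ q₁ p₂ q₂ : ℂ, A 0 = q₁ * q₂ ∧
    A 1 = p₁ * q₂ + p₂ * q₁ ∧ A 2 = p₁ * p₂ := by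
  by_cases h : A 2 = 0
  · exact ⟨A 1, A 0, 0, 1, by simp, by simp, by simp [h]⟩
  obtain ⟨d, hd⟩ := IsAlgClosed.exists_pow_nat_eq (A 1 ^ 2 - 4 * A 0 * A 2) (n := 2) (by norm_num)
  refine ⟨A 2, (A 1 + d) / 2, 1, (A 1 - d) / (2 * A 2), ?_, ?_, by ring⟩
  · field_simp
    linear_combination hd
  · field_simp
    ring

/-- The norm of `A(θ)` is a square up to fourth powers when `A` carries a descent. -/
theorem exists_norm_mul_pow_eq_sq {L : Type*} [Field L] [NumberField L] {m : ℤ} {θ : 𝓞 L}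
    (hprod : ∀ p q : ℂ, ∏ σ : L →ₐ[ℚ] ℂ, (p * σ θ + q) = sexticForm (m : ℂ) (-q) p)
    {A : Fin 3 → ℤ} {B : Fin 4 → ℤ} {C : Fin 5 → ℤ} {k : ℤ}
    (hD : descentDefect 1 m k A C B = 0) :
    ∃ Z : ℤ, k ^ 4 * Algebra.norm ℤ (quadForm (fun i => (A i : 𝓞 L)) θ 1) = Z ^ 2 := by
  obtain ⟨p₁, q₁, p₂, q₂, h0, h1, h2⟩ := exists_quadForm_factors fun i => (A i : ℂ)
  have hd : descentDefect (1 : ℂ) m k (fun i => (A i : ℂ)) (fun i => (C i : ℂ))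
      (fun i => (B i : ℂ)) = 0 := by
    ext i
    have := map_descentDefect (Int.castRingHom ℂ) 1 m k A C B i
    simpa [hD] using this.symm
  have hsq : ∀ x z : ℂ, quadForm (fun i => (A i : ℂ)) x z = 0 → k ^ 2 * sexticForm (m : ℂ) x z =
      (2 * cubForm (fun i => (B i : ℂ)) x z + k * hForm x z) ^ 2 := by
    intro x z h
    have e := eval_of_descentDefect_eq_zero hd x z
    rw [h] at e
    simp only [sexticForm]
    linear_combination 4 * e
  have e1 := hsq (-q₁) p₁ (by simp only [quadForm, h0, h1, h2]; ring)
  have e2 := hsq (-q₂) p₂ (by simp only [quadForm, h0, h1, h2]; ring)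
  let G : Fin 4 → ℤ := ![2 * B 0 - k, 2 * B 1 - 2 * k, 2 * B 2 + k, 2 * B 3 + k]
  refine ⟨G 0 ^ 2 * A 2 ^ 3 - G 0 * G 1 * A 2 ^ 2 * A 1 +
    G 0 * G 2 * A 2 * (A 1 ^ 2 - 2 * A 0 * A 2) - G 0 * G 3 * (A 1 ^ 3 - 3 * A 0 * A 1 * A 2) +
    G 1 ^ 2 * A 0 * A 2 ^ 2 - G 1 * G 2 * A 0 * A 1 * A 2 +
    G 1 * G 3 * A 0 * (A 1 ^ 2 - 2 * A 0 * A 2) + G 2 ^ 2 * A 0 ^ 2 * A 2 -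
    G 2 * G 3 * A 0 ^ 2 * A 1 + G 3 ^ 2 * A 0 ^ 3, ?_⟩
  have hnorm : ((Algebra.norm ℤ (quadForm (fun i => (A i : 𝓞 L)) θ 1) : ℤ) : ℂ) =
      sexticForm (m : ℂ) (-q₁) p₁ * sexticForm (m : ℂ) (-q₂) p₂ := by
    rw [← hprod, ← hprod, ← Finset.prod_mul_distrib]
    have := Algebra.norm_eq_prod_embeddings ℚ ℂ
      ((quadForm (fun i => (A i : 𝓞 L)) θ 1 : 𝓞 L) : L)
    rw [← Algebra.coe_norm_int] at this
    simp only [eq_ratCast, Rat.cast_intCast] at this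
    rw [this]
    refine Finset.prod_congr rfl fun σ _ => ?_
    simp [quadForm]
    linear_combination h0 + σ θ * h1 + σ θ ^ 2 * h2
  apply Int.cast_injective (α := ℂ)
  push_cast
  rw [hnorm]
  calc (k : ℂ) ^ 4 * (sexticForm (m : ℂ) (-q₁) p₁ * sexticForm (m : ℂ) (-q₂) p₂) =
      (k ^ 2 * sexticForm (m : ℂ) (-q₁) p₁) * (k ^ 2 * sexticForm (m : ℂ) (-q₂) p₂) := by ring
    _ = _ := by
      rw [e1, e2, ← mul_pow]
      simp only [G, Matrix.cons_val]
      push_cast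
      congr 1
      rw [h0, h1, h2]
      simp only [cubForm, hForm]
      ring

end

section

open NumberField

theorem intCast_eq_zero_or_one_of_two_eq_zero {S : Type*} [CommRing S] (h2 : (2 : S) = 0) (n : ℤ) :
    Even n ∧ (n : S) = 0 ∨ Odd n ∧ (n : S) = 1 := by
  rcases Int.even_or_odd n with h | h
  · obtain ⟨k, rfl⟩ := h
    exact Or.inl ⟨⟨k, rfl⟩, by push_cast; linear_combination (k : S) * h2⟩
  · obtain ⟨k, rfl⟩ := h
    exact Or.inr ⟨⟨k, rfl⟩, by push_cast; linear_combination (k : S) * h2⟩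

/-- Nonzero elements of `𝔽₂[t] / (t³ + t² + 1)` are seventh roots of unity. -/
theorem quadForm_pow_seven_eq_one {S : Type*} [CommRing S] (h2 : (2 : S) = 0) {t : S}
    (ht : t ^ 3 + t ^ 2 + 1 = 0) {a : Fin 3 → ℤ} (ha : ∃ i, Odd (a i)) :
    quadForm (fun i => (a i : S)) t 1 ^ 7 = 1 := by
  have h3 : t ^ 3 = 1 + t ^ 2 := by linear_combination ht - (1 + t ^ 2) * h2
  have h7 : t ^ 7 = 1 := by
    linear_combination (t ^ 4 + t ^ 3 + t ^ 2 + 1) * h3 + (t ^ 4 + t ^ 2) * h2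
  have hseven : ∀ (j : ℕ) {x : S}, x = t ^ j → x ^ 7 = 1 := fun j x hx => by
    rw [hx, ← pow_mul, mul_comm, pow_mul, h7, one_pow]
  have h4 : t ^ 4 = 1 + t + t ^ 2 := by linear_combination (t + 1) * h3
  have h5 : t ^ 5 = 1 + t := by linear_combination t * h4 + h3 + t ^ 2 * h2
  have h6 : t ^ 6 = t + t ^ 2 := by linear_combination t * h5
  simp only [quadForm, Fin.exists_fin_succ, Fin.isValue, Fin.succ_zero_eq_one,
    Fin.succ_one_eq_two, IsEmpty.exists_iff, or_false] at ha ⊢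
  rcases intCast_eq_zero_or_one_of_two_eq_zero h2 (a 0) with ⟨e0, h0⟩ | ⟨e0, h0⟩ <;>
  rcases intCast_eq_zero_or_one_of_two_eq_zero h2 (a 1) with ⟨e1, h1⟩ | ⟨e1, h1⟩ <;>
  rcases intCast_eq_zero_or_one_of_two_eq_zero h2 (a 2) with ⟨e2, h2'⟩ | ⟨e2, h2'⟩ <;>
  rw [h0, h1, h2']
  · simp [← Int.not_even_iff_odd, e0, e1, e2] at ha
  · exact hseven 2 (by ring)
  · exact hseven 1 (by ring)
  · exact hseven 6 (by rw [h6]; ring)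
  · ring
  · exact hseven 3 (by rw [h3]; ring)
  · exact hseven 5 (by rw [h5]; ring)
  · exact hseven 4 (by rw [h4]; ring)

theorem pow_seven_eq_one_of_card_le {S : Type*} [CommRing S] [Finite S] [Nontrivial S]
    (hS : Nat.card S ≤ 8) (h2 : (2 : S) = 0) {t : S} (ht : t ^ 3 + t ^ 2 + 1 = 0) {x : S}
    (hx : x ≠ 0) : x ^ 7 = 1 := by
  have := Fintype.ofFinite S
  let f : (Fin 3 → Fin 2) → S := fun a => quadForm (fun i => (((a i : ℕ) : ℤ) : S)) t 1
  have hf : Function.Injective f := by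
    intro a b hab
    by_contra hne
    have hodd : ∃ i, Odd (((a i : ℕ) : ℤ) - ((b i : ℕ) : ℤ)) := by
      obtain ⟨i, hi⟩ := Function.ne_iff.1 hne
      refine ⟨i, ?_⟩
      generalize a i = p at hi
      generalize b i = q at hi
      revert p q
      decide
    have h7 := quadForm_pow_seven_eq_one h2 ht hodd
    have h0 : quadForm (fun i => ((((a i : ℕ) : ℤ) - ((b i : ℕ) : ℤ) : ℤ) : S)) t 1 = 0 := by
      simp only [f, quadForm] at hab ⊢
      push_cast at hab ⊢
      linear_combination hab
    rw [h0] at h7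
    simp at h7
  have hbij : Function.Bijective f := by
    refine (Fintype.bijective_iff_injective_and_card f).2 ⟨hf, ?_⟩
    refine le_antisymm (Fintype.card_le_of_injective f hf) ?_
    rw [← Nat.card_eq_fintype_card]
    simpa using hS
  obtain ⟨a, rfl⟩ := hbij.2 x
  refine quadForm_pow_seven_eq_one h2 ht ?_
  by_contra! hno
  apply hx
  simp only [f, quadForm]
  have hz : ∀ i, a i = 0 := by
    intro i
    have := hno i
    generalize a i = p at this
    revert p
    decide
  simp [hz]

/-- The reduction data at the prime above `2`. -/
structure IsTwoUniformizer {R : Type*} [CommRing R] (ε η : R) : Prop where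
  dvd_two : ε ∣ 2
  two_dvd_sq : 2 ∣ ε ^ 2
  dvd_cubic : ε ∣ η ^ 3 + η ^ 2 + 1
  not_isUnit : ¬IsUnit ε

section TwoAdic

variable {R : Type*} [CommRing R] {ε η : R}

theorem IsTwoUniformizer.two_dvd_pow (h : IsTwoUniformizer ε η) {β : R} (hβ : ε ∣ β ^ 7 - 1) :
    2 ∣ β ^ 14 - 1 := by
  obtain ⟨x, hx⟩ := hβ
  obtain ⟨y, hy⟩ := h.two_dvd_sq
  exact ⟨ε * x + y * x ^ 2, by linear_combination (β ^ 7 + 1 + ε * x) * hx + x ^ 2 * hy⟩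

theorem IsTwoUniformizer.not_dvd (h : IsTwoUniformizer ε η) {a : R} {n : ℕ} (hn : n ≠ 0)
    (ha : ε ∣ a ^ n - 1) : ¬ε ∣ a := by
  intro hd
  exact h.not_isUnit (isUnit_of_dvd_one ((dvd_sub_right (hd.pow hn)).1 ha))

theorem IsTwoUniformizer.dvd_quadForm (h : IsTwoUniformizer ε η) {A : Fin 3 → ℤ}
    (hA : ∃ i, Odd (A i)) : 2 ∣ quadForm (fun i => (A i : R)) (η ^ 2) 1 ^ 7 - 1 := by
  have hmk : ε ∣ quadForm (fun i => (A i : R)) η 1 ^ 7 - 1 := by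
    let π := Ideal.Quotient.mk (Ideal.span {ε})
    have hπ : ∀ x, π x = 0 ↔ ε ∣ x := fun x => by
      rw [Ideal.Quotient.eq_zero_iff_mem, Ideal.mem_span_singleton]
    have := quadForm_pow_seven_eq_one (S := R ⧸ Ideal.span {ε}) (t := π η)
      (by rw [← map_ofNat π 2]; exact (hπ 2).2 h.dvd_two)
      (by have := (hπ _).2 h.dvd_cubic; simpa using this) hA
    rw [← hπ, map_sub, map_pow, map_one, sub_eq_zero, ← this]
    simp [quadForm]
  have h14 := h.two_dvd_pow hmk
  have hsq : (2 : R) ∣ quadForm (fun i => (A i : R)) (η ^ 2) 1 -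
      quadForm (fun i => (A i : R)) η 1 ^ 2 := by
    have hpar : ∀ n : ℤ, (2 : R) ∣ (n : R) - (n : R) ^ 2 := fun n => by
      obtain ⟨k, hk⟩ := Int.even_mul_succ_self (n - 1)
      refine ⟨-(k : R), ?_⟩
      have : (((n - 1) * (n - 1 + 1) : ℤ) : R) = ((k + k : ℤ) : R) := congrArg _ hk
      push_cast at this
      linear_combination -this
    obtain ⟨x, hx⟩ := hpar (A 0)
    obtain ⟨y, hy⟩ := hpar (A 1)
    obtain ⟨z, hz⟩ := hpar (A 2)
    refine ⟨x + y * η ^ 2 + z * η ^ 4 - A 0 * A 1 * η - A 0 * A 2 * η ^ 2 - A 1 * A 2 * η ^ 3, ?_⟩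
    simp only [quadForm]
    linear_combination hx + η ^ 2 * hy + η ^ 4 * hz
  have := (hsq.trans (sub_dvd_pow_sub_pow _ _ 7)).add h14
  have e : ∀ p q : R, p ^ 7 - (q ^ 2) ^ 7 + (q ^ 14 - 1) = p ^ 7 - 1 := fun p q => by ring
  rwa [e] at this

end TwoAdic

theorem IsTwoUniformizer.dvd_or_two_dvd {L : Type*} [Field L] [NumberField L] {ε η : 𝓞 L}
    (h : IsTwoUniformizer ε η) (hN : (Algebra.norm ℤ ε).natAbs = 8) (β : 𝓞 L) :
    ε ∣ β ∨ 2 ∣ β ^ 14 - 1 := by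
  by_cases hd : ε ∣ β
  · exact Or.inl hd
  refine Or.inr (h.two_dvd_pow ?_)
  let π := Ideal.Quotient.mk (Ideal.span {ε})
  have hπ : ∀ x, π x = 0 ↔ ε ∣ x := fun x => by
    rw [Ideal.Quotient.eq_zero_iff_mem, Ideal.mem_span_singleton]
  have hcard : Nat.card (𝓞 L ⧸ Ideal.span {ε}) = 8 := by
    rw [← hN, ← Ideal.absNorm_span_singleton]; rfl
  have : Finite (𝓞 L ⧸ Ideal.span {ε}) := Nat.finite_of_card_ne_zero (by rw [hcard]; norm_num)
  have : Nontrivial (𝓞 L ⧸ Ideal.span {ε}) :=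
    Ideal.Quotient.nontrivial_iff.2 fun ht => h.not_isUnit (Ideal.span_singleton_eq_top.1 ht)
  have := pow_seven_eq_one_of_card_le (S := 𝓞 L ⧸ Ideal.span {ε}) hcard.le (t := π η)
    (by rw [← map_ofNat π 2]; exact (hπ 2).2 h.dvd_two)
    (by have := (hπ _).2 h.dvd_cubic; simpa using this) (x := π β) (mt (hπ β).1 hd)
  rw [← hπ, map_sub, map_pow, map_one, this, sub_self]

/-- A common zero of `A` and `C` is a zero of `γ`, hence ramified. -/
theorem dvd_of_descentDefect_eq_zero {R : Type*} [CommRing R] {m : ℤ} {θ s q : R}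
    (hs : s ^ 2 = -(m : R)) (hθ : hForm θ 1 = -2 * s * bForm θ 1)
    {A : Fin 3 → ℤ} {B : Fin 4 → ℤ} {C : Fin 5 → ℤ} {k : ℤ} (hD : descentDefect 1 m k A C B = 0)
    (ha : q ∣ quadForm (fun i => (A i : R)) θ 1) (hc : q ∣ quarForm (fun i => (C i : R)) θ 1)
    (hγ : q ∣ cubForm (fun i => (B i : R)) θ 1 - k * s * bForm θ 1) :
    q ∣ k ^ 2 * s * (θ ^ 2 + θ + 1) ^ 2 := by
  have hd : ∀ i, descentDefect (1 : R) m k (fun i => (A i : R)) (fun i => (C i : R))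
      (fun i => (B i : R)) i = 0 := fun i => by
    have := map_descentDefect (Int.castRingHom R) 1 m k A C B i
    simpa [hD] using this.symm
  have e1 := hd 1
  have e2 := hd 2
  have e3 := hd 3
  have e4 := hd 4
  have e5 := hd 5
  have e6 := hd 6
  simp only [descentDefect, Matrix.cons_val] at e1 e2 e3 e4 e5 e6
  have key : (k : R) ^ 2 * s * (θ ^ 2 + θ + 1) ^ 2 =
      quadForm (fun i => (A i : R)) θ 1 * (C 1 + 2 * C 2 * θ + 3 * C 3 * θ ^ 2 + 4 * C 4 * θ ^ 3) +
      quarForm (fun i => (C i : R)) θ 1 * (A 1 + 2 * A 2 * θ) -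
      (cubForm (fun i => (B i : R)) θ 1 - k * s * bForm θ 1) *
        (2 * (B 1 + 2 * B 2 * θ + 3 * B 3 * θ ^ 2) + k * (3 * θ ^ 2 + 2 * θ - 2)) := by
    simp only [quadForm, quarForm, cubForm, hForm, bForm] at hθ ⊢
    linear_combination -(e1 + 2 * θ * e2 + 3 * θ ^ 2 * e3 + 4 * θ ^ 3 * e4 + 5 * θ ^ 4 * e5 +
      6 * θ ^ 5 * e6) -
      (k * (B 1 + 2 * B 2 * θ + 3 * B 3 * θ ^ 2) + k ^ 2 * s * (2 * θ + 1)) * hθ +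
      2 * k ^ 2 * (θ ^ 2 + θ) * (2 * θ + 1) * hs
  rw [key]
  exact ((ha.mul_right _).add (hc.mul_right _)).sub (hγ.mul_right _)

/-- The arithmetic of a sextic field `L` on which the descent relies. -/
structure IsDescentField (L : Type*) [Field L] [NumberField L] (m : ℤ) (η s ε ρ : 𝓞 L) : Prop where
  pos : 0 < m
  finrank_eq : Module.finrank ℚ L = 6
  sq_eq : s ^ 2 = -(m : 𝓞 L)
  hForm_eq : hForm (η ^ 2) 1 = -2 * s * bForm (η ^ 2) 1
  relation : ∀ e : Fin 7 → ℚ, ∑ i, algebraMap ℚ L (e i) * ((η : L) ^ 2) ^ (i : ℕ) = 0 →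
    ∃ δ : ℚ, ∀ i, e i = δ * sexticCoeff (m : ℚ) i
  prod_embeddings : ∀ p q : ℂ, ∏ σ : L →ₐ[ℚ] ℂ, (p * σ ((η ^ 2 : 𝓞 L) : L) + q) =
    sexticForm (m : ℂ) (-q) p
  isPrincipalIdealRing : IsPrincipalIdealRing (𝓞 L)
  isTwoUniformizer : IsTwoUniformizer ε η
  norm_uniformizer : (Algebra.norm ℤ ε).natAbs = 8
  dvd_two : s ∣ 2
  norm_ramified : (Algebra.norm ℤ ρ).natAbs.Prime
  dvd_ramified : (η ^ 2) ^ 2 + η ^ 2 + 1 ∣ ρ ^ 2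
  unit_eq_sq : ∀ u : (𝓞 L)ˣ, (2 : 𝓞 L) ∣ (u : 𝓞 L) ^ 7 - 1 → ∃ v : (𝓞 L)ˣ, u = v ^ 2 ∨ u = -v ^ 2

theorem IsDescentField.cubForm_ne {L : Type*} [Field L] [NumberField L] {m : ℤ} {η s ε ρ : 𝓞 L}
    (h : IsDescentField L m η s ε ρ) (B : Fin 4 → ℤ) {k : ℤ} (hk : Odd k) :
    cubForm (fun i => (B i : 𝓞 L)) (η ^ 2) 1 - k * s * bForm (η ^ 2) 1 ≠ 0 := by
  intro h0
  have h1 := h.hForm_eq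
  have h2 : 2 * cubForm (fun i => (B i : 𝓞 L)) (η ^ 2) 1 + k * hForm (η ^ 2) 1 = 0 := by
    linear_combination 2 * h0 + k * h1
  have h3 := congrArg (algebraMap (𝓞 L) L) h2
  obtain ⟨δ, hδ⟩ := h.relation ![2 * B 0 - k, 2 * B 1 - 2 * k, 2 * B 2 + k, 2 * B 3 + k, 0, 0, 0] (by
    simp only [cubForm, hForm, map_add, map_mul, map_sub, map_pow, map_intCast, map_ofNat, map_one,
      map_zero] at h3
    simp [Fin.sum_univ_succ]
    linear_combination h3)
  have h6 : δ = 0 := by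
    have := hδ 6
    simpa [sexticCoeff, eq_comm] using this
  have h30 := hδ 3
  rw [h6, zero_mul] at h30
  simp only [Matrix.cons_val] at h30
  have : (2 * B 3 + k : ℤ) = 0 := by exact_mod_cast h30
  obtain ⟨j, rfl⟩ := hk
  omega

theorem IsDescentField.exists_quadForm_eq {L : Type*} [Field L] [NumberField L] {m : ℤ}
    {η s ε ρ : 𝓞 L} (h : IsDescentField L m η s ε ρ) {A : Fin 3 → ℤ} (hA : IsPrimitiveForm A)
    (hA' : IsDescentForm m A) : ∃ ξ : 𝓞 L, quadForm (fun i => (A i : 𝓞 L)) (η ^ 2) 1 = ξ ^ 2 ∨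
      quadForm (fun i => (A i : 𝓞 L)) (η ^ 2) 1 = -ξ ^ 2 := by
  have := h.isPrincipalIdealRing
  obtain ⟨B, C, k, hk, hD, hred⟩ := hA'.exists_reduced hA
  have hk0 : k ≠ 0 := by rintro rfl; simp at hk
  have hρ0 : ρ ≠ 0 := by
    rintro rfl
    have := h.norm_ramified
    simp [Nat.not_prime_zero] at this
  have hρ : Prime ρ := Ideal.prime_of_irreducible_absNorm_span hρ0
    (by rw [Ideal.absNorm_span_singleton]; exact h.norm_ramified)
  set a := quadForm (fun i => (A i : 𝓞 L)) (η ^ 2) 1 with ha_def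
  set c := quarForm (fun i => (C i : 𝓞 L)) (η ^ 2) 1 with hc_def
  set γ := cubForm (fun i => (B i : 𝓞 L)) (η ^ 2) 1 - k * s * bForm (η ^ 2) 1 with hγ_def
  have ha7 : 2 ∣ a ^ 7 - 1 := h.isTwoUniformizer.dvd_quadForm (IsPrimitiveForm.exists_odd hA)
  have hac : a * c = γ ^ 2 := by
    have hd : descentDefect (1 : 𝓞 L) m k (fun i => (A i : 𝓞 L)) (fun i => (C i : 𝓞 L))
        (fun i => (B i : 𝓞 L)) = 0 := by
      ext i
      have := map_descentDefect (Int.castRingHom (𝓞 L)) 1 m k A C B i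
      simp [hD] at this
      simp [← this]
    have e := eval_of_descentDefect_eq_zero hd (η ^ 2) 1
    rw [ha_def, hc_def, hγ_def]
    linear_combination e + k * cubForm (fun i => (B i : 𝓞 L)) (η ^ 2) 1 * h.hForm_eq -
      k ^ 2 * bForm (η ^ 2) 1 ^ 2 * h.sq_eq
  have hγ0 : γ ≠ 0 := h.cubForm_ne B hk
  have hcommon : ∀ q, Prime q → q ∣ a → q ∣ c → ρ ∣ q := by
    intro q hq hqa hqc
    have hqγ : q ∣ γ := hq.dvd_of_dvd_pow (hac ▸ hqa.mul_right c)
    have hqk : ¬q ∣ (k : 𝓞 L) := by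
      have hmax : (Ideal.span {q}).IsMaximal :=
        ((Ideal.span_singleton_prime hq.ne_zero).2 hq).isMaximal
          (by simpa using hq.ne_zero)
      let _ : Field (𝓞 L ⧸ Ideal.span {q}) := Ideal.Quotient.field _
      have : Finite (𝓞 L ⧸ Ideal.span {q}) :=
        Ideal.finiteQuotientOfFreeOfNeBot _ (by simpa using hq.ne_zero)
      let π := Ideal.Quotient.mk (Ideal.span {q})
      have hπ : ∀ x, π x = 0 ↔ q ∣ x := fun x => by
        rw [Ideal.Quotient.eq_zero_iff_mem, Ideal.mem_span_singleton]
      have := hred (𝓞 L ⧸ Ideal.span {q}) (π (η ^ 2))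
        (by rw [← (hπ a).2 hqa]; simp [ha_def, quadForm])
        (by rw [← (hπ c).2 hqc]; simp [hc_def, quarForm])
      rw [← hπ]
      simpa using this
    have hdvd := dvd_of_descentDefect_eq_zero h.sq_eq h.hForm_eq hD hqa hqc hqγ
    rcases hq.dvd_or_dvd hdvd with hd | hd
    · rcases hq.dvd_or_dvd hd with hd | hd
      · exact absurd (hq.dvd_of_dvd_pow hd) hqk
      · have h2 := (hd.trans h.dvd_two).trans ha7
        exact absurd (isUnit_of_dvd_one ((dvd_sub_right (hqa.pow (by norm_num))).1 h2)) hq.not_isUnit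
    · have := hq.dvd_of_dvd_pow ((hq.dvd_of_dvd_pow hd).trans h.dvd_ramified)
      exact ((hq.associated_of_dvd hρ this).dvd')
  obtain ⟨u, e, β, hβ⟩ := exists_eq_unit_mul_pow_mul_sq hρ hac hγ0 hcommon
  have ha0 : a ≠ 0 := left_ne_zero_of_mul (hac ▸ pow_ne_zero 2 hγ0)
  have hβ0 : β ≠ 0 := by rintro rfl; exact ha0 (by rw [hβ]; ring)
  obtain ⟨Z, hZ⟩ := exists_norm_mul_pow_eq_sq h.prod_embeddings hD
  have he : Even e := by
    refine even_of_mul_pow_eq_sq h.norm_ramified hk0 (Algebra.norm_ne_zero_iff.2 hβ0) hZ ?_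
    rw [← ha_def, hβ, map_mul, map_mul, map_pow, map_pow, Int.natAbs_mul, Int.natAbs_mul,
      Int.natAbs_pow, Int.natAbs_pow, Int.isUnit_iff_natAbs_eq.1 (u.isUnit.map _), one_mul]
  obtain ⟨j, rfl⟩ := he
  have haβ : a = u * (ρ ^ j * β) ^ 2 := by rw [hβ]; ring
  set β' := ρ ^ j * β
  have hεβ : ¬ε ∣ β' := fun hd =>
    h.isTwoUniformizer.not_dvd (by norm_num) (h.isTwoUniformizer.dvd_two.trans ha7)
      (haβ ▸ (hd.pow two_ne_zero).mul_left _)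
  have h14 := (h.isTwoUniformizer.dvd_or_two_dvd h.norm_uniformizer β').resolve_left hεβ
  have hu : (2 : 𝓞 L) ∣ (u : 𝓞 L) ^ 7 - 1 := by
    have := ha7.sub (h14.mul_left ((u : 𝓞 L) ^ 7))
    rw [haβ] at this
    convert this using 1
    ring
  obtain ⟨v, rfl | rfl⟩ := h.unit_eq_sq u hu
  · exact ⟨v * β', Or.inl (by rw [haβ]; push_cast; ring)⟩
  · exact ⟨v * β', Or.inr (by rw [haβ]; push_cast; ring)⟩

/-- The descent terminates: every primitive descent form is a torsion form. -/
theorem IsDescentField.exists_torsionForm {L : Type*} [Field L] [NumberField L] {m : ℤ}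
    {η s ε ρ : 𝓞 L} (h : IsDescentField L m η s ε ρ) (hm : m = 1 ∨ m = 2) {A : Fin 3 → ℤ}
    (hA : IsPrimitiveForm A) (hA' : IsDescentForm m A) :
    ∃ T ∈ torsionForms, ∀ i j, A i * T j = A j * T i := by
  refine exists_torsionForm_of_isDescentForm hm ?_ hA hA'
  intro A B C k hA hk hD
  obtain ⟨ξ, hξ⟩ := h.exists_quadForm_eq hA ⟨B, C, k, hk, hD⟩
  refine exists_mul_sq_eq h.finrank_eq (θ := (η : L) ^ 2) (s := (s : L)) h.pos ?_ h.relation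
    (IsPrimitiveForm.exists_odd hA) hk hD (ξ := (ξ : L)) ?_
  · have := congrArg (algebraMap (𝓞 L) L) h.sq_eq
    simpa using this
  · refine hξ.imp (fun h => ?_) (fun h => ?_) <;>
    · have := congrArg (algebraMap (𝓞 L) L) h
      simpa [quadForm] using this

end

section

open Polynomial

theorem Polynomial.Monic.eq_quadratic {k : Type*} [CommRing k] {q : k[X]} (hq : q.Monic)
    (h : q.natDegree = 2) : q = X ^ 2 + C (q.coeff 1) * X + C (q.coeff 0) := by
  conv_lhs => rw [hq.as_sum, h]
  simp [Finset.sum_range_succ]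
  ring

theorem Polynomial.Monic.eq_cubic {k : Type*} [CommRing k] {q : k[X]} (hq : q.Monic)
    (h : q.natDegree = 3) :
    q = X ^ 3 + C (q.coeff 2) * X ^ 2 + C (q.coeff 1) * X + C (q.coeff 0) := by
  conv_lhs => rw [hq.as_sum, h]
  simp [Finset.sum_range_succ]
  ring

theorem Polynomial.Monic.eq_quartic {k : Type*} [CommRing k] {q : k[X]} (hq : q.Monic)
    (h : q.natDegree = 4) : q = X ^ 4 + C (q.coeff 3) * X ^ 3 + C (q.coeff 2) * X ^ 2 +
      C (q.coeff 1) * X + C (q.coeff 0) := by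
  conv_lhs => rw [hq.as_sum, h]
  simp [Finset.sum_range_succ]
  ring

/-- The monic sextic polynomial with prescribed lower coefficients. -/
noncomputable def sexticPoly {R : Type*} [CommRing R] (a₀ a₁ a₂ a₃ a₄ a₅ : R) : R[X] :=
  X ^ 6 + C a₅ * X ^ 5 + C a₄ * X ^ 4 + C a₃ * X ^ 3 + C a₂ * X ^ 2 + C a₁ * X + C a₀

theorem sexticPoly_natDegree {R : Type*} [CommRing R] [Nontrivial R] (a₀ a₁ a₂ a₃ a₄ a₅ : R) :
    (sexticPoly a₀ a₁ a₂ a₃ a₄ a₅).natDegree = 6 := by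
  unfold sexticPoly
  compute_degree!

theorem sexticPoly_monic {R : Type*} [CommRing R] (a₀ a₁ a₂ a₃ a₄ a₅ : R) :
    (sexticPoly a₀ a₁ a₂ a₃ a₄ a₅).Monic := by
  unfold sexticPoly
  monicity!

theorem sexticPoly_injective {R : Type*} [CommRing R] {a₀ a₁ a₂ a₃ a₄ a₅ b₀ b₁ b₂ b₃ b₄ b₅ : R}
    (h : sexticPoly a₀ a₁ a₂ a₃ a₄ a₅ = sexticPoly b₀ b₁ b₂ b₃ b₄ b₅) :
    a₀ = b₀ ∧ a₁ = b₁ ∧ a₂ = b₂ ∧ a₃ = b₃ ∧ a₄ = b₄ ∧ a₅ = b₅ := by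
  have hc : ∀ n, (sexticPoly a₀ a₁ a₂ a₃ a₄ a₅).coeff n = (sexticPoly b₀ b₁ b₂ b₃ b₄ b₅).coeff n :=
    fun n => by rw [h]
  refine ⟨by simpa [sexticPoly, coeff_X, coeff_C] using hc 0,
    by simpa [sexticPoly, coeff_X, coeff_C] using hc 1,
    by simpa [sexticPoly, coeff_X, coeff_C] using hc 2,
    by simpa [sexticPoly, coeff_X, coeff_C] using hc 3,
    by simpa [sexticPoly, coeff_X, coeff_C] using hc 4,
    by simpa [sexticPoly, coeff_X, coeff_C] using hc 5⟩

theorem sexticPoly_irreducible {k : Type*} [CommRing k] [IsDomain k] {a₀ a₁ a₂ a₃ a₄ a₅ : k}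
    (h1 : ∀ x : k, x ^ 6 + a₅ * x ^ 5 + a₄ * x ^ 4 + a₃ * x ^ 3 + a₂ * x ^ 2 + a₁ * x + a₀ ≠ 0)
    (h2 : ∀ a b c d e f : k, a₅ = a + c → a₄ = b + a * c + d → a₃ = b * c + a * d + e →
      a₂ = b * d + a * e + f → a₁ = b * e + a * f → a₀ ≠ b * f)
    (h3 : ∀ a b c d e f : k, a₅ = a + d → a₄ = b + a * d + e → a₃ = c + b * d + a * e + f →
      a₂ = c * d + b * e + a * f → a₁ = c * e + b * f → a₀ ≠ c * f) :
    Irreducible (sexticPoly a₀ a₁ a₂ a₃ a₄ a₅) := by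
  have hmon := sexticPoly_monic a₀ a₁ a₂ a₃ a₄ a₅
  have hdeg := sexticPoly_natDegree a₀ a₁ a₂ a₃ a₄ a₅
  have hne : sexticPoly a₀ a₁ a₂ a₃ a₄ a₅ ≠ 1 := fun h => by rw [h] at hdeg; simp at hdeg
  rw [hmon.irreducible_iff_natDegree']
  refine ⟨hne, ?_⟩
  rintro q r hq hr hqr hr'
  rw [hdeg, Finset.mem_Ioc] at hr'
  have hsum : q.natDegree + r.natDegree = 6 := by rw [← hdeg, ← hqr, hq.natDegree_mul hr]
  obtain h | h | h : r.natDegree = 1 ∨ r.natDegree = 2 ∨ r.natDegree = 3 := by omega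
  · have e : r = X + C (r.coeff 0) := by
      conv_lhs => rw [hr.as_sum, h]
      simp
    apply h1 (-r.coeff 0)
    have := congrArg (eval (-r.coeff 0)) hqr
    rw [eval_mul, e] at this
    simp [sexticPoly] at this
    linear_combination -this
  · have e : q * r = sexticPoly (r.coeff 0 * q.coeff 0) (r.coeff 0 * q.coeff 1 + r.coeff 1 * q.coeff 0)
        (r.coeff 0 * q.coeff 2 + r.coeff 1 * q.coeff 1 + q.coeff 0)
        (r.coeff 0 * q.coeff 3 + r.coeff 1 * q.coeff 2 + q.coeff 1)
        (r.coeff 0 + r.coeff 1 * q.coeff 3 + q.coeff 2) (r.coeff 1 + q.coeff 3) := by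
      conv_lhs => rw [hr.eq_quadratic h, hq.eq_quartic (by omega)]
      simp only [sexticPoly, C_add, C_mul]
      ring
    rw [hqr] at e
    obtain ⟨e0, e1, e2, e3, e4, e5⟩ := sexticPoly_injective e
    exact h2 _ _ _ _ _ _ e5 e4 e3 e2 e1 e0
  · have e : q * r = sexticPoly (r.coeff 0 * q.coeff 0) (r.coeff 0 * q.coeff 1 + r.coeff 1 * q.coeff 0)
        (r.coeff 0 * q.coeff 2 + r.coeff 1 * q.coeff 1 + r.coeff 2 * q.coeff 0)
        (r.coeff 0 + r.coeff 1 * q.coeff 2 + r.coeff 2 * q.coeff 1 + q.coeff 0)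
        (r.coeff 1 + r.coeff 2 * q.coeff 2 + q.coeff 1) (r.coeff 2 + q.coeff 2) := by
      conv_lhs => rw [hr.eq_cubic h, hq.eq_cubic (by omega)]
      simp only [sexticPoly, C_add, C_mul]
      ring
    rw [hqr] at e
    obtain ⟨e0, e1, e2, e3, e4, e5⟩ := sexticPoly_injective e
    exact h3 _ _ _ _ _ _ e5 e4 e3 e2 e1 e0

theorem sexticPoly_map {R S : Type*} [CommRing R] [CommRing S] (f : R →+* S)
    (a₀ a₁ a₂ a₃ a₄ a₅ : R) : (sexticPoly a₀ a₁ a₂ a₃ a₄ a₅).map f =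
      sexticPoly (f a₀) (f a₁) (f a₂) (f a₃) (f a₄) (f a₅) := by
  simp [sexticPoly]

theorem sexticPoly_irreducible_of_zmod {p : ℕ} [Fact p.Prime] {a₀ a₁ a₂ a₃ a₄ a₅ : ℤ}
    (h : Irreducible (sexticPoly (a₀ : ZMod p) a₁ a₂ a₃ a₄ a₅)) :
    Irreducible (sexticPoly (a₀ : ℚ) a₁ a₂ a₃ a₄ a₅) := by
  have hmon := sexticPoly_monic a₀ a₁ a₂ a₃ a₄ a₅
  have h1 : Irreducible (sexticPoly a₀ a₁ a₂ a₃ a₄ a₅) :=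
    hmon.irreducible_of_irreducible_map (Int.castRingHom (ZMod p)) _ (by
      rw [sexticPoly_map]; exact h)
  have := hmon.irreducible_iff_irreducible_map_fraction_map (K := ℚ) |>.1 h1
  rw [sexticPoly_map] at this
  simpa using this

theorem irreducible_sexticPoly_zmod_three : Irreducible (sexticPoly (1 : ZMod 3) 2 4 4 3 2) := by
  have hdom : IsDomain (ZMod 3) := ZMod.instIsDomain (hp := ⟨by norm_num⟩)
  refine sexticPoly_irreducible (by decide) ?_ ?_
  · intro a b c d e f h5 h4 h3 h2
    obtain rfl := (sub_eq_of_eq_add' h5).symm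
    obtain rfl := (sub_eq_of_eq_add' h4).symm
    obtain rfl := (sub_eq_of_eq_add' h3).symm
    obtain rfl := (sub_eq_of_eq_add' h2).symm
    clear h5 h4 h3 h2
    revert a b
    decide
  · intro a b c d e f h5 h4 h3
    obtain rfl := (sub_eq_of_eq_add' h5).symm
    obtain rfl := (sub_eq_of_eq_add' h4).symm
    obtain rfl := (sub_eq_of_eq_add' h3).symm
    clear h5 h4 h3
    revert a b c
    decide

theorem irreducible_sexticPoly_of_one : Irreducible (sexticPoly (1 : ℚ) 2 4 4 3 2) := by
  have : Fact (Nat.Prime 3) := ⟨by norm_num⟩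
  have := sexticPoly_irreducible_of_zmod (p := 3) (a₀ := 1) (a₁ := 2) (a₂ := 4) (a₃ := 4)
    (a₄ := 3) (a₅ := 2) (by push_cast; exact irreducible_sexticPoly_zmod_three)
  simpa using this

theorem irreducible_sexticPoly_zmod_five : Irreducible (sexticPoly (1 : ZMod 5) 0 2 2 3 2) := by
  have hdom : IsDomain (ZMod 5) := ZMod.instIsDomain (hp := ⟨by norm_num⟩)
  refine sexticPoly_irreducible (by decide) ?_ ?_
  · intro a b c d e f h5 h4 h3 h2
    obtain rfl := (sub_eq_of_eq_add' h5).symm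
    obtain rfl := (sub_eq_of_eq_add' h4).symm
    obtain rfl := (sub_eq_of_eq_add' h3).symm
    obtain rfl := (sub_eq_of_eq_add' h2).symm
    clear h5 h4 h3 h2
    revert a b
    decide
  · intro a b c d e f h5 h4 h3
    obtain rfl := (sub_eq_of_eq_add' h5).symm
    obtain rfl := (sub_eq_of_eq_add' h4).symm
    obtain rfl := (sub_eq_of_eq_add' h3).symm
    clear h5 h4 h3
    revert a b c
    decide

theorem irreducible_sexticPoly_of_two : Irreducible (sexticPoly (1 : ℚ) 0 2 2 3 2) := by
  have : Fact (Nat.Prime 5) := ⟨by norm_num⟩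
  have := sexticPoly_irreducible_of_zmod (p := 5) (a₀ := 1) (a₁ := 0) (a₂ := 2) (a₃ := 2)
    (a₄ := 3) (a₅ := 2) (by push_cast; exact irreducible_sexticPoly_zmod_five)
  simpa using this

end

section

open NumberField Polynomial

theorem prod_sub_embeddings {L : Type*} [Field L] [NumberField L] (pb : PowerBasis ℚ L) (w : ℂ) :
    ∏ σ : L →ₐ[ℚ] ℂ, (w - σ pb.gen) = aeval w (minpoly ℚ pb.gen) := by
  classical
  have hmon : ((minpoly ℚ pb.gen).map (algebraMap ℚ ℂ)).Monic :=
    (minpoly.monic pb.isIntegral_gen).map _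
  have hsep : ((minpoly ℚ pb.gen).map (algebraMap ℚ ℂ)).Separable :=
    Polynomial.Separable.map (Algebra.IsSeparable.isSeparable ℚ pb.gen)
  rw [aeval_def, eval₂_eq_eval_map,
    (IsAlgClosed.splits ((minpoly ℚ pb.gen).map (algebraMap ℚ ℂ))).eval_eq_prod_roots_of_monic hmon,
    Fintype.prod_equiv pb.liftEquiv' (fun σ => w - σ pb.gen) (fun x => w - x)
      fun σ => by simp only [PowerBasis.liftEquiv'_apply_coe]]
  rw [Finset.prod_mem_multiset _ _ (fun x => w - x) fun x => rfl,
    Finset.prod_eq_multiset_prod, Multiset.toFinset_val, Multiset.dedup_eq_self.mpr]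
  exact nodup_roots hsep

theorem aeval_sexticPoly {R S : Type*} [CommRing R] [CommRing S] [Algebra R S]
    (a₀ a₁ a₂ a₃ a₄ a₅ : R) (x : S) : aeval x (sexticPoly a₀ a₁ a₂ a₃ a₄ a₅) =
      x ^ 6 + algebraMap R S a₅ * x ^ 5 + algebraMap R S a₄ * x ^ 4 + algebraMap R S a₃ * x ^ 3 +
        algebraMap R S a₂ * x ^ 2 + algebraMap R S a₁ * x + algebraMap R S a₀ := by
  simp [sexticPoly]

theorem eq_zero_of_sum_pow_eq_zero {L : Type*} [Field L] [Algebra ℚ L] {η : L}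
    (h : (minpoly ℚ η).natDegree = 6) {c₀ c₁ c₂ c₃ c₄ c₅ : ℚ}
    (h0 : algebraMap ℚ L c₀ + algebraMap ℚ L c₁ * η + algebraMap ℚ L c₂ * η ^ 2 +
      algebraMap ℚ L c₃ * η ^ 3 + algebraMap ℚ L c₄ * η ^ 4 + algebraMap ℚ L c₅ * η ^ 5 = 0) :
    c₀ = 0 ∧ c₁ = 0 ∧ c₂ = 0 ∧ c₃ = 0 ∧ c₄ = 0 ∧ c₅ = 0 := by
  let p : ℚ[X] := C c₀ + C c₁ * X + C c₂ * X ^ 2 + C c₃ * X ^ 3 + C c₄ * X ^ 4 + C c₅ * X ^ 5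
  have hp : p = 0 := by
    refine eq_zero_of_dvd_of_natDegree_lt (p := minpoly ℚ η) (minpoly.dvd ℚ η ?_) ?_
    · simpa [p] using h0
    · rw [h, Nat.lt_succ_iff]
      simp only [p]
      compute_degree
  have hc : ∀ n, p.coeff n = 0 := fun n => by rw [hp, coeff_zero]
  refine ⟨by simpa [p, coeff_X, coeff_C] using hc 0, by simpa [p, coeff_X, coeff_C] using hc 1,
    by simpa [p, coeff_X, coeff_C] using hc 2, by simpa [p, coeff_X, coeff_C] using hc 3,
    by simpa [p, coeff_X, coeff_C] using hc 4, by simpa [p, coeff_X, coeff_C] using hc 5⟩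

theorem prod_embeddings_sq {L : Type*} [Field L] [NumberField L] (pb : PowerBasis ℚ L)
    (hL : Module.finrank ℚ L = 6) {m : ℂ}
    (hF : ∀ w : ℂ, aeval w (minpoly ℚ pb.gen) * aeval (-w) (minpoly ℚ pb.gen) =
      sexticForm m (w ^ 2) 1) (p q : ℂ) :
    ∏ σ : L →ₐ[ℚ] ℂ, (p * σ (pb.gen ^ 2) + q) = sexticForm m (-q) p := by
  have hcard : Fintype.card (L →ₐ[ℚ] ℂ) = 6 := by rw [AlgHom.card, hL]
  by_cases hp : p = 0
  · simp [hp, hcard, sexticForm, hForm, bForm]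
    ring
  obtain ⟨w, hw⟩ := IsAlgClosed.exists_pow_nat_eq (-q / p) (n := 2) (by norm_num)
  have hq : q = -(p * w ^ 2) := by rw [hw]; field_simp
  calc ∏ σ : L →ₐ[ℚ] ℂ, (p * σ (pb.gen ^ 2) + q) =
      ∏ σ : L →ₐ[ℚ] ℂ, (p * ((w - σ pb.gen) * (-w - σ pb.gen))) := by
        refine Finset.prod_congr rfl fun σ _ => ?_
        rw [hq, map_pow]
        ring
    _ = p ^ 6 * sexticForm m (w ^ 2) 1 := by
        rw [Finset.prod_mul_distrib, Finset.prod_mul_distrib, prod_sub_embeddings,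
          prod_sub_embeddings, hF, Finset.prod_const, Finset.card_univ, hcard]
    _ = _ := by
        rw [hq]
        simp only [sexticForm, hForm, bForm]
        ring

theorem pow_absNorm_sub_mem {L : Type*} [Field L] [NumberField L] {I : Ideal (𝓞 L)}
    [hI : I.IsPrime] (hI0 : I ≠ ⊥) (x : 𝓞 L) : x ^ Ideal.absNorm I - x ∈ I := by
  have hmax := hI.isMaximal hI0
  let _ : Field (𝓞 L ⧸ I) := Ideal.Quotient.field _
  have hfin : Finite (𝓞 L ⧸ I) := Ideal.finiteQuotientOfFreeOfNeBot _ hI0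
  have := Fintype.ofFinite (𝓞 L ⧸ I)
  have hcard : Ideal.absNorm I = Fintype.card (𝓞 L ⧸ I) := by
    rw [← Nat.card_eq_fintype_card]; rfl
  rw [← Ideal.Quotient.eq_zero_iff_mem, map_sub, map_pow, hcard, FiniteField.pow_card, sub_self]

theorem isPrincipalIdealRing_of_abs_norm_le {L : Type*} [Field L] [NumberField L]
    (pb : PowerBasis ℚ L) (hintegral : IsIntegral ℤ pb.gen) (hL : Module.finrank ℚ L = 6)
    (hr : InfinitePlace.nrRealPlaces L = 0) {d : ℚ} {N : ℕ} (hd : 0 ≤ d)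
    (hdisc : |Algebra.norm ℚ (aeval pb.gen (derivative (minpoly ℚ pb.gen)))| ≤ d ^ 2)
    (hN : (4 / 3.14) ^ 3 * (720 / 46656) * d < N + 1)
    (h : ∀ I : Ideal (𝓞 L), I.IsPrime → I ≠ ⊥ → Ideal.absNorm I ≤ N → I.IsPrincipal) :
    IsPrincipalIdealRing (𝓞 L) := by
  refine RingOfIntegers.isPrincipalIdealRing_of_isPrincipal_of_norm_le_of_isPrime fun I hI hIM => ?_
  refine h I hI (nonZeroDivisors.coe_ne_zero I) ?_
  rw [nrComplexPlaces_eq_three hL hr, hL] at hIM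
  have hdis : |(discr L : ℚ)| ≤ d ^ 2 := by
    refine (abs_discr_le pb.basis fun i => ?_).trans ?_
    · rw [pb.basis_eq_pow]; exact hintegral.pow _
    · rw [Algebra.discr_powerBasis_eq_norm, abs_mul, abs_pow, abs_neg, abs_one, one_pow, one_mul]
      exact hdisc
  have hsqrt : √|(discr L : ℝ)| ≤ (d : ℝ) := by
    refine Real.sqrt_le_iff.2 ⟨by exact_mod_cast hd, by exact_mod_cast hdis⟩
  have hπ : (4 / Real.pi) ≤ 4 / 3.14 := by
    have := Real.pi_gt_d2
    gcongr
  have hfac : (Nat.factorial 6 / (6 : ℕ) ^ 6 : ℝ) = 720 / 46656 := by norm_num [Nat.factorial]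
  have hN' : ((4 / 3.14) ^ 3 * (720 / 46656) * d : ℝ) < N + 1 := by
    have : (((4 / 3.14) ^ 3 * (720 / 46656) * d : ℚ) : ℝ) < ((N + 1 : ℚ) : ℝ) := by exact_mod_cast hN
    push_cast at this
    convert this using 3
  have hlt : (Ideal.absNorm (I : Ideal (𝓞 L)) : ℝ) < N + 1 := by
    refine lt_of_le_of_lt (hIM.trans ?_) hN'
    push_cast at hfac ⊢
    rw [hfac, mul_assoc]
    gcongr
  exact Nat.lt_succ_iff.1 (by exact_mod_cast hlt)

end

section

open NumberField

theorem IsTwoUniformizer.even_of_dvd_quadForm {R : Type*} [CommRing R] {ε η : R}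
    (h : IsTwoUniformizer ε η) {a : Fin 3 → ℤ} (ha : ε ∣ quadForm (fun i => (a i : R)) η 1) (i : Fin 3) :
    Even (a i) := by
  by_contra hi
  rw [Int.not_even_iff_odd] at hi
  let π := Ideal.Quotient.mk (Ideal.span {ε})
  have hπ : ∀ x, π x = 0 ↔ ε ∣ x := fun x => by
    rw [Ideal.Quotient.eq_zero_iff_mem, Ideal.mem_span_singleton]
  have h7 := quadForm_pow_seven_eq_one (S := R ⧸ Ideal.span {ε}) (t := π η)
    (by rw [← map_ofNat π 2]; exact (hπ 2).2 h.dvd_two)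
    (by rw [← map_pow, ← map_pow, ← map_add, ← map_one π, ← map_add]; exact (hπ _).2 h.dvd_cubic)
    ⟨i, hi⟩
  have h0 : quadForm (fun i => (a i : R ⧸ Ideal.span {ε})) (π η) 1 = 0 := by
    rw [← (hπ _).2 ha]
    simp [quadForm]
  rw [h0, zero_pow (by norm_num)] at h7
  exact h.not_isUnit (isUnit_of_dvd_one ((hπ 1).1 (by rw [map_one, h7])))

theorem two_dvd_prod_pow_sub {R : Type*} [CommRing R] {ε : R} (h2 : 2 ∣ ε ^ 2) {ι : Type*}
    (t : Finset ι) {g q : ι → R} (hg : ∀ i, 2 ∣ g i - 1 - ε * q i) (n : ι → ℕ) :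
    2 ∣ ∏ i ∈ t, g i ^ n i - 1 - ε * ∑ i ∈ t, n i * q i := by
  have hmul : ∀ {a b c d : R}, 2 ∣ a - 1 - ε * b → 2 ∣ c - 1 - ε * d →
      2 ∣ a * c - 1 - ε * (b + d) := by
    rintro a b c d ⟨x, hx⟩ ⟨y, hy⟩
    obtain ⟨z, hz⟩ := h2
    exact ⟨x * c + (1 + ε * b) * y + z * b * d,
      by linear_combination c * hx + (1 + ε * b) * hy + b * d * hz⟩
  have hpow : ∀ i (k : ℕ), 2 ∣ g i ^ k - 1 - ε * (k * q i) := by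
    intro i k
    induction k with
    | zero => simp
    | succ k ih =>
      have := hmul ih (hg i)
      rw [← pow_succ] at this
      convert this using 2
      push_cast
      ring
  classical
  induction t using Finset.induction_on with
  | empty => simp
  | insert i t hi ih =>
    rw [Finset.prod_insert hi, Finset.sum_insert hi]
    exact hmul (hpow _ _) ih

theorem IsTwoUniformizer.unit_eq_sq {L : Type*} [Field L] [NumberField L] {ε η : 𝓞 L}
    (h : IsTwoUniformizer ε η) (hN : (Algebra.norm ℤ ε).natAbs = 8) (hε : ε ^ 2 ∣ 2)
    (hr : Units.rank L = 2) (g : Fin 3 → (𝓞 L)ˣ) (a : Fin 3 → Fin 3 → ℤ)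
    (hg : ∀ i, 2 ∣ (g i : 𝓞 L) ^ 7 - 1 - ε * quadForm (fun j => (a i j : 𝓞 L)) η 1)
    (ha : ∀ n : Fin 3 → Fin 2, n ≠ 0 → (∀ j, Even (∑ i, ((n i : ℕ) : ℤ) * a i j)) →
      ∏ i, g i ^ (n i : ℕ) = -1 ∧ ¬IsSquare (-1 : (𝓞 L)ˣ))
    (u : (𝓞 L)ˣ) (hu : (2 : 𝓞 L) ∣ (u : 𝓞 L) ^ 7 - 1) : ∃ v : (𝓞 L)ˣ, u = v ^ 2 ∨ u = -v ^ 2 := by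
  have hε0 : ε ≠ 0 := by
    rintro rfl
    simp at hN
  have heven : ∀ n : Fin 3 → Fin 2,
      (2 : 𝓞 L) ∣ ((∏ i, g i ^ (n i : ℕ) : (𝓞 L)ˣ) : 𝓞 L) ^ 7 - 1 →
      ∀ j, Even (∑ i, ((n i : ℕ) : ℤ) * a i j) := by
    intro n hn
    have h1 := two_dvd_prod_pow_sub h.two_dvd_sq Finset.univ hg fun i => (n i : ℕ)
    have h2 : (2 : 𝓞 L) ∣ ε * ∑ i, ((n i : ℕ) : 𝓞 L) * quadForm (fun j => (a i j : 𝓞 L)) η 1 := by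
      rw [Units.coe_prod, ← Finset.prod_pow] at hn
      simp only [Units.val_pow_eq_pow_val, pow_right_comm _ _ 7] at hn
      exact (dvd_sub_right hn).1 h1
    have h3 := (hε.trans h2)
    rw [sq, mul_dvd_mul_iff_left hε0] at h3
    refine h.even_of_dvd_quadForm ?_
    convert h3 using 1
    simp only [quadForm, Fin.sum_univ_three]
    push_cast
    ring
  have hsq : ∀ v : (𝓞 L)ˣ, (2 : 𝓞 L) ∣ ((v ^ 2 : (𝓞 L)ˣ) : 𝓞 L) ^ 7 - 1 := by
    intro v
    rcases h.dvd_or_two_dvd hN v with hd | hd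
    · exact absurd (isUnit_of_dvd_unit hd v.isUnit) h.not_isUnit
    · rwa [Units.val_pow_eq_pow_val, ← pow_mul]
  obtain ⟨f, hf⟩ := exists_units_generators hr
  obtain ⟨n, v, rfl⟩ := exists_eq_prod_mul_sq_of_independent f g hf (fun n hn hs => by
    obtain ⟨v, hv⟩ := hs
    obtain ⟨h1, h2⟩ := ha n hn (heven n (by rw [hv, ← sq]; exact hsq v))
    exact h2 ⟨v, h1.symm.trans hv⟩) u
  refine ⟨v, ?_⟩
  by_cases hn : n = 0
  · left; simp [hn]
  right
  rw [(ha n hn (heven n ?_)).1, neg_one_mul]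
  obtain ⟨x, hx⟩ := hu
  obtain ⟨y, hy⟩ := hsq v
  rw [Units.val_mul] at hx
  exact ⟨x - ((∏ i, g i ^ (n i : ℕ) : (𝓞 L)ˣ) : 𝓞 L) ^ 7 * y, by
    linear_combination hx - ((∏ i, g i ^ (n i : ℕ) : (𝓞 L)ˣ) : 𝓞 L) ^ 7 * hy⟩

end

section

open NumberField Polynomial

theorem natAbs_norm_of_isUnit {L : Type*} [Field L] {u : 𝓞 L} (hu : IsUnit u) :
    (Algebra.norm ℤ u).natAbs = 1 :=
  Int.isUnit_iff_natAbs_eq.1 (hu.map (Algebra.norm ℤ))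

section

variable {L : Type*} [Field L] [NumberField L]

theorem natAbs_norm_two (hL : Module.finrank ℚ L = 6) : (Algebra.norm ℤ (2 : 𝓞 L)).natAbs = 64 := by
  have h : ((Algebra.norm ℤ (2 : 𝓞 L) : ℤ) : ℚ) = 64 := by
    have h2 : ((2 : 𝓞 L) : L) = algebraMap ℚ L 2 :=
      (map_ofNat (algebraMap (𝓞 L) L) 2).trans (map_ofNat (algebraMap ℚ L) 2).symm
    rw [Algebra.coe_norm_int, h2, Algebra.norm_algebraMap, hL]
    norm_num
  have h' : Algebra.norm ℤ (2 : 𝓞 L) = 64 := by exact_mod_cast h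
  rw [h']
  rfl

theorem norm_eq_of_prod_embeddings {x : 𝓞 L} {n : ℤ}
    (h : ∏ σ : L →ₐ[ℚ] ℂ, σ (x : L) = n) : Algebra.norm ℤ x = n := by
  have h1 := Algebra.norm_eq_prod_embeddings ℚ ℂ (x : L)
  rw [h, ← Algebra.coe_norm_int, eq_ratCast] at h1
  exact_mod_cast h1

theorem Ideal.IsPrime.absNorm_ne_of_eq {I : Ideal (𝓞 L)} (hI : I.IsPrime) (hI0 : I ≠ ⊥) {p : 𝓞 L}
    (hp : p ∈ I) {η a c : 𝓞 L} {q : ℕ} (h : a * (η ^ q - η) = 1 + p * c) : Ideal.absNorm I ≠ q := by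
  rintro rfl
  refine hI.ne_top ((Ideal.eq_top_iff_one _).2 ?_)
  have h1 := I.mul_mem_left a (pow_absNorm_sub_mem hI0 η)
  rw [h] at h1
  exact (Ideal.add_mem_iff_left I (I.mul_mem_right c hp)).1 h1

theorem isIntegral_of_minpoly_eq {x : L} {a₀ a₁ a₂ a₃ a₄ a₅ : ℤ}
    (h : minpoly ℚ x = sexticPoly (a₀ : ℚ) a₁ a₂ a₃ a₄ a₅) : IsIntegral ℤ x := by
  refine ⟨sexticPoly a₀ a₁ a₂ a₃ a₄ a₅, sexticPoly_monic _ _ _ _ _ _, ?_⟩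
  have h0 := minpoly.aeval ℚ x
  rw [h, aeval_sexticPoly] at h0
  rw [← aeval_def, aeval_sexticPoly]
  simpa using h0

end

end

section

open NumberField Polynomial

theorem isDescentField_one_aux {R : Type*} [CommRing R] {η s : R} (hs : s ^ 2 = -1)
    (hP : η ^ 3 + η ^ 2 + (1 + s) * η + 1 = 0) :
    η * (-1 - s - η - η ^ 2) = 1 ∧
    (1 + s + (1 + s) * η + η ^ 2) * (-1 - η + (s - 1) * η ^ 2) = 1 ∧
    hForm (η ^ 2) 1 = -2 * s * bForm (η ^ 2) 1 ∧
    (1 + η + η ^ 2) * (-s - (1 + s) * η - η ^ 2) = 1 ∧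
    ((1 + 2 * s) * η + 2 * s * η ^ 2) * (1 + 3 * s + (2 * s - 1) * η + (3 + 2 * s) * η ^ 2) = 1 ∧
    6 * η ^ 5 + 10 * η ^ 4 + 12 * η ^ 3 + 12 * η ^ 2 + 8 * η + 2 =
      2 * (η ^ 2 - η + 1) ^ 2 * (-s * η * ((1 + 2 * s) * η + 2 * s * η ^ 2)) ∧
    η ^ 7 - 1 - (1 + s) * (1 + η) = 2 * (-1 - (1 + s) * η + η ^ 2) ∧
    (1 + s + (1 + s) * η + η ^ 2) ^ 7 - 1 - (1 + s) * (1 + η ^ 2) =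
      2 * (-2 * s - 2 * s * η - (1 + 2 * s) * η ^ 2) ∧
    s ^ 7 - 1 - (1 + s) = 2 * (-1 - s) ∧ η ^ 3 + η ^ 2 + 1 = (1 + s) * -η := by
  have h3 : (1 + s + (1 + s) * η + η ^ 2) ^ 3 = -2 * s - η * s - η ^ 2 := by
    linear_combination (1 + 5 * s + 3 * s ^ 2 + s ^ 3 + 3 * η + 5 * η * s + 3 * η * s ^ 2 +
      2 * η ^ 2 + 3 * η ^ 2 * s + η ^ 3) * hP + (-η - η * s - η * s ^ 2 + η ^ 2 - η ^ 2 * s) * hs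
  refine ⟨?_, ?_, ?_, ?_, ?_, ?_, ?_, ?_, ?_, ?_⟩
  · linear_combination -hP
  · linear_combination (-1 - s + s ^ 2 - η + η * s) * hP + (-1 - η * s - η ^ 2) * hs
  · simp only [hForm, bForm]
    linear_combination (-1 + η + η * s - η ^ 2 + η ^ 3) * hP - η ^ 2 * hs
  · linear_combination (-1 - s - η) * hP + η * hs
  · linear_combination (3 + 4 * s ^ 2 + 6 * η * s + 4 * η * s ^ 2) * hP +
      (-4 - 2 * η - 4 * η * s - 4 * η ^ 2 - 4 * η ^ 2 * s) * hs
  · linear_combination (2 - 16 * s + 4 * s ^ 2 - 16 * s ^ 3 + 4 * s ^ 4 + 4 * η + 10 * η * s -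
      2 * η * s ^ 2 + 12 * η * s ^ 3 + 6 * η ^ 2 - 6 * η ^ 2 * s + 8 * η ^ 2 * s ^ 2 -
      4 * η ^ 2 * s ^ 3 + 2 * η ^ 3 * s - 8 * η ^ 3 * s ^ 2 + 4 * η ^ 4 * s ^ 2) * hP +
      (16 * s - 4 * s ^ 2 + 2 * η + 4 * η * s + 12 * η * s ^ 2 - 4 * η * s ^ 3 + 10 * η ^ 2 * s -
      16 * η ^ 2 * s ^ 2) * hs
  · have h : η ^ 3 = -1 - η - η * s - η ^ 2 := by linear_combination hP
    linear_combination (1 - s + s ^ 2 + η + 2 * η * s + η ^ 2) * hP + (-1 - η * s - 3 * η ^ 2) * hs +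
      η * (η ^ 3 + (-1 - η - η * s - η ^ 2)) * h
  · linear_combination (-1 + 5 * s ^ 2 + s ^ 3 + 3 * η * s + 3 * η * s ^ 2 + 3 * η ^ 2 * s + η ^ 3) *
      hP + (-1 + 3 * s + η + 2 * η * s - η * s ^ 2 + 2 * η ^ 2 + η ^ 2 * s) * hs +
      (1 + s + (1 + s) * η + η ^ 2) * ((1 + s + (1 + s) * η + η ^ 2) ^ 3 +
        (-2 * s - η * s - η ^ 2)) * h3
  · linear_combination (s ^ 5 - s ^ 3 + s) * hs
  · linear_combination hP

theorem isDescentField_two_aux {R : Type*} [CommRing R] {η s : R} (hs : s ^ 2 = -2)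
    (hP : η ^ 3 + (1 - s) * η ^ 2 + 1 = 0) :
    η * ((s - 1) * η - η ^ 2) = 1 ∧
    (-s - η ^ 2) * (1 - η - s * η ^ 2) = 1 ∧
    hForm (η ^ 2) 1 = -2 * s * bForm (η ^ 2) 1 ∧
    (η ^ 2) ^ 2 + η ^ 2 + 1 = (s - 1 + η + 2 * s * η ^ 2) * (η + 1) ^ 2 ∧
    (s - 1 + η + 2 * s * η ^ 2) * (2 + 2 * η + η ^ 2) = 1 ∧
    (1 + η ^ 2) * (1 + s + η + η ^ 2) = 1 ∧
    6 * η ^ 5 + 10 * η ^ 4 + 12 * η ^ 3 + 6 * η ^ 2 + 4 * η =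
      2 * s * (η + 1) ^ 4 * (η ^ 2 * (1 + η ^ 2)) ∧
    η ^ 7 - 1 - s * (η + η ^ 2) = 2 * (2 - s - (2 + s) * η + (1 - 3 * s) * η ^ 2) ∧
    (-s - η ^ 2) ^ 7 - 1 - s * (1 + η) = 2 * (2 + s + (1 - 3 * s) * η + (3 - 2 * s) * η ^ 2) ∧
    η ^ 3 + η ^ 2 + 1 = s * η ^ 2 := by
  have h3 : (-s - η ^ 2) ^ 3 = -2 - η + η * s - η ^ 2 + η ^ 2 * s := by
    linear_combination (2 - s ^ 3 - η - η * s - η * s ^ 2 + η ^ 2 - η ^ 2 * s - η ^ 3) * hP +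
      (η - η ^ 2 + η ^ 2 * s - η ^ 2 * s ^ 2) * hs
  refine ⟨?_, ?_, ?_, ?_, ?_, ?_, ?_, ?_, ?_, ?_⟩
  · linear_combination -hP
  · linear_combination (1 - s + s ^ 2 + η * s) * hP + (-1 - η ^ 2 + η ^ 2 * s) * hs
  · simp only [hForm, bForm]
    linear_combination (-3 + 2 * s - s ^ 2 + s ^ 3 + 2 * η + η * s ^ 2 - η ^ 2 + η ^ 2 * s + η ^ 3) *
      hP + (1 - s - η + η ^ 2 - 2 * η ^ 2 * s + η ^ 2 * s ^ 2) * hs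
  · linear_combination (-2 - s - 2 * s ^ 2 + η - 2 * η * s) * hP + (2 + η ^ 2 - 2 * η ^ 2 * s) * hs
  · linear_combination (1 + 2 * s + 2 * s ^ 2 + 2 * η * s) * hP + (-2 + 2 * η ^ 2 * s) * hs
  · linear_combination (s + η) * hP + η ^ 2 * hs
  · linear_combination (8 + 8 * s ^ 2 + 4 * s ^ 3 - 2 * s ^ 4 + 2 * s ^ 5 - 2 * s ^ 6 + 4 * η +
      4 * η * s - 2 * η * s ^ 3 - 2 * η * s ^ 5 + 6 * η ^ 2 - 6 * η ^ 2 * s - 4 * η ^ 2 * s ^ 2 -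
      2 * η ^ 2 * s ^ 3 - 2 * η ^ 2 * s ^ 4 - 8 * η ^ 3 * s - 4 * η ^ 3 * s ^ 2 - 2 * η ^ 3 * s ^ 3 -
      6 * η ^ 4 * s - 2 * η ^ 4 * s ^ 2 - 2 * η ^ 5 * s) * hP + (-4 - 2 * s ^ 2 - 2 * s ^ 3 +
      2 * s ^ 4 - 2 * η * s + 2 * η * s ^ 3 - 4 * η ^ 2 + 6 * η ^ 2 * s + 4 * η ^ 2 * s ^ 4 -
      2 * η ^ 2 * s ^ 5) * hs
  · have h : η ^ 3 = -1 - η ^ 2 + η ^ 2 * s := by linear_combination hP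
    linear_combination (3 - 6 * s + 6 * s ^ 2 - 4 * s ^ 3 + s ^ 4 - η + 3 * η * s - 3 * η * s ^ 2 +
      η * s ^ 3 + η ^ 2 - 2 * η ^ 2 * s + η ^ 2 * s ^ 2) * hP + (-4 + 4 * s - s ^ 2 + 3 * η - η * s -
      3 * η ^ 2 + 8 * η ^ 2 * s - 5 * η ^ 2 * s ^ 2 + η ^ 2 * s ^ 3) * hs +
      η * (η ^ 3 + (-1 - η ^ 2 + η ^ 2 * s)) * h
  · linear_combination (1 - 7 * s + 7 * s ^ 2 - 2 * s ^ 3 + 2 * s ^ 4 - s ^ 5 - 4 * η + 3 * η * s +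
      η * s ^ 2 + η * s ^ 3 - η * s ^ 4 - η ^ 2 + η ^ 2 * s + η ^ 2 * s ^ 2 - η ^ 2 * s ^ 3 - η ^ 3 +
      2 * η ^ 3 * s - η ^ 3 * s ^ 2) * hP + (-3 - 2 * s ^ 2 + s ^ 3 + η - η * s + η * s ^ 2 -
      5 * η ^ 2 + 3 * η ^ 2 * s - 2 * η ^ 2 * s ^ 2 + 3 * η ^ 2 * s ^ 3 - η ^ 2 * s ^ 4) * hs +
      (-s - η ^ 2) * ((-s - η ^ 2) ^ 3 + (-2 - η + η * s - η ^ 2 + η ^ 2 * s)) * h3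
  · linear_combination hP

end

section

open NumberField Polynomial

theorem map_sextic_one {R S : Type*} [CommRing R] [CommRing S] (f : R →+* S) (x : R) :
    f (x ^ 6 + 2 * x ^ 5 + 3 * x ^ 4 + 4 * x ^ 3 + 4 * x ^ 2 + 2 * x + 1) =
      f x ^ 6 + 2 * f x ^ 5 + 3 * f x ^ 4 + 4 * f x ^ 3 + 4 * f x ^ 2 + 2 * f x + 1 := by
  simp only [map_add, map_mul, map_pow, map_one, map_ofNat f 2, map_ofNat f 3, map_ofNat f 4]

theorem map_quintic_one {R S : Type*} [CommRing R] [CommRing S] (f : R →+* S) (x : R) :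
    f (6 * x ^ 5 + 10 * x ^ 4 + 12 * x ^ 3 + 12 * x ^ 2 + 8 * x + 2) =
      6 * f x ^ 5 + 10 * f x ^ 4 + 12 * f x ^ 3 + 12 * f x ^ 2 + 8 * f x + 2 := by
  simp only [map_add, map_mul, map_pow, map_ofNat f 6, map_ofNat f 10, map_ofNat f 12, map_ofNat f 8, map_ofNat f 2]

theorem isPrincipal_of_absNorm_le_three {L : Type*} [Field L] [NumberField L] {η : 𝓞 L}
    (hg : η ^ 6 + 2 * η ^ 5 + 3 * η ^ 4 + 4 * η ^ 3 + 4 * η ^ 2 + 2 * η + 1 = 0) {I : Ideal (𝓞 L)}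
    (hI : I.IsPrime) (hI0 : I ≠ ⊥) (hN : Ideal.absNorm I ≤ 3) : I.IsPrincipal := by
  exfalso
  have hmem := Ideal.absNorm_mem I
  have h0 : Ideal.absNorm I ≠ 0 := fun h => hI0 (Ideal.absNorm_eq_zero_iff.1 h)
  have h1 : Ideal.absNorm I ≠ 1 := fun h => hI.ne_top (Ideal.absNorm_eq_one_iff.1 h)
  obtain h2 | h3 : Ideal.absNorm I = 2 ∨ Ideal.absNorm I = 3 := by omega
  · rw [h2] at hmem
    refine hI.absNorm_ne_of_eq hI0 hmem (η := η) (a := η ^ 3 + η ^ 4)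
      (c := η + 2 * η ^ 2 + 2 * η ^ 3 + η ^ 4 + η ^ 5 + η ^ 6) ?_ h2
    push_cast
    linear_combination -hg
  · rw [h3] at hmem
    refine hI.absNorm_ne_of_eq hI0 hmem (η := η) (a := 1 + η - η ^ 2 - η ^ 3 + η ^ 5)
      (c := -η ^ 4 - 2 * η ^ 5 - 2 * η ^ 6 - η ^ 7) ?_ h3
    push_cast
    linear_combination (-(1 - η - η ^ 2)) * hg

theorem exists_isDescentField_one_of_minpoly {L : Type*} [Field L] [NumberField L]
    (pb : PowerBasis ℚ L) (hmin : minpoly ℚ pb.gen = sexticPoly (1 : ℚ) 2 4 4 3 2) :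
    ∃ η s ε ρ : 𝓞 L, IsDescentField L 1 η s ε ρ := by
  have hL : Module.finrank ℚ L = 6 := by
    rw [pb.finrank, ← pb.natDegree_minpoly, hmin, sexticPoly_natDegree]
  have hintegral : IsIntegral ℤ pb.gen :=
    isIntegral_of_minpoly_eq (a₀ := 1) (a₁ := 2) (a₂ := 4) (a₃ := 4) (a₄ := 3) (a₅ := 2)
      (by simpa using hmin)
  obtain ⟨η, hη⟩ : ∃ η : 𝓞 L, (η : L) = pb.gen := ⟨⟨pb.gen, hintegral⟩, rfl⟩
  have hgL : pb.gen ^ 6 + 2 * pb.gen ^ 5 + 3 * pb.gen ^ 4 + 4 * pb.gen ^ 3 + 4 * pb.gen ^ 2 +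
      2 * pb.gen + 1 = 0 := by
    have h0 := minpoly.aeval ℚ pb.gen
    rw [hmin, aeval_sexticPoly] at h0
    simpa using h0
  have hg : η ^ 6 + 2 * η ^ 5 + 3 * η ^ 4 + 4 * η ^ 3 + 4 * η ^ 2 + 2 * η + 1 = 0 := by
    apply RingOfIntegers.coe_injective
    rw [← hη] at hgL
    exact (map_sextic_one (algebraMap (𝓞 L) L) η).trans hgL
  obtain ⟨s, hs⟩ : ∃ s, s = η ^ 5 + 2 * η ^ 4 + 3 * η ^ 3 + 3 * η ^ 2 + 3 * η + 1 := ⟨_, rfl⟩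
  have hs2 : s ^ 2 = -1 := by
    rw [hs]
    linear_combination (2 + 2 * η + 3 * η ^ 2 + 2 * η ^ 3 + η ^ 4) * hg
  have hP : η ^ 3 + η ^ 2 + (1 + s) * η + 1 = 0 := by
    rw [hs]
    linear_combination hg
  obtain ⟨k1, k2, k3, k4, k5, k6, k7, k8, k9, k10⟩ := isDescentField_one_aux hs2 hP
  have hr : InfinitePlace.nrRealPlaces L = 0 := by
    refine nrRealPlaces_eq_zero_of_sq (s := (s : L)) (m := 1) one_pos ?_
    have := congrArg (algebraMap (𝓞 L) L) hs2
    simpa using this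
  have hsu : IsUnit s := IsUnit.of_mul_eq_one (-s) (by linear_combination -hs2)
  have hηu : IsUnit η := IsUnit.of_mul_eq_one _ k1
  have hρ : Algebra.norm ℤ (η ^ 2 - η + 1) = 13 := by
    refine norm_eq_of_prod_embeddings ?_
    obtain ⟨w, hw⟩ := IsAlgClosed.exists_aeval_eq_zero ℂ (X ^ 2 + X + 1 : ℂ[X])
      (by rw [show (X ^ 2 + X + 1 : ℂ[X]).degree = 2 by compute_degree!]; norm_num)
    simp only [map_add, map_pow, aeval_X, map_one] at hw
    calc ∏ σ : L →ₐ[ℚ] ℂ, σ ((η ^ 2 - η + 1 : 𝓞 L) : L) =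
        ∏ σ : L →ₐ[ℚ] ℂ, ((-w - σ pb.gen) * (1 + w - σ pb.gen)) := by
          refine Finset.prod_congr rfl fun σ _ => ?_
          simp only [map_add, map_sub, map_pow, map_one, hη]
          linear_combination hw
      _ = ((13 : ℤ) : ℂ) := by
          rw [Finset.prod_mul_distrib, prod_sub_embeddings, prod_sub_embeddings, hmin,
            aeval_sexticPoly, aeval_sexticPoly]
          simp
          linear_combination (4 + 12 * w + 21 * w ^ 2 + 17 * w ^ 3 + 5 * w ^ 4 - 6 * w ^ 5 - 2 * w ^ 6 +
            6 * w ^ 7 + 9 * w ^ 8 + 5 * w ^ 9 + w ^ 10) * hw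
  have hε : (Algebra.norm ℤ (1 + s)).natAbs = 8 := by
    have h : (1 + s) ^ 2 = 2 * s := by linear_combination hs2
    have h' := congrArg (fun x => (Algebra.norm ℤ x).natAbs) h
    simp only [map_pow, map_mul, Int.natAbs_pow, Int.natAbs_mul, natAbs_norm_two hL,
      natAbs_norm_of_isUnit hsu] at h'
    exact Nat.pow_left_injective (two_ne_zero) h'
  have hU : IsTwoUniformizer (1 + s) η := by
    refine ⟨⟨1 - s, by linear_combination hs2⟩, ⟨s, by linear_combination hs2⟩, ⟨-η, k10⟩, fun h => ?_⟩
    have := natAbs_norm_of_isUnit h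
    omega
  have hpid : IsPrincipalIdealRing (𝓞 L) := by
    refine isPrincipalIdealRing_of_abs_norm_le pb hintegral hL hr (d := 104) (N := 3) (by norm_num) ?_
      (by norm_num) fun I hI hI0 hIN => isPrincipal_of_absNorm_le_three hg hI hI0 hIN
    have hder : aeval pb.gen (derivative (minpoly ℚ pb.gen)) =
        ((2 * (η ^ 2 - η + 1) ^ 2 * (-s * η * ((1 + 2 * s) * η + 2 * s * η ^ 2)) : 𝓞 L) : L) := by
      rw [← k6, hmin, sexticPoly, ← hη]
      refine Eq.trans ?_ (map_quintic_one (algebraMap (𝓞 L) L) η).symm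
      simp
      ring
    have h' : (Algebra.norm ℤ (2 * (η ^ 2 - η + 1) ^ 2 *
        (-s * η * ((1 + 2 * s) * η + 2 * s * η ^ 2)))).natAbs = 10816 := by
      have hu : IsUnit (-s * η * ((1 + 2 * s) * η + 2 * s * η ^ 2)) :=
        (hsu.neg.mul hηu).mul (IsUnit.of_mul_eq_one _ k5)
      rw [map_mul, Int.natAbs_mul, natAbs_norm_of_isUnit hu, map_mul, Int.natAbs_mul,
        natAbs_norm_two hL, map_pow, hρ]
      norm_num
    rw [hder, ← Algebra.coe_norm_int, ← Int.cast_abs, Int.abs_eq_natAbs, h']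
    norm_num
  refine ⟨η, s, 1 + s, η ^ 2 - η + 1, one_pos, hL, by simpa using hs2, k3, ?_, ?_, hpid, hU, hε,
    hsu.dvd, ?_, ?_, ?_⟩
  · intro e he
    have he' := eq_zero_of_sum_pow_eq_zero (η := (η : L)) (c₀ := e 0 - e 3 - e 4 - e 5 + 4 * e 6)
      (c₁ := -2 * e 3 - 2 * e 5 + 8 * e 6) (c₂ := e 1 - 4 * e 3 - e 4 - 5 * e 5 + 15 * e 6)
      (c₃ := -4 * e 3 + 2 * e 4 - 4 * e 5 + 14 * e 6) (c₄ := e 2 - 3 * e 3 + e 4 - 4 * e 5 + 7 * e 6)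
      (c₅ := -2 * e 3 + 4 * e 6) (by rw [hη, hmin, sexticPoly_natDegree]) (by
        rw [Fin.sum_univ_seven] at he
        change algebraMap ℚ L (e 0) * ((η : L) ^ 2) ^ 0 + algebraMap ℚ L (e 1) * ((η : L) ^ 2) ^ 1 +
          algebraMap ℚ L (e 2) * ((η : L) ^ 2) ^ 2 + algebraMap ℚ L (e 3) * ((η : L) ^ 2) ^ 3 +
          algebraMap ℚ L (e 4) * ((η : L) ^ 2) ^ 4 + algebraMap ℚ L (e 5) * ((η : L) ^ 2) ^ 5 +
          algebraMap ℚ L (e 6) * ((η : L) ^ 2) ^ 6 = 0 at he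
        simp only [map_add, map_sub, map_mul, map_neg, map_ofNat]
        rw [← hη] at hgL
        generalize algebraMap ℚ L = f at *
        generalize (η : L) = y at *
        linear_combination he - (f (e 3) + f (e 4) * (1 - 2 * y + y ^ 2) + f (e 5) * (1 + y ^ 2 -
          2 * y ^ 3 + y ^ 4) + f (e 6) * (-4 + y ^ 2 + y ^ 4 - 2 * y ^ 5 + y ^ 6)) * hgL)
    refine ⟨e 6, fun i => ?_⟩
    obtain ⟨e0, e1, e2, e3, e4, e5⟩ := he'
    fin_cases i <;> simp [sexticCoeff] <;> linarith
  · intro p q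
    have := prod_embeddings_sq pb hL (m := 1) (fun w => by
      rw [hmin, aeval_sexticPoly, aeval_sexticPoly]
      simp [sexticForm, hForm, bForm]
      ring) p q
    simpa [hη] using this
  · rw [hρ]; norm_num
  · refine ⟨(η ^ 2 - η + 1) * (-s - (1 + s) * η - η ^ 2), ?_⟩
    linear_combination (-(η ^ 2 - η + 1) ^ 2) * k4
  · refine hU.unit_eq_sq hε ⟨-s, by linear_combination (2 + s) * hs2⟩ (units_rank_eq_two hL hr)
      ![hsu.unit, hηu.unit, (IsUnit.of_mul_eq_one _ k2).unit] ![![1, 0, 0], ![1, 1, 0], ![1, 0, 1]]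
      ?_ ?_
    · intro i
      fin_cases i
      · exact ⟨-1 - s, by simpa [quadForm] using k9⟩
      · exact ⟨-1 - (1 + s) * η + η ^ 2, by simpa [quadForm] using k7⟩
      · exact ⟨-2 * s - 2 * s * η - (1 + 2 * s) * η ^ 2, by simpa [quadForm] using k8⟩
    · intro n hn h
      exfalso
      revert n
      decide

end

section

open NumberField Polynomial

theorem map_sextic_two {R S : Type*} [CommRing R] [CommRing S] (f : R →+* S) (x : R) :
    f (x ^ 6 + 2 * x ^ 5 + 3 * x ^ 4 + 2 * x ^ 3 + 2 * x ^ 2 + 1) =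
      f x ^ 6 + 2 * f x ^ 5 + 3 * f x ^ 4 + 2 * f x ^ 3 + 2 * f x ^ 2 + 1 := by
  simp only [map_add, map_mul, map_pow, map_one, map_ofNat f 2, map_ofNat f 3]

theorem map_quintic_two {R S : Type*} [CommRing R] [CommRing S] (f : R →+* S) (x : R) :
    f (6 * x ^ 5 + 10 * x ^ 4 + 12 * x ^ 3 + 6 * x ^ 2 + 4 * x) =
      6 * f x ^ 5 + 10 * f x ^ 4 + 12 * f x ^ 3 + 6 * f x ^ 2 + 4 * f x := by
  simp only [map_add, map_mul, map_pow, map_ofNat f 6, map_ofNat f 10, map_ofNat f 12, map_ofNat f 4]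

/-- `-1` is not a square modulo an ideal of norm three. -/
theorem mul_self_ne_neg_one_of_absNorm {L : Type*} [Field L] [NumberField L] {I : Ideal (𝓞 L)}
    (hI : Ideal.absNorm I = 3) {v : 𝓞 L} : v * v ≠ -1 := by
  intro hv
  have hprime : I.IsPrime :=
    Ideal.isPrime_of_irreducible_absNorm (by rw [hI]; exact Nat.prime_three)
  have hmem := pow_absNorm_sub_mem (fun h => by simp [h] at hI) v (I := I)
  have h3 := Ideal.absNorm_mem I
  rw [hI] at hmem h3
  push_cast at h3
  refine hprime.ne_top ((Ideal.eq_top_iff_one _).2 ?_)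
  have hone : (1 : 𝓞 L) = 3 * 1 - v * (v ^ 3 - v) := by
    linear_combination (v ^ 2 - 2) * hv
  rw [hone]
  exact I.sub_mem (I.mul_mem_right _ h3) (I.mul_mem_left _ hmem)

theorem isPrincipal_of_absNorm_le_six {L : Type*} [Field L] [NumberField L] {η : 𝓞 L}
    (hg : η ^ 6 + 2 * η ^ 5 + 3 * η ^ 4 + 2 * η ^ 3 + 2 * η ^ 2 + 1 = 0)
    (hρ : Algebra.norm ℤ (η + 1) = 3) {I : Ideal (𝓞 L)} (hI : I.IsPrime) (hI0 : I ≠ ⊥)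
    (hN : Ideal.absNorm I ≤ 6) : I.IsPrincipal := by
  have hmem := Ideal.absNorm_mem I
  have h0 : Ideal.absNorm I ≠ 0 := fun h => hI0 (Ideal.absNorm_eq_zero_iff.1 h)
  have h1 : Ideal.absNorm I ≠ 1 := fun h => hI.ne_top (Ideal.absNorm_eq_one_iff.1 h)
  obtain h2 | h3 | h4 | h5 | h6 : Ideal.absNorm I = 2 ∨ Ideal.absNorm I = 3 ∨ Ideal.absNorm I = 4 ∨
    Ideal.absNorm I = 5 ∨ Ideal.absNorm I = 6 := by omega
  · exfalso
    rw [h2] at hmem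
    refine hI.absNorm_ne_of_eq hI0 hmem (η := η) (a := η ^ 3 + η ^ 4)
      (c := η ^ 2 + η ^ 3 + η ^ 4 + η ^ 5 + η ^ 6) ?_ h2
    push_cast
    linear_combination -hg
  · have hspan : Ideal.absNorm (Ideal.span {η + 1}) = 3 := by
      rw [Ideal.absNorm_span_singleton, hρ]; rfl
    have hprime : (Ideal.span {η + 1}).IsPrime :=
      Ideal.isPrime_of_irreducible_absNorm (by rw [hspan]; exact Nat.prime_three)
    have hmax := hprime.isMaximal fun h => by simp [h] at hspan
    have hle : Ideal.span {η + 1} ≤ I := by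
      rw [Ideal.span_singleton_le_iff_mem]
      have hpow := pow_absNorm_sub_mem hI0 η
      rw [h3] at hpow hmem
      have heq : η + 1 = (-1 - η + η ^ 2 - η ^ 3) * (η ^ 3 - η) - ((3 : ℕ) : 𝓞 L) *
          (η ^ 2 + η ^ 4 + η ^ 5) := by
        push_cast
        linear_combination hg
      rw [heq]
      exact I.sub_mem (I.mul_mem_left _ hpow) (I.mul_mem_right _ hmem)
    rw [← hmax.eq_of_le hI.ne_top hle]
    exact ⟨⟨_, rfl⟩⟩
  · exfalso
    have h2 : (2 : 𝓞 L) ∈ I := by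
      rw [h4, show ((4 : ℕ) : 𝓞 L) = 2 * 2 by push_cast; ring] at hmem
      exact (hI.mem_or_mem hmem).elim id id
    refine hI.absNorm_ne_of_eq hI0 h2 (η := η) (a := η + η ^ 2 + η ^ 3 + η ^ 4 + η ^ 5)
      (c := η ^ 2 + η ^ 3 + 2 * η ^ 4 + 3 * η ^ 5 + 3 * η ^ 6 + 3 * η ^ 7 + 2 * η ^ 8 + η ^ 9) ?_ h4
    linear_combination (-(1 + η ^ 2 + η ^ 3)) * hg
  · exfalso
    rw [h5] at hmem
    refine hI.absNorm_ne_of_eq hI0 hmem (η := η) (a := 1 + η + 2 * η ^ 3 + η ^ 4 + η ^ 5)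
      (c := η ^ 3 + η ^ 5) ?_ h5
    push_cast
    linear_combination (-(1 + η - η ^ 2 + η ^ 3 - η ^ 4)) * hg
  · exfalso
    rw [h6, show ((6 : ℕ) : 𝓞 L) = 2 * 3 by push_cast; ring] at hmem
    rcases hI.mem_or_mem hmem with h2 | h3
    · refine hI.absNorm_ne_of_eq hI0 h2 (η := η) (a := η + η ^ 2 + η ^ 3)
        (c := η ^ 2 + η ^ 3 + 2 * η ^ 4 + 3 * η ^ 5 + 3 * η ^ 6 + 3 * η ^ 7 + 2 * η ^ 8 + η ^ 9) ?_ h6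
      linear_combination (-(1 + η ^ 2 + η ^ 3)) * hg
    · refine hI.absNorm_ne_of_eq hI0 h3 (η := η) (a := 1 - η ^ 3 + η ^ 4 + η ^ 5)
        (c := η ^ 2 + η ^ 3 + 3 * η ^ 4 + η ^ 5 + 2 * η ^ 6 - η ^ 9) ?_ h6
      linear_combination (-(1 + η + η ^ 2 - η ^ 3 + η ^ 4 - η ^ 5)) * hg

theorem exists_isDescentField_two_of_minpoly {L : Type*} [Field L] [NumberField L]
    (pb : PowerBasis ℚ L) (hmin : minpoly ℚ pb.gen = sexticPoly (1 : ℚ) 0 2 2 3 2) :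
    ∃ η s ε ρ : 𝓞 L, IsDescentField L 2 η s ε ρ := by
  have hL : Module.finrank ℚ L = 6 := by
    rw [pb.finrank, ← pb.natDegree_minpoly, hmin, sexticPoly_natDegree]
  have hintegral : IsIntegral ℤ pb.gen :=
    isIntegral_of_minpoly_eq (a₀ := 1) (a₁ := 0) (a₂ := 2) (a₃ := 2) (a₄ := 3) (a₅ := 2)
      (by simpa using hmin)
  obtain ⟨η, hη⟩ : ∃ η : 𝓞 L, (η : L) = pb.gen := ⟨⟨pb.gen, hintegral⟩, rfl⟩
  have hgL : pb.gen ^ 6 + 2 * pb.gen ^ 5 + 3 * pb.gen ^ 4 + 2 * pb.gen ^ 3 + 2 * pb.gen ^ 2 + 1 =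
      0 := by
    have h0 := minpoly.aeval ℚ pb.gen
    rw [hmin, aeval_sexticPoly] at h0
    simpa using h0
  have hg : η ^ 6 + 2 * η ^ 5 + 3 * η ^ 4 + 2 * η ^ 3 + 2 * η ^ 2 + 1 = 0 := by
    apply RingOfIntegers.coe_injective
    rw [← hη] at hgL
    exact (map_sextic_two (algebraMap (𝓞 L) L) η).trans hgL
  obtain ⟨s, hs⟩ : ∃ s, s = -η ^ 4 - 2 * η ^ 3 - 3 * η ^ 2 - η - 1 := ⟨_, rfl⟩
  have hs2 : s ^ 2 = -2 := by
    rw [hs]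
    linear_combination (3 + 2 * η + η ^ 2) * hg
  have hP : η ^ 3 + (1 - s) * η ^ 2 + 1 = 0 := by
    rw [hs]
    linear_combination hg
  obtain ⟨k1, k2, k3, k4, k5, k6, k7, k8, k9, k10⟩ := isDescentField_two_aux hs2 hP
  have hr : InfinitePlace.nrRealPlaces L = 0 := by
    refine nrRealPlaces_eq_zero_of_sq (s := (s : L)) (m := 2) two_pos ?_
    have := congrArg (algebraMap (𝓞 L) L) hs2
    rw [map_pow, map_neg] at this
    exact this.trans (congrArg Neg.neg (map_ofNat (algebraMap (𝓞 L) L) 2))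
  have hηu : IsUnit η := IsUnit.of_mul_eq_one _ k1
  have hρ : Algebra.norm ℤ (η + 1) = 3 := by
    refine norm_eq_of_prod_embeddings ?_
    have hcard : Fintype.card (L →ₐ[ℚ] ℂ) = 6 := by rw [AlgHom.card, hL]
    calc ∏ σ : L →ₐ[ℚ] ℂ, σ ((η + 1 : 𝓞 L) : L) = ∏ σ : L →ₐ[ℚ] ℂ, (-1 * (-1 - σ pb.gen)) := by
          refine Finset.prod_congr rfl fun σ _ => ?_
          simp only [map_add, map_one, hη]
          ring
      _ = ((3 : ℤ) : ℂ) := by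
          rw [Finset.prod_mul_distrib, prod_sub_embeddings, hmin, aeval_sexticPoly, Finset.prod_const,
            Finset.card_univ, hcard]
          simp
          norm_num
  have hε : (Algebra.norm ℤ s).natAbs = 8 := by
    have h' := congrArg (fun x => (Algebra.norm ℤ x).natAbs) hs2
    rw [neg_eq_neg_one_mul] at h'
    simp only [map_pow, map_mul, Int.natAbs_pow, Int.natAbs_mul, natAbs_norm_two hL,
      natAbs_norm_of_isUnit isUnit_one.neg] at h'
    exact Nat.pow_left_injective (two_ne_zero) h'
  have hU : IsTwoUniformizer s η := by
    refine ⟨⟨-s, by linear_combination hs2⟩, ⟨-1, by linear_combination hs2⟩, ⟨η ^ 2, k10⟩,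
      fun h => ?_⟩
    have := natAbs_norm_of_isUnit h
    omega
  have hpid : IsPrincipalIdealRing (𝓞 L) := by
    refine isPrincipalIdealRing_of_abs_norm_le pb hintegral hL hr (d := 204) (N := 6) (by norm_num) ?_
      (by norm_num) fun I hI hI0 hIN => isPrincipal_of_absNorm_le_six hg hρ hI hI0 hIN
    have hder : aeval pb.gen (derivative (minpoly ℚ pb.gen)) =
        ((2 * s * (η + 1) ^ 4 * (η ^ 2 * (1 + η ^ 2)) : 𝓞 L) : L) := by
      rw [← k7, hmin, sexticPoly, ← hη]
      refine Eq.trans ?_ (map_quintic_two (algebraMap (𝓞 L) L) η).symm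
      simp
      ring
    have h' : (Algebra.norm ℤ (2 * s * (η + 1) ^ 4 * (η ^ 2 * (1 + η ^ 2)))).natAbs = 41472 := by
      have hu : IsUnit (η ^ 2 * (1 + η ^ 2)) := (hηu.pow 2).mul (IsUnit.of_mul_eq_one _ k6)
      rw [map_mul, Int.natAbs_mul, natAbs_norm_of_isUnit hu, map_mul, Int.natAbs_mul, map_mul,
        Int.natAbs_mul, natAbs_norm_two hL, hε, map_pow, hρ]
      norm_num
    rw [hder, ← Algebra.coe_norm_int, ← Int.cast_abs, Int.abs_eq_natAbs, h']
    norm_num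
  refine ⟨η, s, s, η + 1, two_pos, hL, by simpa using hs2, k3, ?_, ?_, hpid, hU, hε,
    hU.dvd_two, ?_, ?_, ?_⟩
  · intro e he
    have he' := eq_zero_of_sum_pow_eq_zero (η := (η : L)) (c₀ := e 0 - e 3 - e 4 + 5 * e 5 + 4 * e 6)
      (c₁ := 2 * e 4 - 2 * e 5 - 6 * e 6) (c₂ := e 1 - 2 * e 3 - 3 * e 4 + 9 * e 5 + 13 * e 6)
      (c₃ := -2 * e 3 + 2 * e 4 + 8 * e 5 - 6 * e 6) (c₄ := e 2 - 3 * e 3 - e 4 + 8 * e 5 + 9 * e 6)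
      (c₅ := -2 * e 3 + 2 * e 4 + 6 * e 5 - 2 * e 6) (by rw [hη, hmin, sexticPoly_natDegree]) (by
        rw [Fin.sum_univ_seven] at he
        change algebraMap ℚ L (e 0) * ((η : L) ^ 2) ^ 0 + algebraMap ℚ L (e 1) * ((η : L) ^ 2) ^ 1 +
          algebraMap ℚ L (e 2) * ((η : L) ^ 2) ^ 2 + algebraMap ℚ L (e 3) * ((η : L) ^ 2) ^ 3 +
          algebraMap ℚ L (e 4) * ((η : L) ^ 2) ^ 4 + algebraMap ℚ L (e 5) * ((η : L) ^ 2) ^ 5 +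
          algebraMap ℚ L (e 6) * ((η : L) ^ 2) ^ 6 = 0 at he
        simp only [map_add, map_sub, map_mul, map_neg, map_ofNat]
        rw [← hη] at hgL
        generalize algebraMap ℚ L = f at *
        generalize (η : L) = y at *
        linear_combination he - (f (e 3) + f (e 4) * (1 - 2 * y + y ^ 2) + f (e 5) * (-5 + 2 * y +
          y ^ 2 - 2 * y ^ 3 + y ^ 4) + f (e 6) * (-4 + 6 * y - 5 * y ^ 2 + 2 * y ^ 3 + y ^ 4 -
          2 * y ^ 5 + y ^ 6)) * hgL)
    refine ⟨e 6, fun i => ?_⟩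
    obtain ⟨e0, e1, e2, e3, e4, e5⟩ := he'
    fin_cases i <;> simp [sexticCoeff] <;> linarith
  · intro p q
    have := prod_embeddings_sq pb hL (m := 2) (fun w => by
      rw [hmin, aeval_sexticPoly, aeval_sexticPoly]
      simp [sexticForm, hForm, bForm]
      ring) p q
    simpa [hη] using this
  · rw [hρ]; norm_num
  · refine ⟨2 + 2 * η + η ^ 2, ?_⟩
    linear_combination (-(2 + 2 * η + η ^ 2)) * k4 - (η + 1) ^ 2 * k5
  · refine hU.unit_eq_sq hε ⟨-1, by linear_combination hs2⟩ (units_rank_eq_two hL hr)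
      ![-1, hηu.unit, (IsUnit.of_mul_eq_one _ k2).unit] ![![0, 0, 0], ![0, 1, 1], ![1, 1, 0]]
      ?_ ?_
    · intro i
      fin_cases i
      · exact ⟨-1, by simp [quadForm]; ring⟩
      · exact ⟨2 - s - (2 + s) * η + (1 - 3 * s) * η ^ 2, by simpa [quadForm] using k8⟩
      · exact ⟨2 + s + (1 - 3 * s) * η + (3 - 2 * s) * η ^ 2, by simpa [quadForm] using k9⟩
    · intro n hn h
      have hn' : n = ![1, 0, 0] := by
        revert n
        decide
      refine ⟨by simp [hn', Fin.prod_univ_three], ?_⟩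
      rintro ⟨v, hv⟩
      refine mul_self_ne_neg_one_of_absNorm (I := Ideal.span {η + 1}) ?_ (v := (v : 𝓞 L)) ?_
      · rw [Ideal.absNorm_span_singleton, hρ]; rfl
      · rw [← Units.val_mul, ← hv]; simp

end

section

open NumberField

theorem exists_numberField_of_irreducible {f : Polynomial ℚ} (hf : Irreducible f) (hm : f.Monic) :
    ∃ (L : Type) (_ : Field L) (_ : NumberField L) (pb : PowerBasis ℚ L), minpoly ℚ pb.gen = f := by
  have := Fact.mk hf
  have : FiniteDimensional ℚ (AdjoinRoot f) :=
    (AdjoinRoot.powerBasis hf.ne_zero).finite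
  refine ⟨AdjoinRoot f, inferInstance, ⟨⟩, AdjoinRoot.powerBasis hf.ne_zero, ?_⟩
  exact AdjoinRoot.minpoly_powerBasis_gen_of_monic hm

/-- Every primitive descent form is a torsion form. -/
theorem IsDescentForm.exists_torsionForm {m : ℤ} (hm : m = 1 ∨ m = 2) {A : Fin 3 → ℤ}
    (hA : IsPrimitiveForm A) (hA' : IsDescentForm m A) :
    ∃ T ∈ torsionForms, ∀ i j, A i * T j = A j * T i := by
  rcases hm with rfl | rfl
  · obtain ⟨L, _, _, pb, hmin⟩ :=
      exists_numberField_of_irreducible irreducible_sexticPoly_of_one (sexticPoly_monic ..)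
    obtain ⟨η, s, ε, ρ, h⟩ := exists_isDescentField_one_of_minpoly pb hmin
    exact h.exists_torsionForm (Or.inl rfl) hA hA'
  · obtain ⟨L, _, _, pb, hmin⟩ :=
      exists_numberField_of_irreducible irreducible_sexticPoly_of_two (sexticPoly_monic ..)
    obtain ⟨η, s, ε, ρ, h⟩ := exists_isDescentField_two_of_minpoly pb hmin
    exact h.exists_torsionForm (Or.inr rfl) hA hA'

end

theorem descentDefect_eq_zero_of_eval_one {α β κ : ℤ} {A : Fin 3 → ℤ} {Q : Fin 5 → ℤ}
    {M : Fin 4 → ℤ} (h : ∀ x : ℤ, quadForm A x 1 * quarForm Q x 1 =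
      α * cubForm M x 1 ^ 2 + κ * (hForm x 1 * cubForm M x 1) - β * κ ^ 2 * bForm x 1 ^ 2) :
    descentDefect α β κ A Q M = 0 := by
  have := sextic_coeff_eq_zero (e₀ := descentDefect α β κ A Q M 0)
    (e₁ := descentDefect α β κ A Q M 1) (e₂ := descentDefect α β κ A Q M 2)
    (e₃ := descentDefect α β κ A Q M 3) (e₄ := descentDefect α β κ A Q M 4)
    (e₅ := descentDefect α β κ A Q M 5) (e₆ := descentDefect α β κ A Q M 6) (fun x => by
      have := h x
      simp only [quadForm, cubForm, hForm, bForm, quarForm] at this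
      simp [descentDefect]
      linear_combination this)
  ext i
  fin_cases i <;> simp_all

theorem exists_linForm_mod_two : ∀ a₀ a₂ c₀ c₁ c₂ c₃ c₄ b₀ b₁ b₂ b₃ : ZMod 2,
    descentDefect 1 0 0 ![a₀, 1, a₂] ![c₀, c₁, c₂, c₃, c₄] ![b₀, b₁, b₂, b₃] = 0 →
      ∃ l₀ l₁ : ZMod 2, b₀ = a₀ * l₀ ∧ b₁ = a₀ * l₁ + l₀ ∧ b₂ = l₁ + a₂ * l₀ ∧ b₃ = a₂ * l₁ := by
  decide +kernel

/-- A form with odd middle coefficient is squarefree modulo two, so a relation with even parameter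
can be divided by two. -/
theorem exists_descent_half {m k : ℤ} {A : Fin 3 → ℤ} (hA : IsPrimitiveForm A) (hA1 : Odd (A 1))
    {B : Fin 4 → ℤ} {C : Fin 5 → ℤ} (h : descentDefect 1 m (2 * k) A C B = 0) :
    ∃ (B' : Fin 4 → ℤ) (C' : Fin 5 → ℤ), descentDefect 1 m k A C' B' = 0 := by
  have h1 := intCast_zmod_two_of_odd hA1
  have two : (2 : ZMod 2) = 0 := rfl
  have hmod : descentDefect 1 0 0 ![(A 0 : ZMod 2), 1, A 2]
      ![(C 0 : ZMod 2), C 1, C 2, C 3, C 4] ![(B 0 : ZMod 2), B 1, B 2, B 3] = 0 := by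
    ext i
    have h2 := map_descentDefect (Int.castRingHom (ZMod 2)) 1 m (2 * k) A C B i
    rw [h] at h2
    simp only [Int.coe_castRingHom, Int.cast_mul, Int.cast_ofNat, two, zero_mul] at h2
    fin_cases i <;> simpa [descentDefect, h1, two] using h2.symm
  obtain ⟨l₀, l₁, e0, e1, e2, e3⟩ := exists_linForm_mod_two _ _ _ _ _ _ _ _ _ _ _ hmod
  obtain ⟨l₀, rfl⟩ := ZMod.intCast_surjective l₀
  obtain ⟨l₁, rfl⟩ := ZMod.intCast_surjective l₁
  have lift : ∀ x y : ℤ, (x : ZMod 2) = y → ∃ w, x = y + (2 : ℕ) * w := fun x y hxy => by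
    obtain ⟨w, hw⟩ := (ZMod.intCast_eq_intCast_iff_dvd_sub y x 2).1 hxy.symm
    exact ⟨w, by linear_combination hw⟩
  obtain ⟨w0, h0'⟩ := lift (B 0) (A 0 * l₀) (by push_cast; exact e0)
  obtain ⟨w1, h1'⟩ := lift (B 1) (A 0 * l₁ + A 1 * l₀) (by push_cast; rw [h1, one_mul]; exact e1)
  obtain ⟨w2, h2'⟩ := lift (B 2) (A 1 * l₁ + A 2 * l₀) (by push_cast; rw [h1, one_mul]; exact e2)
  obtain ⟨w3, h3'⟩ := lift (B 3) (A 2 * l₁) (by push_cast; exact e3)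
  exact ⟨![w0, w1, w2, w3], exists_descent_of_prime_dvd hA Nat.prime_two (l := ![l₀, l₁])
    (by simpa using h) (by simpa using h0') (by simpa using h1') (by simpa using h2')
    (by simpa using h3')⟩

theorem isDescentForm_of_odd {m k : ℤ} {A : Fin 3 → ℤ} (hA : IsPrimitiveForm A)
    (hA1 : Odd (A 1)) (hk : k ≠ 0) {B : Fin 4 → ℤ} {C : Fin 5 → ℤ}
    (h : descentDefect 1 m k A C B = 0) : IsDescentForm m A := by
  obtain ⟨n, g, hg, i, hi⟩ := exists_two_pow_mul_odd (f := fun _ : Unit => k) ⟨(), hk⟩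
  have hk' : k = 2 ^ n * g () := hg ()
  have hodd : Odd (g ()) := hi
  clear hg hi hk
  induction n generalizing k B C with
  | zero => exact ⟨B, C, k, by simpa [hk'] using hodd, h⟩
  | succ n ih =>
    have : k = 2 * (2 ^ n * g ()) := by rw [hk']; ring
    rw [this] at h
    obtain ⟨B', C', h'⟩ := exists_descent_half hA hA1 h
    exact ih h' rfl

open Polynomial in
theorem dvd_of_aeval_eq_zero {K : Type*} [Field K] [CharZero K] {t : K} {a p : ℤ[X]}
    (ha : a.IsPrimitive) (hdeg : a.natDegree ≤ (minpoly ℚ t).natDegree) (hat : aeval t a = 0)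
    (hpt : aeval t p = 0) : a ∣ p := by
  have hinj : Function.Injective (Int.castRingHom ℚ) := Int.cast_injective
  have ha0 : a.map (Int.castRingHom ℚ) ≠ 0 := (Polynomial.map_ne_zero_iff hinj).2 ha.ne_zero
  have hat' : aeval t (a.map (Int.castRingHom ℚ)) = 0 := by
    rw [← hat]; exact aeval_map_algebraMap ℚ t a
  have hpt' : aeval t (p.map (Int.castRingHom ℚ)) = 0 := by
    rw [← hpt]; exact aeval_map_algebraMap ℚ t p
  have hintegral : IsIntegral ℚ t := isAlgebraic_iff_isIntegral.1 ⟨_, ha0, hat'⟩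
  obtain ⟨u, hu⟩ := minpoly.dvd ℚ t hat'
  have hu0 : u ≠ 0 := by rintro rfl; simp [hu] at ha0
  have hudeg : u.natDegree = 0 := by
    have h1 := natDegree_mul (minpoly.ne_zero hintegral) hu0
    rw [← hu, natDegree_map_eq_of_injective hinj] at h1
    omega
  have huu : IsUnit u := by
    rw [natDegree_eq_zero] at hudeg
    obtain ⟨x, rfl⟩ := hudeg
    exact isUnit_C.2 (isUnit_iff_ne_zero.2 (by rintro rfl; simp at hu0))
  have hdvd : a.map (Int.castRingHom ℚ) ∣ p.map (Int.castRingHom ℚ) := by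
    rw [hu, huu.mul_right_dvd]
    exact minpoly.dvd ℚ t hpt'
  exact (IsPrimitive.Int.dvd_iff_map_cast_dvd_map_cast _ _ ha).2 hdvd

section

open Polynomial

/-- A quadratic form with root `t` divides every polynomial of degree at most six vanishing
at `t`. -/
theorem exists_quar_of_root {K : Type*} [Field K] [CharZero K] {t : K} {A : Fin 3 → ℤ}
    (hA : IsPrimitiveForm A) (ht : 2 ≤ (minpoly ℚ t).natDegree)
    (hAt : quadForm (fun i => (A i : K)) t 1 = 0) {p : ℤ[X]} (hp : p.natDegree ≤ 6)
    (hpt : aeval t p = 0) :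
    ∃ C : Fin 5 → ℤ, (∀ x, p.eval x = quadForm A x 1 * quarForm C x 1) ∧
      (p.natDegree ≤ 4 → C 3 = 0 ∧ C 4 = 0) := by
  set a : ℤ[X] := C (A 0) + C (A 1) * X + C (A 2) * X ^ 2 with ha
  have hadeg : a.natDegree ≤ 2 := by rw [ha]; compute_degree
  have hcoeff : a.coeff 0 = A 0 ∧ a.coeff 1 = A 1 ∧ a.coeff 2 = A 2 := by
    simp [ha, coeff_X, coeff_C, -eq_intCast]
  have hprim : a.IsPrimitive := fun r hr => hA r fun i => by
    rw [C_dvd_iff_dvd_coeff] at hr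
    fin_cases i
    · exact hcoeff.1 ▸ hr 0
    · exact hcoeff.2.1 ▸ hr 1
    · exact hcoeff.2.2 ▸ hr 2
  have hat : aeval t a = 0 := by
    simp only [quadForm] at hAt
    simp [ha]
    linear_combination hAt
  obtain ⟨q, rfl⟩ := dvd_of_aeval_eq_zero hprim (hadeg.trans ht) hat hpt
  have ha2 : 2 ≤ a.natDegree := by
    have hinj : Function.Injective (Int.castRingHom ℚ) := Int.cast_injective
    have := natDegree_le_of_dvd (minpoly.dvd ℚ t (p := a.map (Int.castRingHom ℚ))
      ((aeval_map_algebraMap ℚ t a).trans hat)) ((Polynomial.map_ne_zero_iff hinj).2 hprim.ne_zero)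
    rw [natDegree_map_eq_of_injective hinj] at this
    omega
  have hqdeg : q.natDegree + 2 ≤ (a * q).natDegree ∨ q = 0 := by
    by_cases hq : q = 0
    · exact Or.inr hq
    · rw [natDegree_mul hprim.ne_zero hq]; omega
  have hq4 : q.natDegree < 5 := by
    rcases hqdeg with h | rfl
    · omega
    · simp
  refine ⟨fun i => q.coeff i, fun x => ?_, fun h => ?_⟩
  · rw [eval_mul, eval_eq_sum_range' hq4]
    simp [ha, quadForm, quarForm, Finset.sum_range_succ]
  · have hq2 : q.natDegree < 3 := by
      rcases hqdeg with h | rfl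
      · omega
      · simp
    exact ⟨coeff_eq_zero_of_natDegree_lt hq2, coeff_eq_zero_of_natDegree_lt (by simp; omega)⟩

/-- The polynomial `x³ + x² - 2x - 1`. -/
noncomputable def hPoly : ℤ[X] := X ^ 3 + X ^ 2 - C 2 * X - C 1

/-- The polynomial `x² + x`. -/
noncomputable def bPoly : ℤ[X] := X ^ 2 + X

/-- A point of the curve over a quadratic field gives a relation on the minimal form of its
abscissa. -/
theorem exists_descentDefect_of_root {K : Type*} [Field K] [CharZero K] {t y : K} {m : ℤ}
    {A : Fin 3 → ℤ} (hA : IsPrimitiveForm A) (ht : 2 ≤ (minpoly ℚ t).natDegree)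
    (hAt : quadForm (fun i => (A i : K)) t 1 = 0) (hy : y ^ 2 = sexticForm (m : K) t 1)
    {d u v : ℤ} (hd : (d : K) * y = u + v * t) :
    ∃ (B : Fin 4 → ℤ) (Q : Fin 5 → ℤ), descentDefect 1 m (2 * d) A Q B = 0 := by
  obtain ⟨Q, hQ, -⟩ := exists_quar_of_root hA ht hAt
    (p := (C u + C v * X) ^ 2 - C (d ^ 2) * hPoly ^ 2 - C (4 * m * d ^ 2) * bPoly ^ 2)
    (by rw [hPoly, bPoly]; compute_degree) (by
      have h1 : ((u : K) + v * t) ^ 2 = d ^ 2 * y ^ 2 := by rw [← hd]; ring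
      simp [hPoly, bPoly, map_ofNat]
      rw [h1, hy, sexticForm, hForm, bForm]
      ring)
  refine ⟨![u + d, v + 2 * d, -d, -d], Q, descentDefect_eq_zero_of_eval_one fun x => ?_⟩
  rw [← hQ]
  simp [hPoly, bPoly, cubForm, hForm, bForm]
  ring

theorem false_of_isDescentForm {K : Type*} [Field K] [CharZero K] {t : K} {m : ℤ}
    (hm : m = 1 ∨ m = 2) {A : Fin 3 → ℤ} (hA : IsPrimitiveForm A) (hA' : IsDescentForm m A)
    (hAt : quadForm (fun i => (A i : K)) t 1 = 0) (h0 : t ≠ 0) (h1 : t + 1 ≠ 0)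
    (h3 : t ^ 2 + t + 1 ≠ 0) : False := by
  obtain ⟨T, hT, hAT⟩ := hA'.exists_torsionForm hm hA
  obtain ⟨i, hi⟩ := hA.exists_odd
  have hi0 : (A i : K) ≠ 0 := by
    exact_mod_cast (fun h => by simp [h] at hi : A i ≠ 0)
  have key : (A i : K) * quadForm (fun j => (T j : K)) t 1 = 0 := by
    have e := fun j => congrArg (Int.cast : ℤ → K) (hAT i j)
    push_cast at e
    simp only [quadForm] at hAt ⊢
    linear_combination (T i : K) * hAt + e 0 + t * e 1 + t ^ 2 * e 2
  have hTt := (mul_eq_zero.1 key).resolve_left hi0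
  simp only [torsionForms, List.mem_cons, List.not_mem_nil, or_false] at hT
  rcases hT with rfl | rfl | rfl | rfl | rfl | rfl | rfl <;> simp [quadForm] at hTt
  · exact h0 hTt
  · exact h1 (pow_eq_zero_iff two_ne_zero |>.1 (by linear_combination hTt))
  · exact (mul_ne_zero h0 h1) (by linear_combination hTt)
  · exact h0 hTt
  · exact h1 (by linear_combination hTt)
  · exact h3 (by linear_combination hTt)

end

section

open Polynomial

theorem false_of_even_even {K : Type*} [Field K] [CharZero K] {t y : K} {m : ℤ}
    (hm : m = 1 ∨ m = 2) {A : Fin 3 → ℤ} (hA : IsPrimitiveForm A)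
    (ht : 2 ≤ (minpoly ℚ t).natDegree) (hAt : quadForm (fun i => (A i : K)) t 1 = 0)
    (hy : y ^ 2 = sexticForm (m : K) t 1) (h0 : t ≠ 0) (h1 : t + 1 ≠ 0)
    (h3 : t ^ 2 + t + 1 ≠ 0) (hA0 : Even (A 0)) (hA1 : Even (A 1)) {α β κ : ℤ} (hκ : κ ≠ 0)
    (hodd : Odd α ∨ Odd β ∨ Odd κ)
    (hrel : κ * (y - hForm t 1) + 2 * ((t + 1) * (α * t + β)) = 0) : False := by
  obtain ⟨N, hN, hN'⟩ := exists_quar_of_root hA ht hAt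
    (p := (X + C 1) * (C α * X + C β) ^ 2 - C κ * hPoly * (C α * X + C β) -
      C (m * κ ^ 2) * (X ^ 3 + X ^ 2))
    ((by rw [hPoly]; compute_degree : _ ≤ 4).trans (by norm_num)) (by
      have h4 : (4 * (t + 1)) ≠ 0 := mul_ne_zero (by norm_num) h1
      refine (mul_eq_zero.1 (?_ : 4 * (t + 1) * _ = 0)).resolve_left h4
      simp [hPoly, map_ofNat, -mul_eq_zero]
      simp only [sexticForm, hForm, bForm] at hy hrel
      linear_combination (κ : K) ^ 2 * hy + (2 * ((t + 1) * (α * t + β)) -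
        κ * (y + (t ^ 3 + t ^ 2 - 2 * t - 1))) * hrel)
  obtain ⟨hN3, hN4⟩ := hN' (by rw [hPoly]; compute_degree)
  have hS : ∀ x : ℤ, quadForm A x 1 * (N 0 + N 1 * x + N 2 * x ^ 2) =
      (x + 1) * (α * x + β) ^ 2 - κ * hForm x 1 * (α * x + β) - m * κ ^ 2 * (x ^ 3 + x ^ 2) := by
    intro x
    have := hN x
    simp [hPoly, quarForm, hN3, hN4] at this
    rw [hForm]
    linear_combination -this
  clear hN hN'
  have hodd2 : Odd (A 2) := by
    obtain ⟨i, hi⟩ := hA.exists_odd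
    fin_cases i
    · exact absurd hA0 (Int.not_even_iff_odd.2 hi)
    · exact absurd hA1 (Int.not_even_iff_odd.2 hi)
    · exact hi
  by_cases hκ2 : Odd κ
  · refine false_of_isDescentForm hm hA ?_ hAt h0 h1 h3
    refine ⟨![β, α + β, α, 0], ![N 0, N 0 + N 1, N 1 + N 2, N 2, 0], -κ, hκ2.neg,
      descentDefect_eq_zero_of_eval_one fun x => ?_⟩
    have := hS x
    simp [quarForm, cubForm, hForm, bForm] at this ⊢
    linear_combination (x + 1) * this
  · rw [Int.not_odd_iff_even] at hκ2
    obtain ⟨c0, c1, c2, c3, c4, -, -⟩ := sextic_coeff_eq_zero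
      (e₀ := A 0 * N 0 - (β ^ 2 + κ * β))
      (e₁ := A 0 * N 1 + A 1 * N 0 - (β ^ 2 + 2 * α * β + κ * α + 2 * κ * β))
      (e₂ := A 0 * N 2 + A 1 * N 1 + A 2 * N 0 -
        (α ^ 2 + 2 * α * β - κ * (β - 2 * α) - m * κ ^ 2))
      (e₃ := A 1 * N 2 + A 2 * N 1 - (α ^ 2 - κ * (β + α) - m * κ ^ 2))
      (e₄ := A 2 * N 2 + κ * α) (e₅ := 0) (e₆ := 0) (fun x => by
        have := hS x
        simp only [quadForm, hForm] at this
        linear_combination this)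
    have hA2 : ¬Even (A 2) := Int.not_even_iff_odd.2 hodd2
    have hβ : Even β := by
      have := congrArg Even (sub_eq_zero.1 c0)
      simp [Int.even_add, hA0, hκ2, Int.even_pow] at this
      exact this
    have hα : Odd α := by
      rcases hodd with h | h | h
      · exact h
      · exact absurd hβ (Int.not_even_iff_odd.2 h)
      · exact absurd hκ2 (Int.not_even_iff_odd.2 h)
    have hα' : ¬Even α := Int.not_even_iff_odd.2 hα
    have hN1 : Odd (N 1) := by
      have := congrArg Even (sub_eq_zero.1 c3)
      simp [Int.even_add, Int.even_sub, Int.even_mul, hA1, hA2, hκ2, hα', Int.even_pow] at this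
      exact this
    have hN0 : Odd (N 0) := by
      have := congrArg Even (sub_eq_zero.1 c2)
      simp [Int.even_add, Int.even_sub, Int.even_mul, hA0, hA1, hA2, hκ2, hα', Int.even_pow] at this
      exact this
    have hN2 : Even (N 2) := by
      have := congrArg Even (eq_neg_of_add_eq_zero_left c4)
      simpa [Int.even_mul, hA2, hκ2] using this
    obtain ⟨g, N', hg, hprim, hgN⟩ := exists_isPrimitiveForm (N := ![N 0, N 1, N 2])
      (fun h => by
        have := congrFun h 0
        simp at this
        simp [this] at hN0)
    have e0 : N 0 = g * N' 0 := hgN 0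
    have e1 : N 1 = g * N' 1 := hgN 1
    have e2 : N 2 = g * N' 2 := hgN 2
    rw [e0, Int.odd_mul] at hN0
    rw [e1, Int.odd_mul] at hN1
    have hN2' : Even (N' 2) := by
      rw [e2, Int.even_mul] at hN2
      exact hN2.resolve_left (Int.not_even_iff_odd.2 hN0.1)
    have hgood : IsDescentForm m N' := by
      refine isDescentForm_of_odd hprim hN1.2 (neg_ne_zero.2 hκ) (B := ![β, α + β, α, 0])
        (C := ![g * A 0, g * (A 0 + A 1), g * (A 1 + A 2), g * A 2, 0])
        (descentDefect_eq_zero_of_eval_one fun x => ?_)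
      have := hS x
      rw [e0, e1, e2] at this
      simp [quarForm, quadForm, cubForm, hForm, bForm] at this ⊢
      linear_combination (x + 1) * this
    obtain ⟨T, hT, hNT⟩ := hgood.exists_torsionForm hm hprim
    have hN' : N' 0 = N' 1 ∧ N' 2 = 0 := by
      have t01 := hNT 0 1
      have t02 := hNT 0 2
      have t12 := hNT 1 2
      obtain ⟨a, ha⟩ := hN0.2
      obtain ⟨b, hb⟩ := hN1.2
      obtain ⟨c, hc⟩ := hN2'
      simp only [torsionForms, List.mem_cons, List.not_mem_nil, or_false] at hT
      rcases hT with rfl | rfl | rfl | rfl | rfl | rfl | rfl <;> simp at t01 t02 t12 <;> omega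
    have hS1 := hS (-1)
    rw [e0, e1, e2, ← hN'.1, hN'.2] at hS1
    have : κ * (β - α) = 0 := by
      simp [hForm] at hS1
      rcases hS1 with h | h
      · rw [h]; ring
      · exact mul_eq_zero_of_right _ (by linear_combination h)
    rcases mul_eq_zero.1 this with h | h
    · exact hκ h
    · exact hα' (by rw [← sub_eq_zero.1 h]; exact hβ)

end

section

open Polynomial

theorem exists_intCast_mul_eq_add_mul {K : Type*} [Field K] [NumberField K]
    (hdeg : Module.finrank ℚ K = 2) {t : K} (ht : t ∉ (algebraMap ℚ K).range) (w : K) :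
    ∃ d u v : ℤ, d ≠ 0 ∧ (d : K) * w = u + v * t := by
  have hli : LinearIndependent ℚ ![1, t] := by
    rw [LinearIndependent.pair_iff]
    intro a b hab
    have hb : b = 0 := by
      by_contra hb
      refine ht ⟨-a / b, ?_⟩
      have hb' : (b : K) ≠ 0 := by exact_mod_cast hb
      simp only [Algebra.smul_def, eq_ratCast] at hab
      simp only [eq_ratCast, Rat.cast_div, Rat.cast_neg]
      field_simp
      linear_combination -hab
    refine ⟨?_, hb⟩
    simpa [hb] using hab
  have hspan := hli.span_eq_top_of_card_eq_finrank' (by simp [hdeg])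
  have hw : w ∈ Submodule.span ℚ (Set.range ![1, t]) := hspan ▸ Submodule.mem_top
  rw [Matrix.range_cons, Matrix.range_cons, Matrix.range_empty, Set.union_empty,
    Set.singleton_union, Submodule.mem_span_pair] at hw
  obtain ⟨a, b, rfl⟩ := hw
  refine ⟨a.den * b.den, a.num * b.den, b.num * a.den, by simp, ?_⟩
  have ha : (a : K) * a.den = a.num := by exact_mod_cast Rat.mul_den_eq_num a
  have hb : (b : K) * b.den = b.num := by exact_mod_cast Rat.mul_den_eq_num b
  simp only [Algebra.smul_def, eq_ratCast]
  push_cast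
  linear_combination (b.den : K) * ha + (a.den : K) * t * hb

/-- `(t, y)` is an irrational point of `y² = h(t)² + 4mb(t)²` off the torsion forms, and `A` is the
primitive form of `t`. -/
structure IsCurvePoint {K : Type*} [Field K] [CharZero K] (m : ℤ) (t y : K) (A : Fin 3 → ℤ) :
    Prop where
  primitive : IsPrimitiveForm A
  irrational : t ∉ (algebraMap ℚ K).range
  root : quadForm (fun i => (A i : K)) t 1 = 0
  eq : y ^ 2 = sexticForm (m : K) t 1
  ne_zero : t ≠ 0
  ne_neg_one : t + 1 ≠ 0
  ne_omega : t ^ 2 + t + 1 ≠ 0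

theorem IsCurvePoint.rotate {K : Type*} [Field K] [CharZero K] {m : ℤ} {t y : K} {A : Fin 3 → ℤ}
    (h : IsCurvePoint m t y A) : IsCurvePoint m (-1 / (t + 1)) (y / (t + 1) ^ 3)
      ![A 2, 2 * A 2 - A 1, A 0 - A 1 + A 2] := by
  have h1 := h.ne_neg_one
  refine ⟨fun d hd => ?_, ?_, ?_, ?_, ?_, ?_, ?_⟩
  · have d2 : d ∣ A 2 := hd 0
    have d1 : d ∣ A 1 := by
      have := (d2.mul_left 2).sub (hd 1)
      simpa using this
    have d0 : d ∣ A 0 := by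
      have d02 : d ∣ A 0 - A 1 + A 2 := hd 2
      have := (d02.add d1).sub d2
      rwa [show A 0 - A 1 + A 2 + A 1 - A 2 = A 0 by ring] at this
    refine h.primitive d fun i => ?_
    fin_cases i <;> assumption
  · rintro ⟨q, hq⟩
    refine h.irrational ⟨-1 / q - 1, ?_⟩
    rw [map_sub, map_div₀, hq]
    field_simp
    simp
  · have := h.root
    simp [quadForm] at this ⊢
    field_simp
    linear_combination this
  · have := h.eq
    simp only [sexticForm, hForm, bForm] at this ⊢
    rw [div_pow, this]
    field_simp
    ring
  · exact div_ne_zero (by norm_num) h1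
  · have : -1 / (t + 1) + 1 = t / (t + 1) := by field_simp; ring
    rw [this]
    exact div_ne_zero h.ne_zero h1
  · have : (-1 / (t + 1)) ^ 2 + -1 / (t + 1) + 1 = (t ^ 2 + t + 1) / (t + 1) ^ 2 := by
      field_simp; ring
    rw [this]
    exact div_ne_zero h.ne_omega (pow_ne_zero 2 h1)

theorem IsCurvePoint.false_of_odd {K : Type*} [Field K] [NumberField K]
    (hdeg : Module.finrank ℚ K = 2) {m : ℤ} (hm : m = 1 ∨ m = 2) {t y : K} {A : Fin 3 → ℤ}
    (h : IsCurvePoint m t y A) (hA1 : Odd (A 1)) : False := by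
  have ht := (minpoly.two_le_natDegree_iff (Algebra.IsIntegral.isIntegral (R := ℚ) t)).2
    h.irrational
  obtain ⟨d, u, v, hd0, hd⟩ := exists_intCast_mul_eq_add_mul hdeg h.irrational y
  obtain ⟨B, Q, hD⟩ := exists_descentDefect_of_root h.primitive ht h.root h.eq hd
  exact false_of_isDescentForm hm h.primitive (isDescentForm_of_odd h.primitive hA1
    (mul_ne_zero two_ne_zero hd0) hD) h.root h.ne_zero h.ne_neg_one h.ne_omega

theorem IsCurvePoint.false_of_even {K : Type*} [Field K] [NumberField K]
    (hdeg : Module.finrank ℚ K = 2) {m : ℤ} (hm : m = 1 ∨ m = 2) {t y : K} {A : Fin 3 → ℤ}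
    (h : IsCurvePoint m t y A) (hA0 : Even (A 0)) (hA1 : Even (A 1)) : False := by
  have ht := (minpoly.two_le_natDegree_iff (Algebra.IsIntegral.isIntegral (R := ℚ) t)).2
    h.irrational
  have h1 := h.ne_neg_one
  obtain ⟨d, u, v, hd0, hd⟩ := exists_intCast_mul_eq_add_mul hdeg h.irrational
    ((y - hForm t 1) / (2 * (t + 1)))
  obtain ⟨n, g, hg, hodd⟩ := exists_two_pow_mul_odd (f := ![-v, -u, d]) ⟨2, hd0⟩
  have e0 : -v = 2 ^ n * g 0 := hg 0
  have e1 : -u = 2 ^ n * g 1 := hg 1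
  have e2 : d = 2 ^ n * g 2 := hg 2
  refine false_of_even_even hm h.primitive ht h.root h.eq h.ne_zero h1 h.ne_omega hA0 hA1
    (α := g 0) (β := g 1) (κ := g 2) (fun h0 => hd0 (by rw [e2, h0, mul_zero])) ?_ ?_
  · simpa [Fin.exists_fin_succ] using hodd
  · have hn : (2 : K) ^ n ≠ 0 := pow_ne_zero n two_ne_zero
    refine (mul_eq_zero.1 (?_ : (2 : K) ^ n * _ = 0)).resolve_left hn
    have f0 := congrArg (Int.cast : ℤ → K) e0
    have f1 := congrArg (Int.cast : ℤ → K) e1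
    have f2 := congrArg (Int.cast : ℤ → K) e2
    push_cast at f0 f1 f2
    field_simp at hd
    linear_combination hd - (y - hForm t 1) * f2 - 2 * (t + 1) * t * f0 - 2 * (t + 1) * f1

/-- Over a quadratic field, the abscissa of a point of `y² = h(t)² + 4mb(t)²` is rational, apart
from the known exceptions. -/
theorem mem_range_of_sexticForm {K : Type*} [Field K] [NumberField K]
    (hdeg : Module.finrank ℚ K = 2) {m : ℤ} (hm : m = 1 ∨ m = 2) {t y : K}
    (hy : y ^ 2 = sexticForm (m : K) t 1) (h0 : t ≠ 0) (h1 : t + 1 ≠ 0)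
    (h3 : t ^ 2 + t + 1 ≠ 0) : t ∈ (algebraMap ℚ K).range := by
  by_contra hirr
  obtain ⟨d, u, v, hd0, hd⟩ := exists_intCast_mul_eq_add_mul hdeg hirr (t ^ 2)
  obtain ⟨g, A, hg, hA, hgA⟩ := exists_isPrimitiveForm (N := ![-u, -v, d])
    (fun h => hd0 (by simpa using congrFun h 2))
  have h : IsCurvePoint m t y A := by
    refine ⟨hA, hirr, ?_, hy, h0, h1, h3⟩
    have hg' : (g : K) ≠ 0 := by exact_mod_cast hg
    refine (mul_eq_zero.1 (?_ : (g : K) * _ = 0)).resolve_left hg'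
    have e0 : -u = g * A 0 := hgA 0
    have e1 : -v = g * A 1 := hgA 1
    have e2 : d = g * A 2 := hgA 2
    have f0 := congrArg (Int.cast : ℤ → K) e0
    have f1 := congrArg (Int.cast : ℤ → K) e1
    have f2 := congrArg (Int.cast : ℤ → K) e2
    push_cast at f0 f1 f2
    simp only [quadForm]
    linear_combination hd - f0 - t * f1 - t ^ 2 * f2
  rcases Int.even_or_odd (A 1) with hA1 | hA1
  · by_cases hA0 : Even (A 0)
    · exact h.false_of_even hdeg hm hA0 hA1
    have hr1 : Even (2 * A 2 - A 1) := (even_two_mul _).sub hA1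
    by_cases hA2 : Even (A 2)
    · exact h.rotate.false_of_even hdeg hm hA2 hr1
    · refine h.rotate.rotate.false_of_even hdeg hm ?_ ?_
      · simp [Int.even_add, Int.even_sub, hA0, hA1, hA2]
      · simp [Int.even_sub, hA1]
  · exact h.false_of_odd hdeg hm hA1

end

section

open Polynomial

theorem exists_cub_of_rat_root {t : ℚ} {p : ℤ[X]} (hp : p.natDegree ≤ 4) (hpt : aeval t p = 0) :
    ∃ Q : Fin 4 → ℤ, ∀ x, p.eval x = (t.den * x - t.num) * cubForm Q x 1 := by
  set a : ℤ[X] := C (t.den : ℤ) * X - C t.num with ha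
  have hden : (t.den : ℤ) ≠ 0 := by simp
  have hadeg : a.natDegree = 1 := by
    rw [ha]
    compute_degree!
  have hprim : a.IsPrimitive := fun r hr => by
    rw [C_dvd_iff_dvd_coeff] at hr
    have h0 := hr 0
    have h1 := hr 1
    simp [ha, coeff_X, coeff_C, -eq_intCast] at h0 h1
    exact (Int.isCoprime_iff_nat_coprime.2 t.reduced).isUnit_of_dvd' h0 h1
  have hat : aeval t a = 0 := by
    have := Rat.mul_den_eq_num t
    simp [ha, mul_comm, this]
  have hintegral : IsIntegral ℚ t := Algebra.IsIntegral.isIntegral t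
  obtain ⟨q, rfl⟩ := dvd_of_aeval_eq_zero hprim
    (hadeg.trans_le (minpoly.natDegree_pos hintegral)) hat hpt
  have hq : q.natDegree < 4 := by
    by_cases hq : q = 0
    · simp [hq]
    · rw [natDegree_mul hprim.ne_zero hq] at hp
      omega
  refine ⟨fun i => q.coeff i, fun x => ?_⟩
  rw [eval_mul, eval_eq_sum_range' hq]
  simp [ha, cubForm, Finset.sum_range_succ]

theorem isPrimitiveForm_of_isCoprime {A : Fin 3 → ℤ} {i j : Fin 3} (h : IsCoprime (A i) (A j)) :
    IsPrimitiveForm A := fun _ hd => h.isUnit_of_dvd' (hd i) (hd j)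

/-- The curve `y² = h(t)² + 4mb(t)²` has no rational points other than those with `t ∈ {0, -1, ∞}`. -/
theorem ne_sexticForm_of_rat {m : ℤ} (hm : m = 1 ∨ m = 2) {t y : ℚ} (h0 : t ≠ 0)
    (h1 : t + 1 ≠ 0) : y ^ 2 ≠ sexticForm (m : ℚ) t 1 := by
  intro hy
  have hcop : IsCoprime t.num t.den := Int.isCoprime_iff_nat_coprime.2 t.reduced
  have hden : (t.den : ℤ) ≠ 0 := by simp
  have hnum : t.num ≠ 0 := Rat.num_ne_zero.2 h0
  have hne : (t.den : ℤ) ≠ -t.num := by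
    intro h
    have h' : (t.den : ℚ) = -t.num := by exact_mod_cast h
    have := Rat.mul_den_eq_num t
    have hden' : (t.den : ℚ) ≠ 0 := by simp
    exact h1 ((mul_eq_zero.1 (by linear_combination this + h' :
      (t + 1) * (t.den : ℚ) = 0)).resolve_right hden')
  simp only [sexticForm] at hy
  rcases Nat.even_or_odd t.den with hq | hq
  · obtain ⟨w, hw⟩ : ∃ w, w = (y - hForm t 1) / t := ⟨_, rfl⟩
    have hwt : w * t = y - hForm t 1 := by rw [hw]; field_simp
    have hwd := Rat.mul_den_eq_num w
    obtain ⟨Q, hQ⟩ := exists_cub_of_rat_root (t := t) (p := C (w.num ^ 2) * X +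
      C (2 * w.den * w.num) * hPoly - C (4 * m * w.den ^ 2) * (X * (X + C 1) ^ 2))
      ((by rw [hPoly]; compute_degree : _ ≤ 3).trans (by norm_num)) (by
        refine (mul_eq_zero.1 (?_ : t * _ = 0)).resolve_left h0
        simp [hPoly, map_ofNat, -mul_eq_zero]
        rw [← hwd]
        have hy' : y = w * t + hForm t 1 := by linear_combination -hwt
        rw [hy'] at hy
        simp only [hForm, bForm] at hy
        linear_combination (w.den : ℚ) ^ 2 * hy)
    have hodd : Odd t.num := by
      rw [← Int.not_even_iff_odd]
      intro h
      have := hcop.isUnit_of_dvd' h.two_dvd (by exact_mod_cast hq.two_dvd)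
      rw [Int.isUnit_iff] at this
      omega
    have hA : IsPrimitiveForm ![0, -t.num, (t.den : ℤ)] :=
      isPrimitiveForm_of_isCoprime (i := 1) (j := 2) hcop.neg_left
    have hgood : IsDescentForm m ![0, -t.num, (t.den : ℤ)] := by
      refine isDescentForm_of_odd hA hodd.neg (k := 2 * w.den) (by simp)
        (B := ![0, w.num, 0, 0]) (C := ![Q 0, Q 1, Q 2, Q 3, 0])
        (descentDefect_eq_zero_of_eval_one fun x => ?_)
      have := hQ x
      simp [quadForm, quarForm, cubForm, hForm, bForm, hPoly] at this ⊢
      linear_combination -x * this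
    obtain ⟨T, hT, hAT⟩ := hgood.exists_torsionForm hm hA
    have t01 := hAT 0 1
    have t02 := hAT 0 2
    have t12 := hAT 1 2
    simp only [torsionForms, List.mem_cons, List.not_mem_nil, or_false] at hT
    rcases hT with rfl | rfl | rfl | rfl | rfl | rfl | rfl <;> simp [-Rat.num_eq_zero] at t01 t02 t12 <;> omega
  · obtain ⟨w, hw⟩ : ∃ w, w = y - hForm t 1 := ⟨_, rfl⟩
    have hwd := Rat.mul_den_eq_num w
    obtain ⟨Q, hQ⟩ := exists_cub_of_rat_root (t := t) (p := C (w.num ^ 2) +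
      C (2 * w.den * w.num) * hPoly - C (4 * m * w.den ^ 2) * bPoly ^ 2)
      (by rw [hPoly, bPoly]; compute_degree) (by
        simp [hPoly, bPoly, map_ofNat]
        rw [← hwd]
        have hy' : y = w + hForm t 1 := by linear_combination -hw
        rw [hy'] at hy
        simp only [hForm, bForm] at hy
        linear_combination (w.den : ℚ) ^ 2 * hy)
    have hA : IsPrimitiveForm ![-t.num, (t.den : ℤ), 0] :=
      isPrimitiveForm_of_isCoprime (i := 0) (j := 1) hcop.neg_left
    have hgood : IsDescentForm m ![-t.num, (t.den : ℤ), 0] := by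
      refine isDescentForm_of_odd hA ((Int.odd_coe_nat _).2 hq) (k := 2 * w.den) (by simp)
        (B := ![w.num, 0, 0, 0]) (C := ![Q 0, Q 1, Q 2, Q 3, 0])
        (descentDefect_eq_zero_of_eval_one fun x => ?_)
      have := hQ x
      simp [quadForm, quarForm, cubForm, hForm, bForm, hPoly, bPoly] at this ⊢
      linear_combination -this
    obtain ⟨T, hT, hAT⟩ := hgood.exists_torsionForm hm hA
    have t01 := hAT 0 1
    have t02 := hAT 0 2
    have t12 := hAT 1 2
    simp only [torsionForms, List.mem_cons, List.not_mem_nil, or_false] at hT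
    rcases hT with rfl | rfl | rfl | rfl | rfl | rfl | rfl <;> simp [-Rat.num_eq_zero] at t01 t02 t12 <;> omega

end

/-- The trace coordinate `t = x + f(x)` of a point of period three. -/
theorem HasExactPeriod.exists_trace {K : Type*} [Field K] {c x : K} (h : HasExactPeriod c 3 x) :
    ∃ t : K, t ≠ 0 ∧ t + 1 ≠ 0 ∧ t ^ 2 + t + 1 ≠ 0 ∧
      2 * x * (t * (t + 1)) = t ^ 3 + 2 * t ^ 2 + t + 1 ∧ c = t - x - x ^ 2 := by
  obtain ⟨h3, hj⟩ := h
  have h1 := hj 1 le_rfl (by norm_num)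
  have h2 := hj 2 (by norm_num) (by norm_num)
  simp only [Function.iterate_succ, Function.iterate_zero, Function.comp_apply, id_eq, fc]
    at h3 h1 h2
  obtain ⟨x₁, hx₁⟩ : ∃ x₁, x₁ = x ^ 2 + c := ⟨_, rfl⟩
  obtain ⟨x₂, hx₂⟩ : ∃ x₂, x₂ = x₁ ^ 2 + c := ⟨_, rfl⟩
  rw [← hx₁] at h1 h2 h3
  rw [← hx₂] at h2 h3
  have hd : x - x₁ ≠ 0 := sub_ne_zero.2 h1.symm
  have g₁ : x₁ - x₂ = (x - x₁) * (x + x₁) := by linear_combination hx₁ - hx₂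
  have g₂ : x₂ - x = (x₁ - x₂) * (x₁ + x₂) := by linear_combination hx₂ + h3
  have g₃ : x - x₁ = (x₂ - x) * (x₂ + x) := by linear_combination -h3 - hx₁
  have e₁ : (x + x₁) * (x₁ + x₂) = -(1 + (x + x₁)) := by
    refine mul_left_cancel₀ hd ?_
    linear_combination -(x₁ + x₂ + 1) * g₁ - g₂
  have e₂ : (x + x₁) * (x₁ + x₂) * (x₂ + x) = 1 := by
    refine mul_left_cancel₀ hd ?_
    linear_combination -(x₁ + x₂) * (x₂ + x) * g₁ - (x₂ + x) * g₂ - g₃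
  have ht0 : x + x₁ ≠ 0 := fun h0 => by simp [h0] at e₂
  refine ⟨x + x₁, ht0, fun h0 => ?_, fun h0 => ?_, ?_, ?_⟩
  · rw [add_comm 1, h0] at e₁
    simp [e₁] at e₂
  · refine h2 ?_
    have := mul_left_cancel₀ ht0 (by linear_combination e₁ - h0 :
      (x + x₁) * (x₁ + x₂) = (x + x₁) * (x + x₁))
    linear_combination this
  · linear_combination ((x + x₁) * (x₂ + x) - (x + x₁ + 1)) * e₁ - (x + x₁) * e₂
  · linear_combination -hx₁

theorem HasExactPeriod.rational_of_sq_eq {K : Type*} [Field K] [NumberField K]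
    (hdeg : Module.finrank ℚ K = 2) {m : ℤ} (hm : m = 1 ∨ m = 2) {c x r : K}
    (h : HasExactPeriod c 3 x) (hr : r ^ 2 = 4 * m - 7 - 4 * c) :
    (∃ q : ℚ, (q : K) = c) ∧ (∃ q : ℚ, (q : K) = x) ∧ ¬∃ q : ℚ, (q : K) = r := by
  obtain ⟨t, h0, h1, h3, hx, hc⟩ := h.exists_trace
  have hb : t * (t + 1) ≠ 0 := mul_ne_zero h0 h1
  have hy : (t * (t + 1) * r) ^ 2 = sexticForm (m : K) t 1 := by
    rw [mul_pow, hr, hc]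
    simp only [sexticForm, hForm, bForm]
    linear_combination (2 * x * (t * (t + 1)) + (t ^ 3 + 2 * t ^ 2 + t + 1) +
      2 * (t * (t + 1))) * hx
  obtain ⟨t, rfl⟩ := mem_range_of_sexticForm hdeg hm hy h0 h1 h3
  simp only [eq_ratCast] at *
  have hx' : x = (((t ^ 3 + 2 * t ^ 2 + t + 1) / (2 * (t * (t + 1))) : ℚ) : K) := by
    push_cast
    rw [eq_div_iff (mul_ne_zero two_ne_zero hb)]
    linear_combination hx
  obtain ⟨q, rfl⟩ : ∃ q : ℚ, (q : K) = x := ⟨_, hx'.symm⟩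
  refine ⟨⟨t - q - q ^ 2, by rw [hc]; push_cast; ring⟩, ⟨q, rfl⟩, ?_⟩
  rintro ⟨s, rfl⟩
  refine ne_sexticForm_of_rat hm (t := t) (y := t * (t + 1) * s) (by exact_mod_cast h0)
    (by exact_mod_cast h1) ?_
  simp only [sexticForm, hForm, bForm] at hy ⊢
  exact_mod_cast hy

theorem HasExactPeriod.sq_of_one {K : Type*} [Field K] {c p : K} (h : HasExactPeriod c 1 p) :
    (2 * p - 1) ^ 2 = 4 * 2 - 7 - 4 * c := by
  have := h.1
  simp only [Function.iterate_one, fc] at this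
  linear_combination 4 * this

theorem HasExactPeriod.sq_of_two {K : Type*} [Field K] {c p : K} (h : HasExactPeriod c 2 p) :
    (2 * p + 1) ^ 2 = 4 * 1 - 7 - 4 * c := by
  have h1 := h.2 1 le_rfl (by norm_num)
  have h2 := h.1
  simp only [Function.iterate_succ, Function.iterate_zero, Function.comp_apply, id_eq, fc] at h1 h2
  have : p ^ 2 + c + p + 1 = 0 := by
    refine (mul_eq_zero.1 (?_ : (p ^ 2 + c - p) * _ = 0)).resolve_left (sub_ne_zero.2 h1)
    linear_combination h2
  linear_combination 4 * this

theorem periods_1and3_2and3_rationality {K : Type*} [Field K] [NumberField K]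
    (hdeg : Module.finrank ℚ K = 2) (c : K) :
    ((∃ α : K, HasExactPeriod c 1 α) → (∃ β : K, HasExactPeriod c 3 β) →
      (∃ q : ℚ, (q : K) = c) ∧
      (∀ β : K, HasExactPeriod c 3 β → ∃ q : ℚ, (q : K) = β) ∧
      (∀ α : K, HasExactPeriod c 1 α → ¬∃ q : ℚ, (q : K) = α)) ∧
    ((∃ α : K, HasExactPeriod c 2 α) → (∃ β : K, HasExactPeriod c 3 β) →
      (∃ q : ℚ, (q : K) = c) ∧
      (∀ β : K, HasExactPeriod c 3 β → ∃ q : ℚ, (q : K) = β) ∧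
      (∀ α : K, HasExactPeriod c 2 α → ¬∃ q : ℚ, (q : K) = α)) := by
  refine ⟨fun ⟨α, hα⟩ ⟨β, hβ⟩ => ?_, fun ⟨α, hα⟩ ⟨β, hβ⟩ => ?_⟩
  · have key : ∀ α β : K, HasExactPeriod c 1 α → HasExactPeriod c 3 β → _ := fun α β hα hβ =>
      hβ.rational_of_sq_eq hdeg (m := 2) (Or.inr rfl) (hα.sq_of_one.trans (by push_cast; ring))
    refine ⟨(key α β hα hβ).1, fun β hβ => (key α β hα hβ).2.1, fun α hα => ?_⟩
    rintro ⟨q, rfl⟩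
    exact (key q β hα hβ).2.2 ⟨2 * q - 1, by push_cast; ring⟩
  · have key : ∀ α β : K, HasExactPeriod c 2 α → HasExactPeriod c 3 β → _ := fun α β hα hβ =>
      hβ.rational_of_sq_eq hdeg (m := 1) (Or.inl rfl) (hα.sq_of_two.trans (by push_cast; ring))
    refine ⟨(key α β hα hβ).1, fun β hβ => (key α β hα hβ).2.1, fun α hα => ?_⟩
    rintro ⟨q, rfl⟩
    exact (key q β hα hβ).2.2 ⟨2 * q + 1, by push_cast; ring⟩
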